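/- arXiv:1503.06634 — 2 statements merged into one kernel-verified Lean document; each statement's English description precedes it below -/
import Mathlib

section
/- Let q be a prime power and let g ∈ 𝔽_q[t] be monic of positive degree. There exist constants C > 0 and L, depending only on q and g, with the following property. Let ℓ ≥ L be a prime number, let r be a prime number dividing q^ℓ − 1 but not dividing q − 1, let M ∈ 𝔽_q[t] be monic and divisible by every prime divisor of g, and let β ∈ 𝔽_q[t] be coprime to M. Then the number of prime polynomials P of degree ℓ with P ≡ β (mod M) and g^{(q^ℓ − 1)/r} ≡ 1 (mod P) equals q^ℓ/(ℓ · r · Φ(M)) + E, where |E| ≤ C · q^{ℓ/2} · (1 + deg M)/ℓ. -/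
open Polynomial

/-- A polynomial over a finite field is "prime" if it is monic and irreducible. -/
def IsPrimePoly {F : Type} [Field F] (P : Polynomial F) : Prop :=
  P.Monic ∧ Irreducible P

/-- The Euler phi function for `𝔽_q[t]`: `Φ(f) = #(𝔽_q[t]/(f))^×`. -/
noncomputable def polyPhi (F : Type) [Field F] [Fintype F] (f : Polynomial F) : ℕ :=
  Nat.card ((Polynomial F ⧸ Ideal.span {f})ˣ)

namespace Carlitz

section TorsionPolynomial

variable {B : Type*} [CommRing B]

/-- The `m`-th iterate of the additive polynomial `Y ^ q + c Y`. -/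
noncomputable def iterPoly (q : ℕ) (c : B) : ℕ → B[X]
  | 0 => X
  | m + 1 => iterPoly q c m ^ q + C c * iterPoly q c m

/-- The polynomial of the primitive torsion points of level `m + 1` of `Y ^ q + c Y`. -/
noncomputable def torsPoly (q : ℕ) (c : B) (m : ℕ) : B[X] :=
  iterPoly q c m ^ (q - 1) + C c

/-- The degree of `torsPoly q c m`. -/
def torsDeg (q m : ℕ) : ℕ := q ^ m * (q - 1)

theorem torsDeg_pos {q : ℕ} (hq : 2 ≤ q) (m : ℕ) : 0 < torsDeg q m :=
  Nat.mul_pos (by positivity) (by omega)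

theorem iterPoly_map {B' : Type*} [CommRing B'] (f : B →+* B') (q : ℕ) (c : B) (m : ℕ) :
    (iterPoly q c m).map f = iterPoly q (f c) m := by
  induction m with
  | zero => simp [iterPoly]
  | succ m ih => simp [iterPoly, ih]

theorem torsPoly_map {B' : Type*} [CommRing B'] (f : B →+* B') (q : ℕ) (c : B) (m : ℕ) :
    (torsPoly q c m).map f = torsPoly q (f c) m := by
  simp [torsPoly, iterPoly_map]

theorem map_eval_torsPoly {B' : Type*} [CommRing B'] (f : B →+* B') (q : ℕ) (c : B) (m : ℕ)
    (y : B) : f ((torsPoly q c m).eval y) = (torsPoly q (f c) m).eval (f y) := by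
  rw [← torsPoly_map, eval_map, eval₂_hom]

theorem map_eval_iterPoly {B' : Type*} [CommRing B'] (f : B →+* B') (q : ℕ) (c : B) (m : ℕ)
    (y : B) : f ((iterPoly q c m).eval y) = (iterPoly q (f c) m).eval (f y) := by
  rw [← iterPoly_map, eval_map, eval₂_hom]

theorem iterPoly_monic_natDegree [Nontrivial B] {q : ℕ} (hq : 2 ≤ q) (c : B) (m : ℕ) :
    (iterPoly q c m).Monic ∧ (iterPoly q c m).natDegree = q ^ m := by
  induction m with
  | zero => simp [iterPoly, monic_X]
  | succ m ih =>
    have hpos : 0 < q ^ m := by positivity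
    have hmon : (iterPoly q c m ^ q).Monic := ih.1.pow q
    have hdeg : (iterPoly q c m ^ q).natDegree = q ^ (m + 1) := by
      rw [ih.1.natDegree_pow, ih.2, pow_succ, mul_comm]
    have hlt : (C c * iterPoly q c m).degree < (iterPoly q c m ^ q).degree := by
      rw [degree_eq_natDegree hmon.ne_zero, hdeg]
      refine lt_of_le_of_lt (degree_le_of_natDegree_le (natDegree_C_mul_le c _)) ?_
      rw [ih.2]
      exact_mod_cast Nat.pow_lt_pow_right (by omega) (Nat.lt_succ_self m)
    refine ⟨hmon.add_of_left hlt, ?_⟩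
    rw [iterPoly, natDegree_add_eq_left_of_degree_lt hlt, hdeg]

theorem torsPoly_monic_natDegree [Nontrivial B] {q : ℕ} (hq : 2 ≤ q) (c : B) (m : ℕ) :
    (torsPoly q c m).Monic ∧ (torsPoly q c m).natDegree = torsDeg q m := by
  obtain ⟨h1, h2⟩ := iterPoly_monic_natDegree hq c m
  have hmon : (iterPoly q c m ^ (q - 1)).Monic := h1.pow _
  have hdeg : (iterPoly q c m ^ (q - 1)).natDegree = torsDeg q m := by
    rw [h1.natDegree_pow, h2, mul_comm, torsDeg]
  have hlt : (C c).degree < (iterPoly q c m ^ (q - 1)).degree := by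
    rw [degree_eq_natDegree hmon.ne_zero, hdeg]
    exact lt_of_le_of_lt degree_C_le (by exact_mod_cast torsDeg_pos hq m)
  exact ⟨hmon.add_of_left hlt, by rw [torsPoly, natDegree_add_eq_left_of_degree_lt hlt, hdeg]⟩

theorem eval_iterPoly_succ (q : ℕ) (c : B) (m : ℕ) (y : B) :
    (iterPoly q c (m + 1)).eval y =
      (iterPoly q c m).eval y ^ q + c * (iterPoly q c m).eval y := by
  simp [iterPoly]

theorem eval_iterPoly_eq_zero {q : ℕ} (hq : 2 ≤ q) {c : B} {m : ℕ} {y : B}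
    (h : (torsPoly q c m).eval y = 0) {i : ℕ} (hi : m < i) : (iterPoly q c i).eval y = 0 := by
  induction i, hi using Nat.le_induction with
  | base =>
    simp only [torsPoly, eval_add, eval_pow, eval_C] at h
    obtain ⟨r, rfl⟩ := Nat.exists_eq_add_of_le' hq
    rw [eval_iterPoly_succ, show r + 2 = (r + 2 - 1) + 1 by omega, pow_succ, ← add_mul]
    rw [show r + 2 - 1 + 1 = r + 2 by omega, h, zero_mul]
  | succ i _ ih =>
    rw [eval_iterPoly_succ, ih, zero_pow (by omega), mul_zero, add_zero]

theorem coeff_zero_iterPoly {q : ℕ} (hq : 2 ≤ q) (c : B) (m : ℕ) :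
    (iterPoly q c m).coeff 0 = 0 := by
  induction m with
  | zero => simp [iterPoly]
  | succ m ih =>
    rw [coeff_zero_eq_eval_zero] at ih ⊢
    rw [eval_iterPoly_succ, ih, zero_pow (by omega), mul_zero, add_zero]

theorem coeff_zero_torsPoly {q : ℕ} (hq : 2 ≤ q) (c : B) (m : ℕ) :
    (torsPoly q c m).coeff 0 = c := by
  have := coeff_zero_iterPoly hq c m
  rw [coeff_zero_eq_eval_zero] at this ⊢
  simp [torsPoly, this, zero_pow (show q - 1 ≠ 0 by omega)]

theorem iterPoly_zero (q m : ℕ) : iterPoly q (0 : B) m = X ^ q ^ m := by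
  induction m with
  | zero => simp [iterPoly]
  | succ m ih => simp [iterPoly, ih, ← pow_mul, pow_succ]

theorem torsPoly_zero (q m : ℕ) : torsPoly q (0 : B) m = X ^ torsDeg q m := by
  simp [torsPoly, iterPoly_zero, torsDeg, pow_mul]

theorem derivative_iterPoly {q : ℕ} (hq : (q : B) = 0) (c : B) (m : ℕ) :
    derivative (iterPoly q c m) = C (c ^ m) := by
  induction m with
  | zero => simp [iterPoly]
  | succ m ih =>
    simp [iterPoly, derivative_pow, ih, hq, pow_succ, mul_comm]

/-- Roots of the torsion polynomial at a unit `c` are simple. -/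
theorem isUnit_eval_derivative_torsPoly {q : ℕ} (hq2 : 2 ≤ q) (hq : (q : B) = 0) {c : B} {m : ℕ}
    (hc : IsUnit c) {y : B} (hy : (torsPoly q c m).eval y = 0) :
    IsUnit ((derivative (torsPoly q c m)).eval y) := by
  obtain ⟨r, rfl⟩ := Nat.exists_eq_add_of_le' hq2
  have hr : ((r + 2 - 1 : ℕ) : B) = -1 := by
    rw [show r + 2 - 1 = r + 1 by omega]
    push_cast at hq ⊢
    linear_combination hq
  have hx : (iterPoly (r + 2) c m).eval y ^ (r + 1) = -c := by
    simp only [torsPoly, eval_add, eval_pow, eval_C] at hy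
    exact eq_neg_of_add_eq_zero_left hy
  have hux : IsUnit ((iterPoly (r + 2) c m).eval y) :=
    (isUnit_pow_iff (Nat.succ_ne_zero r)).1 (hx ▸ hc.neg)
  simp only [torsPoly, derivative_add, derivative_pow, derivative_iterPoly hq, derivative_C,
    add_zero, eval_mul, eval_pow, eval_C, hr]
  exact (isUnit_one.neg.mul (hux.pow _)).mul (hc.pow m)

theorem isEisensteinAt_torsPoly {K : Type*} [Field K] {q : ℕ} (hq : 2 ≤ q) (m : ℕ) :
    (torsPoly q (PowerSeries.X : PowerSeries K) m).IsEisensteinAt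
      (Ideal.span {PowerSeries.X}) := by
  obtain ⟨h1, h2⟩ := torsPoly_monic_natDegree hq (PowerSeries.X : PowerSeries K) m
  have hprime : (Ideal.span {(PowerSeries.X : PowerSeries K)}).IsPrime :=
    PowerSeries.span_X_isPrime
  refine ⟨?_, ?_, ?_⟩
  · rw [h1.leadingCoeff]
    exact fun h => hprime.ne_top ((Ideal.eq_top_iff_one _).2 h)
  · intro n hn
    have h3 := torsPoly_map
      (PowerSeries.constantCoeff : PowerSeries K →+* K) q PowerSeries.X m
    rw [PowerSeries.constantCoeff_X, torsPoly_zero] at h3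
    have h4 := congrArg (fun P => coeff P n) h3
    simp only [coeff_map, coeff_X_pow] at h4
    rw [if_neg (by omega)] at h4
    rwa [Ideal.mem_span_singleton, PowerSeries.X_dvd_iff]
  · rw [coeff_zero_torsPoly hq, Ideal.span_singleton_pow, Ideal.mem_span_singleton,
      PowerSeries.X_pow_dvd_iff]
    intro h
    simpa using h 1 (by omega)

theorem prime_torsPoly {K : Type*} [Field K] {q : ℕ} (hq : 2 ≤ q) (m : ℕ) :
    Prime (torsPoly q (PowerSeries.X : PowerSeries K) m) := by
  obtain ⟨h1, h2⟩ := torsPoly_monic_natDegree hq (PowerSeries.X : PowerSeries K) m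
  exact ((isEisensteinAt_torsPoly hq m).irreducible PowerSeries.span_X_isPrime h1.isPrimitive
    (h2 ▸ torsDeg_pos hq m)).prime

/-- A bivariate polynomial of total degree at most `D`. -/
def TotalDegreeLE {K : Type*} [Field K] (D : ℕ) (P : K[X][X]) : Prop :=
  ∀ i j, (P.coeff i).coeff j ≠ 0 → i + j ≤ D

namespace TotalDegreeLE

variable {K : Type*} [Field K] {D D' : ℕ} {P P' : K[X][X]}

theorem mono (h : TotalDegreeLE D P) (hD : D ≤ D') : TotalDegreeLE D' P :=
  fun i j hij => (h i j hij).trans hD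

theorem add (h : TotalDegreeLE D P) (h' : TotalDegreeLE D P') : TotalDegreeLE D (P + P') := by
  intro i j hij
  rw [coeff_add, coeff_add] at hij
  by_cases h0 : (P.coeff i).coeff j = 0
  · exact h' i j (by simpa [h0] using hij)
  · exact h i j h0

theorem mul (h : TotalDegreeLE D P) (h' : TotalDegreeLE D' P') :
    TotalDegreeLE (D + D') (P * P') := by
  intro i j hij
  rw [coeff_mul, finsetSum_coeff] at hij
  obtain ⟨u, hu, hu0⟩ := Finset.exists_ne_zero_of_sum_ne_zero hij
  rw [coeff_mul] at hu0
  obtain ⟨v, hv, hv0⟩ := Finset.exists_ne_zero_of_sum_ne_zero hu0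
  rw [Finset.HasAntidiagonal.mem_antidiagonal] at hu hv
  have h1 := h u.1 v.1 (left_ne_zero_of_mul hv0)
  have h2 := h' u.2 v.2 (right_ne_zero_of_mul hv0)
  omega

theorem pow (h : TotalDegreeLE D P) (n : ℕ) : TotalDegreeLE (n * D) (P ^ n) := by
  induction n with
  | zero =>
    intro i j hij
    rw [pow_zero, coeff_one] at hij
    split_ifs at hij with h0
    · rw [coeff_one] at hij
      split_ifs at hij with h1
      · omega
      · exact absurd rfl hij
    · simp at hij
  | succ n ih => rw [pow_succ, Nat.succ_mul]; exact ih.mul h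

theorem C_X_sub_C (a : K) : TotalDegreeLE 1 (C (X - C a) : K[X][X]) := by
  intro i j hij
  rw [coeff_C] at hij
  split_ifs at hij with h0
  · by_contra hlt
    rw [coeff_eq_zero_of_natDegree_lt (by rw [natDegree_X_sub_C]; omega)] at hij
    exact hij rfl
  · simp at hij

theorem iterPoly {q : ℕ} (hq : 2 ≤ q) (a : K) (m : ℕ) :
    TotalDegreeLE (q ^ m) (iterPoly q (X - C a) m) := by
  induction m with
  | zero =>
    intro i j hij
    rw [Carlitz.iterPoly, coeff_X] at hij
    split_ifs at hij with h0
    · rw [coeff_one] at hij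
      split_ifs at hij with h1
      · simp; omega
      · exact absurd rfl hij
    · simp at hij
  | succ m ih =>
    rw [Carlitz.iterPoly]
    refine TotalDegreeLE.add ?_ ?_
    · rw [pow_succ, mul_comm]; exact ih.pow q
    · refine ((C_X_sub_C a).mul ih).mono ?_
      have : 1 ≤ q ^ m := Nat.one_le_pow _ _ (by omega)
      rw [pow_succ]; nlinarith

theorem torsPoly {q : ℕ} (hq : 2 ≤ q) (a : K) (m : ℕ) :
    TotalDegreeLE (torsDeg q m) (torsPoly q (X - C a) m) := by
  refine TotalDegreeLE.add ?_ ((C_X_sub_C a).mono (torsDeg_pos hq m))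
  rw [torsDeg, mul_comm]
  exact (TotalDegreeLE.iterPoly hq a m).pow _

end TotalDegreeLE

end TorsionPolynomial

section Tower

variable {K : Type} [Field K]

/-- `T` is the universal `K`-algebra generated by `θ` and, for each place `a i` with `i ∈ S`,
a primitive torsion point `y i` of level `m i + 1` of the Carlitz module of `θ - a i`. -/
structure IsTower {ι : Type} (q : ℕ) (a : ι → K) (m : ι → ℕ) (S : Finset ι) (T : Type)
    [CommRing T] [Algebra K T] (θ : T) (y : ι → T) : Prop where
  root : ∀ i ∈ S, (torsPoly q (θ - algebraMap K T (a i)) (m i)).eval (y i) = 0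
  lift : ∀ (B : Type) [CommRing B] [Algebra K B] (ϑ : B) (η : ι → B),
    (∀ i ∈ S, (torsPoly q (ϑ - algebraMap K B (a i)) (m i)).eval (η i) = 0) →
      ∃ φ : T →ₐ[K] B, φ θ = ϑ ∧ ∀ i ∈ S, φ (y i) = η i
  integral : (aeval θ : K[X] →ₐ[K] T).toRingHom.IsIntegral
  injective : Function.Injective (aeval θ : K[X] →ₐ[K] T)

theorem aeval_X_add_C_powerSeries (c : K) (p : K[X]) :
    aeval (algebraMap K (PowerSeries K) c + PowerSeries.X) p =
      ((p.comp (C c + X) : K[X]) : PowerSeries K) := by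
  have h : (aeval (algebraMap K (PowerSeries K) c + PowerSeries.X) : K[X] →ₐ[K] PowerSeries K) =
      (coeToPowerSeries.algHom K).comp (aeval (C c + X)) := by
    ext
    simp [coeToPowerSeries.algHom_apply]
  rw [h, AlgHom.comp_apply, coeToPowerSeries.algHom_apply, ← comp_eq_aeval]
  simp

theorem aeval_X_add_C_powerSeries_injective (c : K) :
    Function.Injective
      (aeval (algebraMap K (PowerSeries K) c + PowerSeries.X) : K[X] →ₐ[K] PowerSeries K) := by
  rw [injective_iff_map_eq_zero]
  intro p hp
  rw [aeval_X_add_C_powerSeries, coe_eq_zero_iff] at hp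
  have := congrArg (fun r => r.comp (X - C c)) hp
  simpa [comp_assoc] using this

/-- Simple roots of the torsion polynomials lift to power series. -/
theorem exists_root_powerSeries {q : ℕ} (hq2 : 2 ≤ q) (hq : (q : K) = 0) {c : K} (hc : c ≠ 0)
    (m : ℕ) {u : PowerSeries K} (hu : PowerSeries.constantCoeff u = c) {y₀ : K}
    (hy₀ : (torsPoly q c m).eval y₀ = 0) :
    ∃ y : PowerSeries K, (torsPoly q u m).eval y = 0 ∧ PowerSeries.constantCoeff y = y₀ := by
  have hmem : ∀ x : PowerSeries K, x ∈ Ideal.span {(PowerSeries.X : PowerSeries K)} ↔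
      PowerSeries.constantCoeff x = 0 := fun x => by
    rw [Ideal.mem_span_singleton, PowerSeries.X_dvd_iff]
  obtain ⟨y, hy1, hy2⟩ := HenselianRing.is_henselian
    (I := Ideal.span {(PowerSeries.X : PowerSeries K)}) (torsPoly q u m)
    (torsPoly_monic_natDegree hq2 u m).1 (PowerSeries.C y₀)
    (by rw [hmem, map_eval_torsPoly, hu, PowerSeries.constantCoeff_C, hy₀])
    (by
      refine IsUnit.map _ ?_
      rw [PowerSeries.isUnit_iff_constantCoeff]
      rw [← coe_evalRingHom, ← RingHom.comp_apply]
      have h := isUnit_eval_derivative_torsPoly hq2 hq (m := m) hc.isUnit hy₀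
      rw [← hu, ← torsPoly_map, derivative_map, eval_map] at h
      convert h using 1
      rw [RingHom.comp_apply, coe_evalRingHom]
      conv_rhs => rw [show y₀ = PowerSeries.constantCoeff (PowerSeries.C y₀) by simp,
        eval₂_hom])
  refine ⟨y, hy1, ?_⟩
  rw [hmem, map_sub, PowerSeries.constantCoeff_C] at hy2
  exact sub_eq_zero.1 hy2

theorem exists_root_torsPoly [IsAlgClosed K] {q : ℕ} (hq2 : 2 ≤ q) (c : K) (m : ℕ) :
    ∃ y, (torsPoly q c m).eval y = 0 := by
  obtain ⟨h1, h2⟩ := torsPoly_monic_natDegree hq2 c m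
  refine IsAlgClosed.exists_root _ ?_
  rw [degree_eq_natDegree h1.ne_zero, h2]
  exact_mod_cast (torsDeg_pos hq2 m).ne'

theorem isTower_empty {ι : Type} (q : ℕ) (a : ι → K) (m : ι → ℕ) :
    IsTower q a m ∅ K[X] X (fun _ => 0) where
  root := by simp
  lift B _ _ ϑ η _ := ⟨aeval ϑ, by simp, by simp⟩
  integral := by
    intro x
    have : (aeval (X : K[X]) : K[X] →ₐ[K] K[X]).toRingHom = RingHom.id _ := by
      ext <;> simp
    rw [this]
    exact ⟨X - C x, monic_X_sub_C x, by simp⟩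
  injective := by
    intro p q h
    simpa using h

theorem prime_of_map_prime {T R : Type*} [CommRing T] [IsDomain T] [CommRing R] (φ : T →+* R)
    (hφ : Function.Injective φ) {f : T[X]} (hf : f.Monic) (h : Prime (f.map φ)) : Prime f := by
  refine ⟨hf.ne_zero, fun hu => h.not_isUnit (hu.map (mapRingHom φ)), fun u v huv => ?_⟩
  rw [← map_dvd_map φ hφ hf, Polynomial.map_mul] at huv
  rw [← map_dvd_map φ hφ hf, ← map_dvd_map φ hφ hf]
  exact h.dvd_or_dvd huv

/-- An algebra homomorphism out of an integral tower is injective as soon as its value at `θ` is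
transcendental. -/
theorem IsTower.injective_of_aeval {ι : Type} {q : ℕ} {a : ι → K} {m : ι → ℕ} {S : Finset ι}
    {T : Type} [CommRing T] [IsDomain T] [Algebra K T] {θ : T} {y : ι → T}
    (hT : IsTower q a m S T θ y) {B : Type} [CommRing B] [Algebra K B] (φ : T →ₐ[K] B)
    (h : Function.Injective (aeval (φ θ) : K[X] →ₐ[K] B)) : Function.Injective φ := by
  let _ : Algebra K[X] T := (aeval θ : K[X] →ₐ[K] T).toRingHom.toAlgebra
  have : Algebra.IsIntegral K[X] T := ⟨hT.integral⟩
  have hker : RingHom.ker φ.toRingHom = ⊥ := by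
    refine Ideal.eq_bot_of_comap_eq_bot (R := K[X]) ?_
    rw [eq_bot_iff]
    intro p hp
    have hp' : φ (aeval θ p) = 0 := hp
    rw [← aeval_algHom_apply, map_eq_zero_iff _ h] at hp'
    simpa using hp'
  exact (RingHom.injective_iff_ker_eq_bot φ.toRingHom).2 hker

theorem exists_isTower [IsAlgClosed K] {ι : Type} [DecidableEq ι] {q : ℕ} (hq2 : 2 ≤ q)
    (hq : (q : K) = 0) {a : ι → K} (ha : Function.Injective a) (m : ι → ℕ) (S : Finset ι) :
    ∃ (T : Type) (_ : CommRing T) (_ : IsDomain T) (_ : Algebra K T) (θ : T) (y : ι → T),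
      IsTower q a m S T θ y := by
  induction S using Finset.induction_on with
  | empty => exact ⟨K[X], inferInstance, inferInstance, inferInstance, X, _, isTower_empty q a m⟩
  | insert j S hj ih =>
    obtain ⟨T, _, _, _, θ, y, hT⟩ := ih
    set f : T[X] := torsPoly q (θ - algebraMap K T (a j)) (m j) with hf
    have hmon : f.Monic := (torsPoly_monic_natDegree hq2 _ _).1
    have hroots : ∀ i, ∃ z : PowerSeries K, i ∈ S →
        (torsPoly q (algebraMap K (PowerSeries K) (a j) + PowerSeries.X -
          algebraMap K (PowerSeries K) (a i)) (m i)).eval z = 0 := by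
      intro i
      by_cases hi : i ∈ S
      · have hc : a j - a i ≠ 0 := sub_ne_zero.2 (ha.ne (fun h => hj (h ▸ hi)))
        obtain ⟨y₀, hy₀⟩ := exists_root_torsPoly hq2 (a j - a i) (m i)
        obtain ⟨z, hz, -⟩ := exists_root_powerSeries hq2 hq hc (m i)
          (u := algebraMap K (PowerSeries K) (a j) + PowerSeries.X -
            algebraMap K (PowerSeries K) (a i)) (by simp) hy₀
        exact ⟨z, fun _ => hz⟩
      · exact ⟨0, fun h => absurd h hi⟩
    choose z hz using hroots
    obtain ⟨φ, hφ, -⟩ := hT.lift (PowerSeries K) _ z (fun i hi => hz i hi)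
    have hφinj : Function.Injective φ := hT.injective_of_aeval φ (by
      rw [hφ]; exact aeval_X_add_C_powerSeries_injective _)
    have hprime : Prime f := by
      refine prime_of_map_prime φ.toRingHom hφinj hmon ?_
      have : φ.toRingHom (θ - algebraMap K T (a j)) = PowerSeries.X := by
        change φ _ = _
        rw [map_sub, hφ, AlgHom.commutes, add_sub_cancel_left]
      rw [hf, torsPoly_map, this]
      exact prime_torsPoly hq2 (m j)
    have hdom := AdjoinRoot.isDomain_of_prime hprime
    have hofinj : Function.Injective (AdjoinRoot.of f) :=
      AdjoinRoot.of.injective_of_degree_ne_zero (by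
        rw [degree_eq_natDegree hmon.ne_zero, (torsPoly_monic_natDegree hq2 _ _).2]
        exact_mod_cast (torsDeg_pos hq2 _).ne')
    have halg : ∀ c : K, algebraMap K (AdjoinRoot f) c = AdjoinRoot.of f (algebraMap K T c) := by
      intro c
      rw [AdjoinRoot.algebraMap_eq']
      rfl
    have haev : ∀ p : K[X], aeval (AdjoinRoot.of f θ) p = AdjoinRoot.of f (aeval θ p) := by
      intro p
      rw [aeval_def, aeval_def, hom_eval₂]
      congr 1
    refine ⟨AdjoinRoot f, inferInstance, hdom, inferInstance, AdjoinRoot.of f θ,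
      Function.update (fun i => AdjoinRoot.of f (y i)) j (AdjoinRoot.root f), ?_, ?_, ?_, ?_⟩
    · intro i hi
      by_cases hij : i = j
      · subst hij
        rw [Function.update_self, halg, ← map_sub, ← torsPoly_map, eval_map]
        exact AdjoinRoot.eval₂_root f
      · rw [Function.update_of_ne hij, halg, ← map_sub, ← map_eval_torsPoly,
          hT.root i ((Finset.mem_insert.1 hi).resolve_left hij), map_zero]
    · intro B _ _ ϑ η hη
      obtain ⟨ψ, hψθ, hψy⟩ := hT.lift B ϑ η (fun i hi => hη i (Finset.mem_insert_of_mem hi))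
      have h0 : eval₂ (ψ : T →+* B) (η j) f = 0 := by
        have h1 := hη j (Finset.mem_insert_self _ _)
        rw [← eval_map, hf, torsPoly_map]
        convert h1 using 3
        simp [hψθ]
      refine ⟨AdjoinRoot.liftAlgHom f ψ (η j) h0, ?_, ?_⟩
      · rw [AdjoinRoot.liftAlgHom_of, hψθ]
      · intro i hi
        by_cases hij : i = j
        · subst hij
          rw [Function.update_self, AdjoinRoot.liftAlgHom_root]
        · rw [Function.update_of_ne hij, AdjoinRoot.liftAlgHom_of,
            hψy i ((Finset.mem_insert.1 hi).resolve_left hij)]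
    · have h1 : (aeval (AdjoinRoot.of f θ) : K[X] →ₐ[K] AdjoinRoot f).toRingHom =
          (AdjoinRoot.of f).comp (aeval θ : K[X] →ₐ[K] T).toRingHom := by
        ext p
        · simp [halg]
        · simp
      rw [h1]
      refine hT.integral.trans _ _ ?_
      have := hmon.finite_adjoinRoot
      exact fun x => Algebra.IsIntegral.isIntegral (R := T) x
    · intro p p' h
      rw [haev, haev] at h
      exact hT.injective (hofinj h)

end Tower

section Filtration

variable {K : Type} [Field K] {ι : Type} [Fintype ι] [DecidableEq ι]

/-- Exponents of the reduced monomials. -/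
abbrev Idx (q : ℕ) (m : ι → ℕ) : Type := ∀ i, Fin (torsDeg q (m i))

/-- Total degree of a reduced exponent. -/
def size {q : ℕ} {m : ι → ℕ} (I : Idx q m) : ℕ := ∑ i, (I i : ℕ)

/-- The reduced monomials of total degree at most `D`. -/
def monoms (q : ℕ) (m : ι → ℕ) (D : ℕ) : Finset (Σ _ : Idx q m, ℕ) :=
  Finset.univ.sigma fun I => Finset.range (D + 1 - size I)

theorem mem_monoms {q : ℕ} {m : ι → ℕ} {D : ℕ} {x : Σ _ : Idx q m, ℕ} :
    x ∈ monoms q m D ↔ x.2 + size x.1 ≤ D := by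
  simp only [monoms, Finset.mem_sigma, Finset.mem_univ, true_and, Finset.mem_range]
  omega

theorem card_idx (q : ℕ) (m : ι → ℕ) : Fintype.card (Idx q m) = ∏ i, torsDeg q (m i) := by
  simp

theorem card_monoms_le (q : ℕ) (m : ι → ℕ) (D : ℕ) :
    (monoms q m D).card ≤ (∏ i, torsDeg q (m i)) * (D + 1) := by
  rw [monoms, Finset.card_sigma, ← card_idx, ← Finset.card_univ, ← smul_eq_mul]
  refine Finset.sum_le_card_nsmul _ _ _ fun I _ => ?_
  rw [Finset.card_range]
  omega

theorem le_card_monoms (q : ℕ) (m : ι → ℕ) (D : ℕ) :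
    (∏ i, torsDeg q (m i)) * (D + 1) ≤ (monoms q m D).card + ∑ I : Idx q m, size I := by
  rw [monoms, Finset.card_sigma, ← card_idx, ← Finset.card_univ, ← Finset.sum_add_distrib,
    ← smul_eq_mul]
  refine Finset.card_nsmul_le_sum _ _ _ fun I _ => ?_
  rw [Finset.card_range]
  omega

theorem card_monoms_add_le (q : ℕ) (m : ι → ℕ) (A D : ℕ) :
    (monoms q m (A + D)).card ≤ (monoms q m D).card + (∏ i, torsDeg q (m i)) * A := by
  rw [monoms, monoms, Finset.card_sigma, Finset.card_sigma, ← card_idx, ← Finset.card_univ,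
    ← smul_eq_mul, ← Finset.sum_const, ← Finset.sum_add_distrib]
  refine Finset.sum_le_sum fun I _ => ?_
  rw [Finset.card_range, Finset.card_range]
  omega

variable {T : Type} [CommRing T] [Algebra K T]

/-- The monomial with given exponents. -/
def monom {q : ℕ} {m : ι → ℕ} (θ : T) (y : ι → T) (x : Σ _ : Idx q m, ℕ) : T :=
  θ ^ x.2 * ∏ i, y i ^ (x.1 i : ℕ)

/-- The span of the reduced monomials of total degree at most `D`. -/
def filt (K : Type) [Field K] {T : Type} [CommRing T] [Algebra K T] (q : ℕ) (m : ι → ℕ) (θ : T)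
    (y : ι → T) (D : ℕ) : Submodule K T :=
  Submodule.span K (monom (q := q) (m := m) θ y '' (monoms q m D : Set (Σ _ : Idx q m, ℕ)))

variable {q : ℕ} {m : ι → ℕ} {θ : T} {y : ι → T} {D : ℕ}

theorem monom_mem_filt {x : Σ _ : Idx q m, ℕ} (hx : x.2 + size x.1 ≤ D) :
    monom θ y x ∈ filt K q m θ y D :=
  Submodule.subset_span ⟨x, mem_monoms.2 hx, rfl⟩

theorem filt_mono {D' : ℕ} (h : D ≤ D') : filt K q m θ y D ≤ filt K q m θ y D' :=
  Submodule.span_mono (Set.image_mono fun _ hx => mem_monoms.2 ((mem_monoms.1 hx).trans h))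

theorem filt_induction {D' : ℕ} (u : T)
    (h : ∀ x : Σ _ : Idx q m, ℕ, x.2 + size x.1 ≤ D → u * monom θ y x ∈ filt K q m θ y D')
    {f : T} (hf : f ∈ filt K q m θ y D) : u * f ∈ filt K q m θ y D' := by
  induction hf using Submodule.span_induction with
  | mem z hz =>
    obtain ⟨x, hx, rfl⟩ := hz
    exact h x (mem_monoms.1 hx)
  | zero => rw [mul_zero]; exact Submodule.zero_mem _
  | add z w _ _ hz hw => rw [mul_add]; exact Submodule.add_mem _ hz hw
  | smul c z _ hz => rw [mul_smul_comm]; exact Submodule.smul_mem _ c hz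

theorem theta_mul_mem_filt {f : T} (hf : f ∈ filt K q m θ y D) :
    θ * f ∈ filt K q m θ y (D + 1) := by
  refine filt_induction θ (fun x hx => ?_) hf
  have : θ * monom θ y x = monom θ y (⟨x.1, x.2 + 1⟩ : Σ _ : Idx q m, ℕ) := by
    simp only [monom]; ring
  rw [this]
  exact monom_mem_filt (by dsimp only; omega)

theorem theta_pow_mul_mem_filt {f : T} (hf : f ∈ filt K q m θ y D) (b : ℕ) :
    θ ^ b * f ∈ filt K q m θ y (D + b) := by
  induction b with
  | zero => simpa using hf
  | succ b ih =>
    rw [pow_succ', mul_assoc]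
    exact theta_mul_mem_filt ih

theorem aeval_mul_mem_filt {f : T} (hf : f ∈ filt K q m θ y D) {p : K[X]} {n : ℕ}
    (hp : p.natDegree ≤ n) : aeval θ p * f ∈ filt K q m θ y (D + n) := by
  rw [aeval_eq_sum_range' (Nat.lt_succ_of_le hp), Finset.sum_mul]
  refine Submodule.sum_mem _ fun b hb => ?_
  rw [smul_mul_assoc]
  refine Submodule.smul_mem _ _ (filt_mono ?_ (theta_pow_mul_mem_filt hf b))
  have := Finset.mem_range.1 hb
  omega

variable {a : ι → K}

omit [Fintype ι] [DecidableEq ι] in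
theorem pow_torsDeg_eq (hq2 : 2 ≤ q) {i : ι}
    (h : (torsPoly q (θ - algebraMap K T (a i)) (m i)).eval (y i) = 0) :
    y i ^ torsDeg q (m i) = -∑ k ∈ Finset.range (torsDeg q (m i)),
      aeval θ ((torsPoly q (X - C (a i)) (m i)).coeff k) * y i ^ k := by
  obtain ⟨h1, h2⟩ := torsPoly_monic_natDegree hq2 (X - C (a i)) (m i)
  have h3 : eval₂ (aeval θ : K[X] →ₐ[K] T).toRingHom (y i) (torsPoly q (X - C (a i)) (m i)) =
      0 := by
    rw [← eval_map, torsPoly_map]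
    convert h using 3
    simp
  rw [eval₂_eq_sum_range, h2, Finset.sum_range_succ] at h3
  have h4 : (torsPoly q (X - C (a i)) (m i)).coeff (torsDeg q (m i)) = 1 := by
    rw [← h2]; exact h1.coeff_natDegree
  rw [h4, map_one, one_mul] at h3
  exact eq_neg_of_add_eq_zero_right h3

theorem natDegree_coeff_torsPoly_le (hq2 : 2 ≤ q) (c : K) (n k : ℕ) :
    ((torsPoly q (X - C c) n).coeff k).natDegree ≤ torsDeg q n - k := by
  rw [natDegree_le_iff_coeff_eq_zero]
  intro j hj
  by_contra h
  have := TotalDegreeLE.torsPoly hq2 c n k j h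
  omega

theorem y_mul_mem_filt (hq2 : 2 ≤ q) {i : ι}
    (h : (torsPoly q (θ - algebraMap K T (a i)) (m i)).eval (y i) = 0) {f : T}
    (hf : f ∈ filt K q m θ y D) : y i * f ∈ filt K q m θ y (D + 1) := by
  refine filt_induction (y i) (fun x hx => ?_) hf
  obtain ⟨I, b⟩ := x
  dsimp only at hx
  have hupd : ∀ k : Fin (torsDeg q (m i)), ∏ j, y j ^ (Function.update I i k j : ℕ) =
      y i ^ (k : ℕ) * ∏ j ∈ Finset.univ.erase i, y j ^ (I j : ℕ) := by
    intro k
    rw [← Finset.mul_prod_erase _ _ (Finset.mem_univ i), Function.update_self]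
    congr 1
    exact Finset.prod_congr rfl fun j hj => by
      rw [Function.update_of_ne (Finset.ne_of_mem_erase hj)]
  have hsize : ∀ k : Fin (torsDeg q (m i)), size (Function.update I i k) =
      (k : ℕ) + ∑ j ∈ Finset.univ.erase i, (I j : ℕ) := by
    intro k
    rw [size, ← Finset.add_sum_erase _ _ (Finset.mem_univ i), Function.update_self]
    congr 1
    exact Finset.sum_congr rfl fun j hj => by
      rw [Function.update_of_ne (Finset.ne_of_mem_erase hj)]
  have hI := hupd (I i)
  have hsI := hsize (I i)
  rw [Function.update_eq_self] at hI hsI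
  have hmon : y i * monom θ y (⟨I, b⟩ : Σ _ : Idx q m, ℕ) =
      θ ^ b * (y i ^ ((I i : ℕ) + 1) * ∏ j ∈ Finset.univ.erase i, y j ^ (I j : ℕ)) := by
    simp only [monom, hI]; ring
  rw [hmon]
  have hlt := (I i).isLt
  rcases Nat.lt_or_ge ((I i : ℕ) + 1) (torsDeg q (m i)) with hcase | hcase
  · have := hupd ⟨(I i : ℕ) + 1, hcase⟩
    dsimp only at this
    rw [← this]
    refine monom_mem_filt (x := ⟨Function.update I i ⟨(I i : ℕ) + 1, hcase⟩, b⟩) ?_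
    dsimp only
    rw [hsize]
    dsimp only
    omega
  · have heq : (I i : ℕ) + 1 = torsDeg q (m i) := by omega
    rw [heq, pow_torsDeg_eq hq2 h, neg_mul, mul_neg, Finset.sum_mul, Finset.mul_sum]
    refine Submodule.neg_mem _ (Submodule.sum_mem _ fun k hk => ?_)
    have hk' := Finset.mem_range.1 hk
    have := hupd ⟨k, hk'⟩
    dsimp only at this
    rw [mul_assoc, ← this]
    have h5 : ∏ j, y j ^ (Function.update I i ⟨k, hk'⟩ j : ℕ) ∈
        filt K q m θ y (size (Function.update I i ⟨k, hk'⟩)) := by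
      have := monom_mem_filt (K := K) (θ := θ) (y := y)
        (x := ⟨Function.update I i ⟨k, hk'⟩, 0⟩) (D := size (Function.update I i ⟨k, hk'⟩))
        (by simp)
      simpa [monom] using this
    refine filt_mono ?_ (theta_pow_mul_mem_filt
      (aeval_mul_mem_filt h5 (natDegree_coeff_torsPoly_le hq2 (a i) (m i) k)) b)
    rw [hsize]
    dsimp only
    omega

theorem y_pow_mul_mem_filt (hq2 : 2 ≤ q) {i : ι}
    (h : (torsPoly q (θ - algebraMap K T (a i)) (m i)).eval (y i) = 0) {f : T}
    (hf : f ∈ filt K q m θ y D) (b : ℕ) : y i ^ b * f ∈ filt K q m θ y (D + b) := by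
  induction b with
  | zero => simpa using hf
  | succ b ih =>
    rw [pow_succ', mul_assoc]
    exact y_mul_mem_filt hq2 h ih

theorem mul_mem_filt (hq2 : 2 ≤ q)
    (h : ∀ i, (torsPoly q (θ - algebraMap K T (a i)) (m i)).eval (y i) = 0) {D' : ℕ} {f g : T}
    (hf : f ∈ filt K q m θ y D) (hg : g ∈ filt K q m θ y D') :
    f * g ∈ filt K q m θ y (D + D') := by
  rw [mul_comm]
  refine filt_induction g (fun x hx => ?_) hf
  have key : ∀ s : Finset ι, (∏ i ∈ s, y i ^ (x.1 i : ℕ)) * g ∈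
      filt K q m θ y (D' + ∑ i ∈ s, (x.1 i : ℕ)) := by
    intro s
    induction s using Finset.induction_on with
    | empty => simpa using hg
    | insert j s hj ih =>
      rw [Finset.prod_insert hj, Finset.sum_insert hj, mul_assoc]
      exact filt_mono (by omega) (y_pow_mul_mem_filt hq2 (h j) ih _)
  have := theta_pow_mul_mem_filt (key Finset.univ) x.2
  rw [mul_comm g, monom, mul_assoc]
  refine filt_mono ?_ this
  rw [size] at hx
  omega

theorem one_mem_filt (hq2 : 2 ≤ q) : (1 : T) ∈ filt K q m θ y 0 := by
  have := monom_mem_filt (K := K) (θ := θ) (y := y) (D := 0)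
    (x := (⟨fun i => ⟨0, torsDeg_pos hq2 (m i)⟩, 0⟩ : Σ _ : Idx q m, ℕ)) (by simp [size])
  simpa [monom] using this

theorem pow_mem_filt (hq2 : 2 ≤ q)
    (h : ∀ i, (torsPoly q (θ - algebraMap K T (a i)) (m i)).eval (y i) = 0) {f : T}
    (hf : f ∈ filt K q m θ y D) (n : ℕ) : f ^ n ∈ filt K q m θ y (n * D) := by
  induction n with
  | zero => simpa using one_mem_filt hq2
  | succ n ih => rw [pow_succ, Nat.succ_mul]; exact mul_mem_filt hq2 h ih hf

theorem prod_mem_filt (hq2 : 2 ≤ q)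
    (h : ∀ i, (torsPoly q (θ - algebraMap K T (a i)) (m i)).eval (y i) = 0) {f : ι → T}
    {d : ι → ℕ} (s : Finset ι) (hf : ∀ i ∈ s, f i ∈ filt K q m θ y (d i)) :
    ∏ i ∈ s, f i ∈ filt K q m θ y (∑ i ∈ s, d i) := by
  induction s using Finset.induction_on with
  | empty => simpa using one_mem_filt hq2
  | insert j s hj ih =>
    rw [Finset.prod_insert hj, Finset.sum_insert hj]
    exact mul_mem_filt hq2 h (hf j (Finset.mem_insert_self _ _))
      (ih fun i hi => hf i (Finset.mem_insert_of_mem hi))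

theorem iter_mem_filt (hq2 : 2 ≤ q)
    (h : ∀ i, (torsPoly q (θ - algebraMap K T (a i)) (m i)).eval (y i) = 0) (i : ι) (n : ℕ) :
    (iterPoly q (θ - algebraMap K T (a i)) n).eval (y i) ∈ filt K q m θ y (q ^ n) := by
  induction n with
  | zero =>
    have := y_mul_mem_filt hq2 (h i) (one_mem_filt (K := K) (θ := θ) (y := y) (m := m) hq2)
    simpa [iterPoly] using this
  | succ n ih =>
    rw [eval_iterPoly_succ]
    refine Submodule.add_mem _ ?_ ?_
    · rw [pow_succ, mul_comm]; exact pow_mem_filt hq2 h ih q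
    · have h1 := aeval_mul_mem_filt ih (p := X - C (a i)) (n := 1) (by simp)
      rw [map_sub, aeval_X, aeval_C] at h1
      refine filt_mono ?_ h1
      have : 1 ≤ q ^ n := Nat.one_le_pow _ _ (by omega)
      rw [pow_succ]; nlinarith

/-- Elements of the filtration as polynomial combinations of the reduced monomials. -/
theorem exists_repr_of_mem_filt {f : T} (hf : f ∈ filt K q m θ y D) :
    ∃ p : Idx q m → K[X], (∀ I, (p I).natDegree ≤ D) ∧
      f = ∑ I, aeval θ (p I) * ∏ i, y i ^ (I i : ℕ) := by
  induction hf using Submodule.span_induction with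
  | mem z hz =>
    obtain ⟨x, hx, rfl⟩ := hz
    have hx' := mem_monoms.1 hx
    refine ⟨fun I => if I = x.1 then X ^ x.2 else 0, fun I => ?_, ?_⟩
    · dsimp only
      split_ifs
      · rw [natDegree_X_pow]; omega
      · simp
    · rw [Finset.sum_eq_single x.1]
      · simp [monom]
      · intro I _ hI
        simp [hI]
      · simp
  | zero => exact ⟨0, by simp, by simp⟩
  | add z w _ _ hz hw =>
    obtain ⟨p, hp, rfl⟩ := hz
    obtain ⟨p', hp', rfl⟩ := hw
    refine ⟨p + p', fun I => (natDegree_add_le _ _).trans (max_le (hp I) (hp' I)), ?_⟩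
    simp [add_mul, Finset.sum_add_distrib]
  | smul c z _ hz =>
    obtain ⟨p, hp, rfl⟩ := hz
    refine ⟨c • p, fun I => (natDegree_smul_le _ _).trans (hp I), ?_⟩
    simp [Finset.smul_sum]

end Filtration

section Points

variable {K : Type} [Field K] [IsAlgClosed K] {ι : Type} [Fintype ι] [DecidableEq ι]
  {T : Type} [CommRing T] [Algebra K T]
  {q : ℕ} {a : ι → K} {m : ι → ℕ} {θ : T} {y : ι → T}

theorem card_roots_torsPoly [DecidableEq K] (hq2 : 2 ≤ q) (hq : (q : K) = 0) {c : K} (hc : c ≠ 0)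
    (n : ℕ) : (torsPoly q c n).roots.toFinset.card = torsDeg q n := by
  obtain ⟨h1, h2⟩ := torsPoly_monic_natDegree hq2 c n
  have hnodup : (torsPoly q c n).roots.Nodup := by
    rw [Multiset.nodup_iff_count_le_one]
    intro z
    rw [count_roots]
    by_contra hlt
    rw [not_le, one_lt_rootMultiplicity_iff_isRoot h1.ne_zero] at hlt
    exact (isUnit_eval_derivative_torsPoly hq2 hq hc.isUnit hlt.1).ne_zero hlt.2
  rw [Multiset.toFinset_card_of_nodup hnodup, ← h2]
  exact splits_iff_card_roots.1 (IsAlgClosed.splits _)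

/-- A reduced expression vanishing at all points above `θ₀` has all its coefficients vanishing
at `θ₀`. -/
theorem IsTower.eval_eq_zero_of_points (hT : IsTower q a m Finset.univ T θ y) (hq2 : 2 ≤ q)
    (hq : (q : K) = 0) {θ₀ : K} (hθ₀ : ∀ i, θ₀ ≠ a i) (p : Idx q m → K[X])
    (h : ∀ φ : T →ₐ[K] K, φ θ = θ₀ → φ (∑ I, aeval θ (p I) * ∏ i, y i ^ (I i : ℕ)) = 0)
    (I : Idx q m) : (p I).eval θ₀ = 0 := by
  classical
  let e : Idx q m → ι →₀ ℕ := fun I => Finsupp.equivFunOnFinite.symm fun i => (I i : ℕ)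
  have he : Function.Injective e := by
    intro I J hIJ
    funext i
    exact Fin.ext (DFunLike.congr_fun hIJ i)
  set P : MvPolynomial ι K := ∑ I, MvPolynomial.monomial (e I) ((p I).eval θ₀) with hP
  have hcoeff : ∀ I, P.coeff (e I) = (p I).eval θ₀ := by
    intro I
    rw [hP, MvPolynomial.coeff_sum, Finset.sum_eq_single I]
    · simp
    · intro J _ hJ
      rw [MvPolynomial.coeff_monomial, if_neg (he.ne hJ)]
    · simp
  have hP0 : P = 0 := by
    refine MvPolynomial.eq_zero_of_eval_zero_at_prod_finset P
      (fun i => (torsPoly q (θ₀ - a i) (m i)).roots.toFinset) (fun i => ?_) (fun x hx => ?_)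
    · rw [card_roots_torsPoly hq2 hq (sub_ne_zero.2 (hθ₀ i)), MvPolynomial.degreeOf_lt_iff
        (torsDeg_pos hq2 _)]
      intro s hs
      rw [hP] at hs
      obtain ⟨J, -, hJ⟩ := Finset.mem_biUnion.1 (MvPolynomial.support_sum hs)
      have := Finset.mem_singleton.1 (MvPolynomial.support_monomial_subset hJ)
      rw [this]
      exact (J i).isLt
    · have hroot : ∀ i ∈ Finset.univ,
          (torsPoly q (θ₀ - algebraMap K K (a i)) (m i)).eval (x i) = 0 := by
        intro i _
        have := hx i
        rw [Multiset.mem_toFinset, mem_roots'] at this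
        exact this.2
      obtain ⟨φ, hφθ, hφy⟩ := hT.lift K θ₀ x hroot
      have h1 := h φ hφθ
      rw [map_sum] at h1
      rw [hP, map_sum, ← h1]
      refine Finset.sum_congr rfl fun J _ => ?_
      rw [MvPolynomial.eval_monomial, map_mul, map_prod, ← aeval_algHom_apply, hφθ,
        coe_aeval_eq_eval]
      congr 1
      rw [Finsupp.prod_fintype _ _ (by simp)]
      exact Finset.prod_congr rfl fun i _ => by
        rw [map_pow, hφy i (Finset.mem_univ i)]; rfl
  rw [← hcoeff I, hP0, MvPolynomial.coeff_zero]

theorem IsTower.linearIndependent (hT : IsTower q a m Finset.univ T θ y) (hq2 : 2 ≤ q)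
    (hq : (q : K) = 0) :
    LinearIndependent K (monom (q := q) (m := m) θ y) := by
  classical
  rw [linearIndependent_iff']
  intro s g hg x hx
  let p : Idx q m → K[X] := fun I => ∑ z ∈ s, if I = z.1 then monomial z.2 (g z) else 0
  have hsum : ∑ I, aeval θ (p I) * ∏ i, y i ^ (I i : ℕ) = 0 := by
    rw [← hg]
    simp only [p, map_sum, Finset.sum_mul]
    rw [Finset.sum_comm]
    refine Finset.sum_congr rfl fun z _ => ?_
    rw [Finset.sum_eq_single z.1]
    · rw [if_pos rfl, aeval_monomial, monom, Algebra.smul_def, mul_assoc]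
    · intro I _ hI
      rw [if_neg hI, map_zero, zero_mul]
    · simp
  have hp : p x.1 = 0 := by
    refine eq_zero_of_infinite_isRoot _ (Set.Infinite.mono ?_
      (Set.Finite.infinite_compl (Set.finite_range a)))
    intro θ₀ hθ₀
    refine hT.eval_eq_zero_of_points hq2 hq (fun i hi => hθ₀ ⟨i, hi.symm⟩) p (fun φ _ => ?_) x.1
    rw [hsum, map_zero]
  have hc := congrArg (fun r => coeff r x.2) hp
  simp only [p, finsetSum_coeff, coeff_zero] at hc
  rw [Finset.sum_eq_single x] at hc
  · simpa using hc
  · rintro z _ hz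
    split_ifs with h1
    · rw [coeff_monomial, if_neg]
      intro h2
      exact hz (Sigma.ext h1.symm (heq_of_eq h2))
    · rw [coeff_zero]
  · exact fun h => absurd hx h

theorem IsTower.finrank_filt (hT : IsTower q a m Finset.univ T θ y) (hq2 : 2 ≤ q)
    (hq : (q : K) = 0) (D : ℕ) :
    Module.finrank K (filt K q m θ y D) = (monoms q m D).card := by
  have hli := hT.linearIndependent hq2 hq
  have h := finrank_span_eq_card (hli.comp ((↑) : (monoms q m D) → _) Subtype.val_injective)
  rw [Set.range_comp, Subtype.range_coe_subtype] at h
  rw [filt]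
  rw [Fintype.card_coe] at h
  exact h

instance finiteDimensional_filt (D : ℕ) : FiniteDimensional K (filt K q m θ y D) :=
  FiniteDimensional.span_of_finite K ((Finset.finite_toSet _).image _)

/-- The order of vanishing of an element of the filtration at an unramified point. -/
theorem IsTower.not_X_pow_dvd [IsDomain T] (hT : IsTower q a m Finset.univ T θ y)
    (hq2 : 2 ≤ q) (hq : (q : K) = 0) {θ₀ : K} (ev : T →ₐ[K] PowerSeries K)
    (hev : ev θ = algebraMap K (PowerSeries K) θ₀ + PowerSeries.X) {A Q : ℕ}
    (hA : (∏ i, torsDeg q (m i)) * A < Q) {f : T} (hf : f ∈ filt K q m θ y A) (hf0 : f ≠ 0) :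
    ¬ PowerSeries.X ^ Q ∣ ev f := by
  intro hdvd
  let π : T →ₗ[K] (Fin Q → K) :=
    LinearMap.pi fun j => (PowerSeries.coeff (j : ℕ) : PowerSeries K →ₗ[K] K) ∘ₗ ev.toLinearMap
  have hπ : ∀ x j, π x j = PowerSeries.coeff (j : ℕ) (ev x) := fun x j => rfl
  have hroot : ∀ i, (torsPoly q (θ - algebraMap K T (a i)) (m i)).eval (y i) = 0 :=
    fun i => hT.root i (Finset.mem_univ i)
  set V := filt K q m θ y (A + Q)
  have hsurj : Function.Surjective (π.domRestrict V) := by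
    rw [← LinearMap.range_eq_top, eq_top_iff, ← (Pi.basisFun K (Fin Q)).span_eq,
      Submodule.span_le]
    rintro _ ⟨j, rfl⟩
    have hmem : aeval θ ((X - C θ₀) ^ (j : ℕ)) ∈ V := by
      have := aeval_mul_mem_filt (one_mem_filt (K := K) (m := m) (θ := θ) (y := y) hq2)
        (p := (X - C θ₀) ^ (j : ℕ)) (n := j) (by simp)
      rw [mul_one] at this
      exact filt_mono (by omega) this
    refine ⟨⟨_, hmem⟩, ?_⟩
    funext k
    rw [LinearMap.domRestrict_apply, hπ]
    dsimp only
    rw [← aeval_algHom_apply, hev, map_pow, map_sub, aeval_X, aeval_C, add_sub_cancel_left,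
      PowerSeries.coeff_X_pow, Pi.basisFun_apply, Pi.single_apply]
    simp only [Fin.ext_iff]
  have hrank := LinearMap.finrank_range_add_finrank_ker (π.domRestrict V)
  rw [LinearMap.range_eq_top.2 hsurj, finrank_top, Module.finrank_fin_fun,
    hT.finrank_filt hq2 hq] at hrank
  have hmul : ∀ g : filt K q m θ y Q, f * (g : T) ∈ V := fun g => mul_mem_filt hq2 hroot hf g.2
  let μ : filt K q m θ y Q →ₗ[K] V :=
    ((LinearMap.mulLeft K f).domRestrict _).codRestrict V hmul
  have hμ : Function.Injective μ := by
    intro g g' h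
    have h1 : f * (g : T) = f * (g' : T) := congrArg Subtype.val h
    exact Subtype.ext (mul_left_cancel₀ hf0 h1)
  have hle : LinearMap.range μ ≤ LinearMap.ker (π.domRestrict V) := by
    rintro _ ⟨g, rfl⟩
    rw [LinearMap.mem_ker]
    funext j
    change PowerSeries.coeff (j : ℕ) (ev (f * (g : T))) = 0
    rw [map_mul]
    exact PowerSeries.X_pow_dvd_iff.1 (hdvd.mul_right _) j j.isLt
  have hfin := Submodule.finrank_mono hle
  rw [LinearMap.finrank_range_of_inj hμ, hT.finrank_filt hq2 hq] at hfin
  have := card_monoms_add_le q m A Q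
  omega

omit [DecidableEq ι] in
theorem IsTower.exists_embedding [IsDomain T] (hT : IsTower q a m Finset.univ T θ y)
    (hq2 : 2 ≤ q) (hq : (q : K) = 0) :
    ∃ (θ₀ : K) (ev : T →ₐ[K] PowerSeries K),
      ev θ = algebraMap K (PowerSeries K) θ₀ + PowerSeries.X ∧ Function.Injective ev := by
  obtain ⟨θ₀, hθ₀⟩ := (Set.Finite.infinite_compl (Set.finite_range a)).nonempty
  have hroots : ∀ i, ∃ z : PowerSeries K,
      (torsPoly q (algebraMap K (PowerSeries K) θ₀ + PowerSeries.X -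
        algebraMap K (PowerSeries K) (a i)) (m i)).eval z = 0 := by
    intro i
    have hc : θ₀ - a i ≠ 0 := sub_ne_zero.2 fun h => hθ₀ ⟨i, h.symm⟩
    obtain ⟨y₀, hy₀⟩ := exists_root_torsPoly hq2 (θ₀ - a i) (m i)
    obtain ⟨z, hz, -⟩ := exists_root_powerSeries hq2 hq hc (m i)
      (u := algebraMap K (PowerSeries K) θ₀ + PowerSeries.X -
        algebraMap K (PowerSeries K) (a i)) (by simp) hy₀
    exact ⟨z, hz⟩
  choose z hz using hroots
  obtain ⟨ev, hev, -⟩ := hT.lift (PowerSeries K) _ z (fun i _ => hz i)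
  exact ⟨θ₀, ev, hev, hT.injective_of_aeval ev (by
    rw [hev]; exact aeval_X_add_C_powerSeries_injective _)⟩

end Points

section Frobenius

variable {K : Type} [Field K]

/-- The polynomial `∏ (X - c ^ q ^ j)`, over `j < n`. -/
noncomputable def normPoly (q : ℕ) (c : K) (n : ℕ) : K[X] :=
  ∏ j ∈ Finset.range n, (X - C (c ^ q ^ j))

theorem normPoly_succ {q : ℕ} (F : K →+* K) (hF : ∀ x, F x = x ^ q) (c : K) (n : ℕ) :
    normPoly q c (n + 1) = (X - C c) * (normPoly q c n).map F := by
  rw [normPoly, Finset.prod_range_succ', mul_comm, normPoly, Polynomial.map_prod]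
  congr 1
  · simp
  · refine Finset.prod_congr rfl fun j _ => ?_
    rw [Polynomial.map_sub, map_X, map_C, hF, ← pow_mul, pow_succ]

/-- The action of `p` on a torsion point is the `q ^ n`-Frobenius. -/
theorem sum_normPoly_iterPoly {q : ℕ} (F : K →+* K) (hF : ∀ x, F x = x ^ q) (c y : K) (n : ℕ) :
    (normPoly q c n).sum (fun i b => b * (iterPoly q c i).eval y) = y ^ q ^ n := by
  set u : ℕ → K := fun i => (iterPoly q c i).eval y with hu
  have hus : ∀ i, u (i + 1) = F (u i) + c * u i := fun i => by
    rw [hF, hu]; exact eval_iterPoly_succ q c i y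
  let act : K[X] →ₗ[K] K := lsum fun i => LinearMap.mulRight K (u i)
  have hact : ∀ p : K[X], act p = p.sum fun i b => b * u i := fun p => by
    simp [act, lsum_apply]
  have hmon : ∀ i b, act (monomial i b) = b * u i := fun i b => by
    rw [hact, sum_monomial_index _ _ (by simp)]
  have hstep : ∀ p : K[X], act ((X - C c) * p.map F) = F (act p) := by
    intro p
    induction p using Polynomial.induction_on' with
    | add p r hp hr => rw [Polynomial.map_add, mul_add, map_add, hp, hr, map_add, map_add]
    | monomial i b =>
      rw [map_monomial, sub_mul, X_mul_monomial, C_mul_monomial, map_sub, hmon, hmon, hmon,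
        map_mul, hus]
      ring
  rw [← hact]
  induction n with
  | zero =>
    have : normPoly q c 0 = monomial 0 1 := by simp [normPoly]
    rw [this, hmon, hu]
    simp [iterPoly]
  | succ n ih =>
    rw [normPoly_succ F hF, hstep, ih, hF, ← pow_mul, pow_succ]

theorem pow_eq_sum_coeff_normPoly {q : ℕ} (hq2 : 2 ≤ q) (F : K →+* K) (hF : ∀ x, F x = x ^ q)
    {c y : K} {m : ℕ} (hy : (torsPoly q c m).eval y = 0) (n : ℕ) :
    y ^ q ^ n = ∑ i ∈ Finset.range (m + 1),
      (normPoly q c n).coeff i * (iterPoly q c i).eval y := by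
  rw [← sum_normPoly_iterPoly F hF c y n,
    sum_over_range' _ (fun i => zero_mul _) (max (m + 1) ((normPoly q c n).natDegree + 1))
      (by omega)]
  symm
  refine Finset.sum_subset (Finset.range_subset_range.2 (le_max_left _ _)) fun i _ hi => ?_
  rw [Finset.mem_range] at hi
  rw [eval_iterPoly_eq_zero hq2 hy (by omega), mul_zero]

end Frobenius

section Stepanov

variable {K : Type} [Field K]

theorem exists_X_pow_dvd_of_sum_eq_zero {p : ℕ} [ExpChar K p] [ExpChar (PowerSeries K) p]
    {α : Type} [Fintype α] (N : ℕ) (E G : α → PowerSeries K) (hG : ∃ j, G j ≠ 0)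
    (h : ∑ j, E j * G j ^ p ^ N = 0) :
    ∃ c : α → K, (∃ j, c j ≠ 0) ∧
      PowerSeries.X ^ p ^ N ∣ ∑ j, (c j ^ p ^ N) • E j := by
  classical
  have hex : ∃ n, ∃ j, PowerSeries.coeff n (G j) ≠ 0 := by
    obtain ⟨j, hj⟩ := hG
    by_contra hcon
    push Not at hcon
    exact hj (PowerSeries.ext fun n => by simpa using hcon n j)
  set v := Nat.find hex with hv
  have hdvd : ∀ j, PowerSeries.X ^ v ∣ G j := by
    intro j
    rw [PowerSeries.X_pow_dvd_iff]
    intro n hn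
    by_contra hne
    exact Nat.find_min hex hn ⟨j, hne⟩
  choose H hH using hdvd
  have hH0 : ∀ j, PowerSeries.coeff v (G j) = PowerSeries.constantCoeff (H j) := by
    intro j
    rw [hH j]
    simpa using PowerSeries.coeff_X_pow_mul (H j) v 0
  refine ⟨fun j => PowerSeries.constantCoeff (H j), ?_, ?_⟩
  · obtain ⟨j, hj⟩ := Nat.find_spec hex
    exact ⟨j, by dsimp only; rw [← hH0]; exact hj⟩
  · have h1 : ∑ j, E j * H j ^ p ^ N = 0 := by
      have h2 : PowerSeries.X ^ (v * p ^ N) * ∑ j, E j * H j ^ p ^ N = (0 : PowerSeries K) := by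
        rw [← h, Finset.mul_sum]
        refine Finset.sum_congr rfl fun j _ => ?_
        conv_rhs => rw [hH j]
        rw [mul_pow, ← pow_mul]
        ring
      exact (mul_eq_zero.1 h2).resolve_left (pow_ne_zero _ PowerSeries.X_ne_zero)
    rw [← dvd_neg, ← zero_add (-_), ← h1, ← sub_eq_add_neg, ← Finset.sum_sub_distrib]
    refine Finset.dvd_sum fun j _ => ?_
    have h3 : E j * H j ^ p ^ N - (PowerSeries.constantCoeff (H j) ^ p ^ N) • E j =
        E j * (H j - PowerSeries.C (PowerSeries.constantCoeff (H j))) ^ p ^ N := by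
      rw [sub_pow_expChar_pow, mul_sub, PowerSeries.smul_eq_C_mul, map_pow]
      ring
    rw [h3]
    refine Dvd.dvd.mul_left (pow_dvd_pow_of_dvd ?_ _) _
    rw [PowerSeries.X_dvd_iff]
    simp

variable [IsAlgClosed K] {ι : Type} [Fintype ι] [DecidableEq ι]

/-- The Stepanov bound for the number of points on which Frobenius acts in a given way. -/
theorem card_le_of_lt {p : ℕ} [Fact p.Prime] [CharP K p] {q : ℕ} (hq2 : 2 ≤ q)
    (hq : (q : K) = 0) {a : ι → K} (ha : Function.Injective a) (m : ι → ℕ) (β : ι → ℕ → K)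
    {A B N : ℕ} (hA : (∏ i, torsDeg q (m i)) * A < p ^ N)
    (hAB : (monoms q m (p ^ N * A + (B + ∑ i, torsDeg q (m i) * q ^ m i))).card <
      (monoms q m A).card * (monoms q m B).card)
    (Z : Finset K) (hZa : ∀ z ∈ Z, ∀ i, z ≠ a i) (hZ : ∀ z ∈ Z, z ^ (p ^ N * p ^ N) = z)
    (hZβ : ∀ z ∈ Z, ∀ i η, (torsPoly q (z - a i) (m i)).eval η = 0 → η ^ (p ^ N * p ^ N) =
      ∑ k ∈ Finset.range (m i + 1), β i k * (iterPoly q (z - a i) k).eval η) :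
    Z.card ≤ A + p ^ N * B := by
  classical
  obtain ⟨T, _, _, _, θ, y, hT⟩ := exists_isTower hq2 hq ha m Finset.univ
  obtain ⟨θ₁, ev, hev, hevinj⟩ := hT.exists_embedding hq2 hq
  have hcT : CharP T p := charP_of_injective_algebraMap (algebraMap K T).injective p
  have hcS : CharP (PowerSeries K) p :=
    charP_of_injective_algebraMap (algebraMap K (PowerSeries K)).injective p
  have heK : ExpChar K p := ExpChar.prime Fact.out
  have heT : ExpChar T p := ExpChar.prime Fact.out
  have heS : ExpChar (PowerSeries K) p := ExpChar.prime Fact.out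
  have hroot : ∀ i, (torsPoly q (θ - algebraMap K T (a i)) (m i)).eval (y i) = 0 :=
    fun i => hT.root i (Finset.mem_univ i)
  set Q := p ^ N with hQ
  set c2 := ∑ i, torsDeg q (m i) * q ^ m i with hc2
  let e : (Σ _ : Idx q m, ℕ) → T := monom θ y
  let tw : ι → T := fun i => ∑ k ∈ Finset.range (m i + 1),
    β i k • (iterPoly q (θ - algebraMap K T (a i)) k).eval (y i)
  let σ : (Σ _ : Idx q m, ℕ) → T := fun x => θ ^ x.2 * ∏ i, tw i ^ (x.1 i : ℕ)
  have htw : ∀ i, tw i ∈ filt K q m θ y (q ^ m i) := fun i =>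
    Submodule.sum_mem _ fun k hk => Submodule.smul_mem _ _ (filt_mono
      (Nat.pow_le_pow_right (by omega) (Nat.lt_succ_iff.1 (Finset.mem_range.1 hk)))
      (iter_mem_filt hq2 hroot i k))
  have hσ : ∀ x ∈ monoms q m B, σ x ∈ filt K q m θ y (B + c2) := by
    intro x hx
    have h1 := theta_pow_mul_mem_filt (prod_mem_filt hq2 hroot Finset.univ
      fun i _ => pow_mem_filt hq2 hroot (htw i) (x.1 i : ℕ)) x.2
    refine filt_mono ?_ h1
    have h2 := mem_monoms.1 hx
    have h3 : ∑ i, (x.1 i : ℕ) * q ^ m i ≤ c2 :=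
      Finset.sum_le_sum fun i _ => Nat.mul_le_mul_right _ (x.1 i).isLt.le
    omega
  let v : (monoms q m A) × (monoms q m B) → filt K q m θ y (Q * A + (B + c2)) := fun x =>
    ⟨e x.1 ^ Q * σ x.2, mul_mem_filt hq2 hroot
      (pow_mem_filt hq2 hroot (monom_mem_filt (mem_monoms.1 x.1.2)) Q) (hσ _ x.2.2)⟩
  have hdep : ¬ LinearIndependent K v := by
    intro hli
    have := hli.fintype_card_le_finrank
    rw [hT.finrank_filt hq2 hq, Fintype.card_prod, Fintype.card_coe, Fintype.card_coe] at this
    omega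
  obtain ⟨μ, hμ, ⟨j₀, i₀⟩, hμ0⟩ := Fintype.not_linearIndependent_iff.1 hdep
  have hμ' : ∑ x, μ x • (e x.1 ^ Q * σ x.2) = 0 := by
    have := congrArg Subtype.val hμ
    simpa [v] using this
  have hQ0 : Q ≠ 0 := pow_ne_zero _ (Fact.out : p.Prime).ne_zero
  have hrt : ∀ c : K, ∃ d : K, d ^ Q = c := fun c =>
    IsAlgClosed.exists_pow_nat_eq c (Nat.pos_of_ne_zero hQ0)
  choose rt hrt using hrt
  let g : (monoms q m A) → T := fun j => ∑ i : monoms q m B, rt (rt (μ (j, i))) • e i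
  have hg : ∀ j, g j ∈ filt K q m θ y B := fun j =>
    Submodule.sum_mem _ fun i _ => Submodule.smul_mem _ _ (monom_mem_filt (mem_monoms.1 i.2))
  have hgQ : ∀ j, g j ^ Q = ∑ i : monoms q m B, rt (μ (j, i)) • e i ^ Q := by
    intro j
    simp only [g]
    rw [hQ, sum_pow_char_pow]
    refine Finset.sum_congr rfl fun i _ => ?_
    rw [_root_.smul_pow, ← hQ, hrt]
  let h₀ : T := ∑ j : monoms q m A, e j * g j ^ Q
  have hli := hT.linearIndependent hq2 hq
  have hliA := hli.comp ((↑) : (monoms q m A) → _) Subtype.val_injective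
  have hliB := hli.comp ((↑) : (monoms q m B) → _) Subtype.val_injective
  have hg0 : g j₀ ≠ 0 := by
    intro h0
    have h1 := Fintype.linearIndependent_iff.1 hliB (fun i => rt (rt (μ (j₀, i)))) h0 i₀
    apply hμ0
    rw [← hrt (μ (j₀, i₀)), ← hrt (rt (μ (j₀, i₀))), h1, zero_pow hQ0, zero_pow hQ0]
  have hh0 : h₀ ≠ 0 := by
    intro h0
    have h1 : ∑ j : monoms q m A, ev (e j) * ev (g j) ^ p ^ N = 0 := by
      have := congrArg ev h0
      simpa [h₀, map_sum] using this
    obtain ⟨c, ⟨j₁, hc⟩, hdvd⟩ := exists_X_pow_dvd_of_sum_eq_zero N _ _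
      ⟨j₀, (map_ne_zero_iff ev hevinj).2 hg0⟩ h1
    have h2 : ∑ j : monoms q m A, (c j ^ p ^ N) • ev (e j) =
        ev (∑ j : monoms q m A, (c j ^ p ^ N) • e j) := by
      simp [map_sum]
    rw [h2] at hdvd
    refine hT.not_X_pow_dvd hq2 hq ev hev hA (f := ∑ j : monoms q m A, (c j ^ p ^ N) • e j)
      (Submodule.sum_mem _ fun j _ => Submodule.smul_mem _ _
        (monom_mem_filt (mem_monoms.1 j.2))) ?_ hdvd
    intro h3
    have h4 := Fintype.linearIndependent_iff.1 hliA (fun j => c j ^ p ^ N) h3 j₁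
    exact hc (pow_eq_zero_iff hQ0 |>.1 h4)
  have hmem : h₀ ∈ filt K q m θ y (A + Q * B) :=
    Submodule.sum_mem _ fun j _ => mul_mem_filt hq2 hroot
      (monom_mem_filt (mem_monoms.1 j.2)) (pow_mem_filt hq2 hroot (hg j) Q)
  have hvan : ∀ z ∈ Z, ∀ φ : T →ₐ[K] K, φ θ = z → φ h₀ = 0 := by
    intro z hz φ hφ
    have hφe : ∀ x : (Σ _ : Idx q m, ℕ), φ (e x) ^ (Q * Q) = φ (σ x) := by
      intro x
      simp only [e, σ, monom, map_mul, map_pow, map_prod, mul_pow, hφ]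
      rw [← pow_mul, mul_comm x.2, pow_mul, hZ z hz, ← Finset.prod_pow]
      congr 1
      refine Finset.prod_congr rfl fun i _ => ?_
      rw [← pow_mul, mul_comm (x.1 i : ℕ), pow_mul]
      congr 1
      have h1 : (torsPoly q (z - a i) (m i)).eval (φ (y i)) = 0 := by
        have := congrArg φ.toRingHom (hroot i)
        rw [map_eval_torsPoly, map_zero] at this
        have h3 : φ.toRingHom (θ - algebraMap K T (a i)) = z - a i := by
          change φ _ = _
          rw [map_sub, AlgHom.commutes, hφ]; rfl
        rw [h3] at this
        exact this
      rw [hZβ z hz i _ h1]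
      simp only [tw, map_sum, map_smul, smul_eq_mul]
      refine Finset.sum_congr rfl fun k _ => ?_
      congr 1
      have h2 := map_eval_iterPoly φ.toRingHom q (θ - algebraMap K T (a i)) k (y i)
      have h3 : φ.toRingHom (θ - algebraMap K T (a i)) = z - a i := by
        change φ _ = _
        rw [map_sub, AlgHom.commutes, hφ]; rfl
      rw [h3] at h2
      exact h2.symm
    have hpow : φ h₀ ^ Q = φ (∑ x, μ x • (e x.1 ^ Q * σ x.2)) := by
      simp only [h₀, map_sum]
      rw [hQ, sum_pow_char_pow, Fintype.sum_prod_type]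
      refine Finset.sum_congr rfl fun j _ => ?_
      rw [map_mul, mul_pow, ← hQ, hgQ]
      rw [map_sum, hQ, sum_pow_char_pow, Finset.mul_sum]
      refine Finset.sum_congr rfl fun i _ => ?_
      rw [← hQ, map_smul, smul_eq_mul, mul_pow, hrt, map_smul, smul_eq_mul, map_mul, map_pow,
        map_pow, ← hφe, ← pow_mul]
      ring
    rw [hμ', map_zero] at hpow
    exact (pow_eq_zero_iff hQ0).1 hpow
  obtain ⟨P, hPdeg, hP⟩ := exists_repr_of_mem_filt hmem
  have hPne : ∃ I, P I ≠ 0 := by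
    by_contra hcon
    push Not at hcon
    exact hh0 (by rw [hP]; simp [hcon])
  obtain ⟨I, hI⟩ := hPne
  have hsub : Z ⊆ (P I).roots.toFinset := by
    intro z hz
    rw [Multiset.mem_toFinset, mem_roots hI]
    exact hT.eval_eq_zero_of_points hq2 hq (hZa z hz) P
      (fun φ hφ => by rw [← hP]; exact hvan z hz φ hφ) I
  exact (Finset.card_le_card hsub).trans ((Multiset.toFinset_card_le _).trans
    ((card_roots' _).trans (hPdeg I)))

end Stepanov

section Count

theorem mul_add_lt_mul {Φ c0 c2 c3 A Q a b : ℕ} (hc3 : 2 * c0 + 2 ≤ c3) (hΦ : 0 < Φ)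
    (hA : Q ≤ Φ * (A + 1)) (hQ : Φ * (c0 * c3 + c3 + c2) < Q)
    (ha : Φ * (A + 1) ≤ a + c0) (hb : Φ * (A + c3 + 1) ≤ b + c0) :
    Φ * (Q * A + (A + c3 + c2) + 1) < a * b := by
  zify at *
  set u : ℤ := Φ * (A + 1) with hu
  have hΦ1 : (1 : ℤ) ≤ Φ := hΦ
  have hb' : u + Φ * c3 - c0 ≤ b := by rw [hu]; linarith
  have ha' : u - c0 ≤ a := by linarith
  have hc0 : (0 : ℤ) ≤ c0 := by positivity
  have hc2 : (0 : ℤ) ≤ c2 := by positivity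
  have hc3' : (0 : ℤ) ≤ c3 := by positivity
  have hA0 : (0 : ℤ) ≤ A := by positivity
  have hQ0 : (0 : ℤ) ≤ Q := by positivity
  have hcc : (0 : ℤ) ≤ c0 * c3 := by positivity
  have huge : Φ * (c0 * c3 + c3 + c2) < u := by linarith
  have hΦc : (c3 : ℤ) ≤ Φ * c3 := by nlinarith
  have hcu : (c0 : ℤ) ≤ u := by nlinarith
  have h1 : (u - c0) * (u + Φ * c3 - c0) ≤ a * b :=
    mul_le_mul ha' hb' (by nlinarith) (by positivity)
  refine lt_of_lt_of_le ?_ h1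
  have h2 : (Q : ℤ) * (Φ * A) ≤ u * (u - Φ) := by
    have : (Φ : ℤ) * A = u - Φ := by rw [hu]; ring
    rw [this]
    exact mul_le_mul_of_nonneg_right hA (by rw [← this]; positivity)
  have h3 : u * 2 ≤ u * (Φ * c3 - 2 * c0) :=
    mul_le_mul_of_nonneg_left (by linarith) (by linarith)
  have h4 : (0 : ℤ) ≤ u * Φ := by positivity
  have h5 : (Φ : ℤ) * A = u - Φ := by rw [hu]; ring
  nlinarith [sq_nonneg (c0 : ℤ)]

variable {ι : Type} [Fintype ι] [DecidableEq ι]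

/-- The number of points with prescribed Frobenius action on the torsion is at most its expected
value, up to a square root error. -/
theorem exists_prod_torsDeg_mul_card_le {q : ℕ} (hq2 : 2 ≤ q) (m : ι → ℕ) :
    ∃ C : ℕ, ∀ {K : Type} [Field K] [IsAlgClosed K] {p : ℕ} [Fact p.Prime] [CharP K p],
      (q : K) = 0 → ∀ {a : ι → K}, Function.Injective a → ∀ (β : ι → ℕ → K) {N : ℕ}, N ≠ 0 →
      ∀ Z : Finset K, (∀ z ∈ Z, ∀ i, z ≠ a i) → (∀ z ∈ Z, z ^ (p ^ N * p ^ N) = z) →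
      (∀ z ∈ Z, ∀ i η, (torsPoly q (z - a i) (m i)).eval η = 0 → η ^ (p ^ N * p ^ N) =
        ∑ k ∈ Finset.range (m i + 1), β i k * (iterPoly q (z - a i) k).eval η) →
      (∏ i, torsDeg q (m i)) * Z.card ≤ p ^ N * p ^ N + C * p ^ N := by
  set Φ := ∏ i, torsDeg q (m i) with hΦ
  have hΦ0 : 0 < Φ := Finset.prod_pos fun i _ => torsDeg_pos hq2 _
  set c0 := ∑ I : Idx q m, size I with hc0
  set c2 := ∑ i, torsDeg q (m i) * q ^ m i with hc2
  set c3 := 2 * c0 + 2 with hc3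
  set Q0 := Φ * (c0 * c3 + c3 + c2) with hQ0
  refine ⟨1 + Φ * c3 + Φ * Q0, ?_⟩
  intro K _ _ p _ _ hq a ha β N hN Z hZa hZ hZβ
  have hp : p.Prime := Fact.out
  set Q := p ^ N with hQ
  have hQ2 : 1 < Q := Nat.one_lt_pow hN hp.one_lt
  rcases le_or_gt Q Q0 with hle | hlt
  · have hcard : Z.card ≤ Q * Q := by
      have hne : (X ^ (Q * Q) - X : K[X]) ≠ 0 :=
        FiniteField.X_pow_card_sub_X_ne_zero K (by nlinarith)
      calc Z.card ≤ (X ^ (Q * Q) - X : K[X]).natDegree :=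
            card_le_degree_of_subset_roots fun z hz => by
              rw [mem_roots hne]; simp [hZ z hz]
        _ = Q * Q := FiniteField.X_pow_card_sub_X_natDegree_eq K (by nlinarith)
    calc Φ * Z.card ≤ Φ * (Q0 * Q) := by gcongr; exact hcard.trans (by gcongr)
      _ ≤ _ := by nlinarith [Nat.zero_le (Q * Q), Nat.zero_le (Φ * c3 * Q)]
  · set A := (Q - 1) / Φ with hA
    have hAQ : Φ * A ≤ Q - 1 := Nat.mul_div_le _ _
    have hQA : Q ≤ Φ * (A + 1) := by
      have := Nat.lt_mul_div_succ (Q - 1) hΦ0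
      rw [← hA] at this
      omega
    have := card_le_of_lt hq2 hq ha m β (A := A) (B := A + c3) (N := N)
      (by rw [← hΦ, ← hQ]; omega)
      (lt_of_le_of_lt (card_monoms_le q m _) (by
        rw [← hΦ, ← hQ, ← hc2]
        exact mul_add_lt_mul le_rfl hΦ0 hQA hlt (le_card_monoms q m A)
          (le_card_monoms q m (A + c3)))) Z hZa hZ hZβ
    rw [← hQ] at this
    have h1 : Φ * A ≤ Q := by omega
    have h2 : Φ * A * (1 + Q) ≤ (Q - 1) * (1 + Q) := Nat.mul_le_mul_right _ hAQ
    have h3 : (Q - 1) * (1 + Q) ≤ Q * Q := by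
      rw [Nat.sub_mul, mul_add, one_mul, mul_one]
      omega
    calc Φ * Z.card ≤ Φ * (A + Q * (A + c3)) := by gcongr
      _ = Φ * A * (1 + Q) + Φ * c3 * Q := by ring
      _ ≤ _ := by nlinarith [Nat.zero_le (Φ * Q0 * Q)]

end Count

section FiniteField

variable (κ K : Type) [Field κ] [Fintype κ] [Field K] [Algebra κ K]

/-- The Frobenius of `κ`, as an endomorphism of `K`. -/
noncomputable def frob : K →+* K := (FiniteField.frobeniusAlgHom κ K : K →ₐ[κ] K)

@[simp]
theorem frob_apply (x : K) : frob κ K x = x ^ Fintype.card κ := rfl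

theorem frob_algebraMap (c : κ) : frob κ K (algebraMap κ K c) = algebraMap κ K c :=
  (FiniteField.frobeniusAlgHom κ K).commutes c

theorem frob_iterate_apply (j : ℕ) (x : K) : (frob κ K)^[j] x = x ^ Fintype.card κ ^ j := by
  induction j with
  | zero => simp
  | succ j ih => rw [Function.iterate_succ_apply', ih, frob_apply, ← pow_mul, pow_succ]

theorem natCast_card_eq_zero : (Fintype.card κ : K) = 0 := by
  rw [← map_natCast (algebraMap κ K), Nat.cast_card_eq_zero, map_zero]

variable {K} in
theorem exists_algebraMap_eq {x : K} (hx : x ^ Fintype.card κ = x) : ∃ c, algebraMap κ K c = x := by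
  classical
  have hne : (X ^ Fintype.card κ - X : K[X]) ≠ 0 :=
    FiniteField.X_pow_card_sub_X_ne_zero K Fintype.one_lt_card
  have hsub : Finset.univ.image (algebraMap κ K) ⊆ (X ^ Fintype.card κ - X : K[X]).roots.toFinset := by
    intro y hy
    obtain ⟨c, -, rfl⟩ := Finset.mem_image.mp hy
    rw [Multiset.mem_toFinset, mem_roots hne]
    simp [← map_pow, FiniteField.pow_card]
  have heq := Finset.eq_of_subset_of_card_le hsub <| by
    rw [Finset.card_image_of_injective _ (algebraMap κ K).injective, Finset.card_univ]
    refine (Multiset.toFinset_card_le _).trans ((card_roots' _).trans ?_)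
    rw [FiniteField.X_pow_card_sub_X_natDegree_eq K Fintype.one_lt_card]
  have : x ∈ (X ^ Fintype.card κ - X : K[X]).roots.toFinset := by
    rw [Multiset.mem_toFinset, mem_roots hne]; simp [hx]
  rw [← heq] at this
  obtain ⟨c, -, hc⟩ := Finset.mem_image.mp this
  exact ⟨c, hc⟩

variable {K} in
theorem exists_map_algebraMap_eq {f : K[X]} (hf : f.map (frob κ K) = f) :
    ∃ g : κ[X], g.map (algebraMap κ K) = f := by
  have : f ∈ lifts (algebraMap κ K) := (lifts_iff_coeff_lifts f).mpr fun n => by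
    refine exists_algebraMap_eq κ ?_
    conv_rhs => rw [← hf]
    rw [coeff_map, frob_apply]
  exact (mem_lifts f).mp this

omit [Fintype κ] in
theorem map_injective_algebraMap : Function.Injective (Polynomial.map (algebraMap κ K)) :=
  map_injective _ (algebraMap κ K).injective

open Classical in
/-- The elements of `K` fixed by the `n`-th power of the Frobenius of `κ`. -/
noncomputable def pts (n : ℕ) : Finset K :=
  (X ^ Fintype.card κ ^ n - X : K[X]).roots.toFinset

omit [Algebra κ K] in
variable {κ K} in
theorem mem_pts {n : ℕ} (hn : n ≠ 0) {θ : K} : θ ∈ pts κ K n ↔ θ ^ Fintype.card κ ^ n = θ := by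
  classical
  rw [pts, Multiset.mem_toFinset, mem_roots (FiniteField.X_pow_card_pow_sub_X_ne_zero K hn
    Fintype.one_lt_card)]
  simp [sub_eq_zero]

theorem card_pts [IsAlgClosed K] {n : ℕ} (hn : n ≠ 0) :
    (pts κ K n).card = Fintype.card κ ^ n := by
  classical
  obtain ⟨p, hp⟩ := CharP.exists K
  have hdvd : p ∣ Fintype.card κ ^ n := by
    rw [← CharP.cast_eq_zero_iff K p]
    simp [natCast_card_eq_zero, hn]
  have hsep : (X ^ Fintype.card κ ^ n - X : K[X]).Separable := galois_poly_separable p _ hdvd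
  rw [pts, Multiset.toFinset_card_of_nodup (nodup_roots hsep),
    splits_iff_card_roots.mp (IsAlgClosed.splits _),
    FiniteField.X_pow_card_pow_sub_X_natDegree_eq K hn Fintype.one_lt_card]

variable {κ K}

theorem map_normPoly_frob (θ : K) (n : ℕ) :
    (X - C θ) * (normPoly (Fintype.card κ) θ n).map (frob κ K) =
      (X - C (θ ^ Fintype.card κ ^ n)) * normPoly (Fintype.card κ) θ n := by
  rw [← normPoly_succ (frob κ K) (frob_apply κ K), normPoly, Finset.prod_range_succ, mul_comm,
    ← normPoly]

theorem exists_map_eq_normPoly {θ : K} {n : ℕ} (hθ : θ ^ Fintype.card κ ^ n = θ) :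
    ∃ g : κ[X], g.map (algebraMap κ K) = normPoly (Fintype.card κ) θ n := by
  refine exists_map_algebraMap_eq κ (mul_left_cancel₀ (X_sub_C_ne_zero θ) ?_)
  rw [map_normPoly_frob, hθ]

open Classical in
variable (κ) in
/-- The characteristic polynomial over `κ` of an element `θ` of the degree `n` extension. -/
noncomputable def charp (n : ℕ) (θ : K) : κ[X] :=
  if h : ∃ g : κ[X], g.map (algebraMap κ K) = normPoly (Fintype.card κ) θ n then h.choose else 1

theorem map_charp {θ : K} {n : ℕ} (hθ : θ ^ Fintype.card κ ^ n = θ) :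
    (charp κ n θ).map (algebraMap κ K) = normPoly (Fintype.card κ) θ n := by
  rw [charp, dif_pos (exists_map_eq_normPoly hθ)]
  exact (exists_map_eq_normPoly hθ).choose_spec

theorem normPoly_monic (q : ℕ) (θ : K) (n : ℕ) : (normPoly q θ n).Monic :=
  monic_prod_of_monic _ _ fun _ _ => monic_X_sub_C _

theorem natDegree_normPoly (q : ℕ) (θ : K) (n : ℕ) : (normPoly q θ n).natDegree = n := by
  rw [normPoly, natDegree_prod_of_monic _ _ fun _ _ => monic_X_sub_C _,
    Finset.sum_congr rfl fun j _ => natDegree_X_sub_C (θ ^ q ^ j)]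
  simp

theorem charp_monic {θ : K} {n : ℕ} (hθ : θ ^ Fintype.card κ ^ n = θ) : (charp κ n θ).Monic :=
  monic_of_injective (algebraMap κ K).injective (map_charp hθ ▸ normPoly_monic _ _ _)

theorem natDegree_charp {θ : K} {n : ℕ} (hθ : θ ^ Fintype.card κ ^ n = θ) :
    (charp κ n θ).natDegree = n := by
  rw [← natDegree_map (algebraMap κ K), map_charp hθ, natDegree_normPoly]

theorem normPoly_sub_algebraMap (θ : K) (a : κ) (n : ℕ) :
    normPoly (Fintype.card κ) (θ - algebraMap κ K a) n =
      (normPoly (Fintype.card κ) θ n).comp (X + C (algebraMap κ K a)) := by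
  rw [normPoly, normPoly, prod_comp]
  refine Finset.prod_congr rfl fun j _ => ?_
  have h : (θ - algebraMap κ K a) ^ Fintype.card κ ^ j =
      θ ^ Fintype.card κ ^ j - algebraMap κ K a := by
    rw [← frob_iterate_apply κ K, ← frob_iterate_apply κ K, iterate_map_sub,
      Function.iterate_fixed (frob_algebraMap κ K a)]
  rw [h, sub_comp, X_comp, C_comp, C_sub]
  ring

theorem coeff_normPoly_sub {θ : K} {n : ℕ} (hθ : θ ^ Fintype.card κ ^ n = θ) (a : κ) (k : ℕ) :
    (normPoly (Fintype.card κ) (θ - algebraMap κ K a) n).coeff k =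
      algebraMap κ K ((taylor a (charp κ n θ)).coeff k) := by
  rw [normPoly_sub_algebraMap, ← map_charp hθ, taylor_apply, ← coeff_map, Polynomial.map_comp]
  simp

omit [Fintype κ] in
theorem X_sub_C_pow_dvd_iff_taylor {a : κ} {n : ℕ} {f : κ[X]} :
    (X - C a) ^ n ∣ f ↔ ∀ k < n, (taylor a f).coeff k = 0 := by
  rw [X_sub_C_pow_dvd_iff, X_pow_dvd_iff, taylor_apply]

/-- The evaluation of `charp` at a point. -/
theorem eval_charp_eq_zero_iff {θ : K} {n : ℕ} (hn : n ≠ 0) (hθ : θ ^ Fintype.card κ ^ n = θ)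
    (a : κ) : (charp κ n θ).eval a = 0 ↔ θ = algebraMap κ K a := by
  rw [← (algebraMap κ K).injective.eq_iff, map_zero, ← eval_map_apply, map_charp hθ, normPoly,
    eval_prod, Finset.prod_eq_zero_iff]
  constructor
  · rintro ⟨j, -, hj⟩
    rw [eval_sub, eval_X, eval_C, sub_eq_zero, ← frob_iterate_apply κ K,
      ← Function.iterate_fixed (frob_algebraMap κ K a) j] at hj
    exact ((frob κ K).injective.iterate j hj).symm
  · rintro rfl
    exact ⟨0, Finset.mem_range.mpr (Nat.pos_of_ne_zero hn), by simp⟩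

end FiniteField

section SplitCount

variable {κ K : Type} [Field κ] [Fintype κ] [Field K] [Algebra κ K] [IsAlgClosed K]
variable {ι : Type} [Fintype ι] [DecidableEq ι]

variable (K) in
open Classical in
theorem exists_split_card_le {a : ι → κ} (ha : Function.Injective a) (m : ι → ℕ) :
    ∃ C₀ : ℕ, ∀ k ≠ 0, ∀ u : κ[X], IsCoprime u (∏ i, (X - C (a i)) ^ (m i + 1)) →
      (∏ i, torsDeg (Fintype.card κ) (m i)) * ((pts κ K (2 * k)).filter
        fun θ => (∏ i, (X - C (a i)) ^ (m i + 1)) ∣ charp κ (2 * k) θ - u).card ≤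
      Fintype.card κ ^ (2 * k) + C₀ * Fintype.card κ ^ k := by
  have hq2 : 2 ≤ Fintype.card κ := Fintype.one_lt_card
  obtain ⟨C0, hC⟩ := exists_prod_torsDeg_mul_card_le hq2 m
  obtain ⟨p, hp⟩ := CharP.exists κ
  obtain ⟨e, hpp, he⟩ := FiniteField.card κ p
  have hfp : Fact p.Prime := ⟨hpp⟩
  have hcp : CharP K p := charP_of_injective_algebraMap (algebraMap κ K).injective p
  refine ⟨C0, fun k hk u hu => ?_⟩
  have hpk : p ^ (e * k) = Fintype.card κ ^ k := by rw [he, pow_mul]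
  have h2k : 2 * k ≠ 0 := by omega
  have hsq : Fintype.card κ ^ k * Fintype.card κ ^ k = Fintype.card κ ^ (2 * k) := by
    rw [two_mul, pow_add]
  rw [← hsq, ← hpk]
  refine hC (natCast_card_eq_zero κ K) ((algebraMap κ K).injective.comp ha)
    (fun i j => algebraMap κ K ((taylor (a i) u).coeff j)) (N := e * k)
    (mul_ne_zero e.ne_zero hk) _ ?_ ?_ ?_
  · intro z hz i hzi
    obtain ⟨hz1, hz2⟩ := Finset.mem_filter.mp hz
    rw [mem_pts h2k] at hz1
    have hdvd : (X - C (a i)) ∣ ∏ i, (X - C (a i)) ^ (m i + 1) :=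
      (dvd_pow_self _ (Nat.succ_ne_zero _)).trans (Finset.dvd_prod_of_mem _ (Finset.mem_univ i))
    have h1 : (charp κ (2 * k) z).eval (a i) = 0 := (eval_charp_eq_zero_iff h2k hz1 _).mpr hzi
    have h2 := hdvd.trans hz2
    rw [dvd_iff_isRoot, IsRoot, eval_sub, h1, zero_sub, neg_eq_zero] at h2
    refine not_isUnit_X_sub_C (a i) (hu.isUnit_of_dvd' (dvd_iff_isRoot.mpr h2) hdvd)
  · intro z hz
    rw [hpk, hsq]
    exact (mem_pts h2k).mp (Finset.mem_filter.mp hz).1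
  · intro z hz i η hη
    obtain ⟨hz1, hz2⟩ := Finset.mem_filter.mp hz
    rw [mem_pts h2k] at hz1
    rw [hpk, hsq, pow_eq_sum_coeff_normPoly hq2 (frob κ K) (frob_apply κ K) hη]
    refine Finset.sum_congr rfl fun j hj => ?_
    congr 1
    have h3 := (Finset.dvd_prod_of_mem (fun i => (X - C (a i)) ^ (m i + 1))
      (Finset.mem_univ i)).trans hz2
    have h4 := X_sub_C_pow_dvd_iff_taylor.mp h3 j (Finset.mem_range.mp hj)
    rw [map_sub, coeff_sub, sub_eq_zero] at h4
    rw [← h4]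
    exact coeff_normPoly_sub hz1 (a i) j

end SplitCount

section Dirichlet

variable {κ : Type} [Field κ]

/-- A Dirichlet character modulo `M`. -/
structure IsDirichlet (M : κ[X]) (χ : κ[X] →* ℂ) : Prop where
  congr : ∀ f g, M ∣ f - g → χ f = χ g
  zero : ∀ f, ¬ IsCoprime f M → χ f = 0

/-- A Dirichlet character modulo `M` which is not principal. -/
structure IsNontrivial (M : κ[X]) (χ : κ[X] →* ℂ) : Prop extends IsDirichlet M χ where
  exists_ne : ∃ f, IsCoprime f M ∧ χ f ≠ 1

variable [Fintype κ]

open Classical in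
variable (κ) in
/-- The polynomials of degree less than `d`. -/
noncomputable def lowPolys (d : ℕ) : Finset κ[X] :=
  Finset.univ.image fun v : Fin d → κ => ((degreeLTEquiv κ d).symm v : κ[X])

theorem mem_lowPolys {d : ℕ} {f : κ[X]} : f ∈ lowPolys κ d ↔ f.degree < d := by
  classical
  rw [lowPolys, Finset.mem_image, ← mem_degreeLT]
  constructor
  · rintro ⟨v, -, rfl⟩
    exact ((degreeLTEquiv κ d).symm v).2
  · intro hf
    exact ⟨degreeLTEquiv κ d ⟨f, hf⟩, Finset.mem_univ _, by simp⟩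

theorem modByMonic_mem_lowPolys {M : κ[X]} (hM : M.Monic) (f : κ[X]) :
    f %ₘ M ∈ lowPolys κ M.natDegree := by
  rw [mem_lowPolys, ← degree_eq_natDegree hM.ne_zero]
  exact degree_modByMonic_lt f hM

omit [Fintype κ] in
theorem dvd_sub_modByMonic {M : κ[X]} (f : κ[X]) : M ∣ f - f %ₘ M :=
  ⟨f /ₘ M, by rw [sub_eq_iff_eq_add, add_comm, modByMonic_add_div]⟩

theorem eq_of_mem_lowPolys {M : κ[X]} (hM : M.Monic) {f g : κ[X]}
    (hf : f ∈ lowPolys κ M.natDegree) (hg : g ∈ lowPolys κ M.natDegree) (h : M ∣ f - g) :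
    f = g := by
  rw [mem_lowPolys, ← degree_eq_natDegree hM.ne_zero] at hf hg
  exact sub_eq_zero.mp (eq_zero_of_dvd_of_degree_lt h
    ((degree_sub_le _ _).trans_lt (max_lt hf hg)))

theorem modByMonic_eq_iff {M : κ[X]} (hM : M.Monic) {f u : κ[X]}
    (hu : u ∈ lowPolys κ M.natDegree) : f %ₘ M = u ↔ M ∣ f - u := by
  constructor
  · rintro rfl
    exact dvd_sub_modByMonic f
  · intro h
    refine eq_of_mem_lowPolys hM (modByMonic_mem_lowPolys hM f) hu ?_
    have := dvd_sub h (dvd_sub_modByMonic (M := M) f)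
    rwa [sub_sub_sub_cancel_left] at this

omit [Fintype κ] in
theorem isCoprime_of_dvd_sub {M f g : κ[X]} (h : M ∣ f - g) (hg : IsCoprime g M) :
    IsCoprime f M := by
  obtain ⟨c, hc⟩ := h
  rw [sub_eq_iff_eq_add'] at hc
  rw [hc]
  exact IsCoprime.add_mul_left_left_iff.mpr hg

namespace IsDirichlet

variable {M : κ[X]} {χ : κ[X] →* ℂ}

omit [Fintype κ] in
theorem map_modByMonic (hχ : IsDirichlet M χ) (f : κ[X]) : χ (f %ₘ M) = χ f :=
  (hχ.congr _ _ (dvd_sub_modByMonic f)).symm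

theorem norm_le_one (hχ : IsDirichlet M χ) (hM : M.Monic) (f : κ[X]) : ‖χ f‖ ≤ 1 := by
  by_contra! h
  have hinj : Set.InjOn (fun n : ℕ => f ^ n %ₘ M) Set.univ := by
    intro i _ j _ hij
    have h1 : ‖χ f‖ ^ i = ‖χ f‖ ^ j := by
      rw [← norm_pow, ← norm_pow, ← map_pow, ← map_pow, ← hχ.map_modByMonic (f ^ i),
        ← hχ.map_modByMonic (f ^ j)]
      exact congrArg _ (congrArg _ hij)
    exact (pow_right_injective₀ (by linarith) h.ne') h1
  exact Set.infinite_univ.not_finite ((lowPolys κ M.natDegree).finite_toSet.of_injOn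
    (fun i _ => modByMonic_mem_lowPolys hM _) hinj)

end IsDirichlet

theorem IsNontrivial.sum_lowPolys_eq_zero {M : κ[X]} {χ : κ[X] →* ℂ} (hχ : IsNontrivial M χ)
    (hM : M.Monic) : ∑ f ∈ lowPolys κ M.natDegree, χ f = 0 := by
  obtain ⟨g, hg, hg1⟩ := hχ.exists_ne
  have hbij : ∑ f ∈ lowPolys κ M.natDegree, χ (g * f) = ∑ f ∈ lowPolys κ M.natDegree, χ f := by
    have hinj : Set.InjOn (fun f => g * f %ₘ M) (lowPolys κ M.natDegree) := by
      intro f hf f' hf' h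
      refine eq_of_mem_lowPolys hM hf hf' (hg.symm.dvd_of_dvd_mul_left ?_)
      have := dvd_sub (dvd_sub_modByMonic (M := M) (g * f)) (dvd_sub_modByMonic (M := M) (g * f'))
      rw [show g * f %ₘ M = g * f' %ₘ M from h, sub_sub_sub_cancel_right, ← mul_sub] at this
      exact this
    have hmaps : Set.MapsTo (fun f => g * f %ₘ M) (lowPolys κ M.natDegree)
      (lowPolys κ M.natDegree) := fun f _ => modByMonic_mem_lowPolys hM _
    refine Finset.sum_nbij (fun f => g * f %ₘ M) hmaps hinj
      (Finset.surjOn_of_injOn_of_card_le _ hmaps hinj le_rfl) fun f _ => ?_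
    exact (hχ.map_modByMonic _).symm
  simp_rw [map_mul, ← Finset.mul_sum] at hbij
  have : (χ g - 1) * ∑ f ∈ lowPolys κ M.natDegree, χ f = 0 := by linear_combination hbij
  exact (mul_eq_zero.mp this).resolve_left (sub_ne_zero.mpr hg1)

variable (K : Type) [Field K] [Algebra κ K]

/-- The sum of a character over the characteristic polynomials of the elements of the extension
of degree `n`. -/
noncomputable def charSum (χ : κ[X] →* ℂ) (n : ℕ) : ℂ := ∑ θ ∈ pts κ K n, χ (charp κ n θ)

end Dirichlet

section Split

variable {κ : Type} [Field κ] [Fintype κ]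
variable {ι : Type} [Fintype ι] [DecidableEq ι]

open Classical in
theorem card_coprime_lowPolys_le {a : ι → κ} (ha : Function.Injective a) (m : ι → ℕ) {M : κ[X]}
    (hM : M = ∏ i, (X - C (a i)) ^ (m i + 1)) :
    ((lowPolys κ M.natDegree).filter fun u => IsCoprime u M).card ≤
      ∏ i, torsDeg (Fintype.card κ) (m i) := by
  have hmon : M.Monic := hM ▸ monic_prod_of_monic _ _ fun _ _ => (monic_X_sub_C _).pow _
  set U := (lowPolys κ M.natDegree).filter fun u => IsCoprime u M with hU
  have hne : ∀ u ∈ U, ∀ i, (taylor (a i) u).coeff 0 ≠ 0 := by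
    intro u hu i h0
    have h1 : IsCoprime u M := (Finset.mem_filter.mp hu).2
    have hdvd : (X - C (a i)) ∣ M := hM ▸ (dvd_pow_self _ (Nat.succ_ne_zero _)).trans
      (Finset.dvd_prod_of_mem _ (Finset.mem_univ i))
    rw [taylor_coeff_zero] at h0
    exact not_isUnit_X_sub_C (a i) (h1.isUnit_of_dvd' (dvd_iff_isRoot.mpr h0) hdvd)
  let φ : U → ∀ i, (Fin (m i) → κ) × κˣ := fun u i =>
    (fun k => (taylor (a i) (u : κ[X])).coeff (k + 1), Units.mk0 _ (hne u u.2 i))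
  have hφ : Function.Injective φ := by
    intro u v huv
    refine Subtype.ext (eq_of_mem_lowPolys hmon (Finset.mem_filter.mp u.2).1
      (Finset.mem_filter.mp v.2).1 ?_)
    rw [hM]
    refine Finset.prod_dvd_of_coprime (fun i _ j _ hij => ?_) fun i _ => ?_
    · exact (isCoprime_X_sub_C_of_isUnit_sub (sub_ne_zero.mpr (ha.ne hij)).isUnit).pow
    · rw [X_sub_C_pow_dvd_iff_taylor]
      intro k hk
      have h := congrFun huv i
      rw [map_sub, coeff_sub, sub_eq_zero]
      cases k with
      | zero => exact congrArg Units.val (Prod.ext_iff.mp h).2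
      | succ k => exact congrFun (Prod.ext_iff.mp h).1 ⟨k, by omega⟩
  have := Fintype.card_le_of_injective φ hφ
  simpa [Fintype.card_pi, Fintype.card_units, torsDeg] using this

variable (K : Type) [Field K] [Algebra κ K] [IsAlgClosed K]

theorem exists_norm_charSum_le_of_split {a : ι → κ} (ha : Function.Injective a) (m : ι → ℕ)
    {M : κ[X]} (hM : M = ∏ i, (X - C (a i)) ^ (m i + 1)) :
    ∃ C₀ : ℝ, 0 ≤ C₀ ∧ ∀ χ : κ[X] →* ℂ, IsNontrivial M χ → ∀ k ≠ 0,
      ‖charSum K χ (2 * k)‖ ≤ C₀ * (Fintype.card κ : ℝ) ^ k := by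
  classical
  have hmon : M.Monic := hM ▸ monic_prod_of_monic _ _ fun _ _ => (monic_X_sub_C _).pow _
  obtain ⟨C₀, hC⟩ := exists_split_card_le K ha m
  rw [← hM] at hC
  refine ⟨2 * C₀ + Fintype.card ι, by positivity, fun χ hχ k hk => ?_⟩
  have h2k : 2 * k ≠ 0 := by omega
  set Φ := ∏ i, torsDeg (Fintype.card κ) (m i) with hΦ
  have hΦ0 : 0 < Φ := Finset.prod_pos fun i _ => torsDeg_pos Fintype.one_lt_card _
  have hΦ0' : (0 : ℝ) < Φ := by exact_mod_cast hΦ0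
  set U := (lowPolys κ M.natDegree).filter fun u => IsCoprime u M with hU
  have hUΦ : U.card ≤ Φ := card_coprime_lowPolys_le ha m hM
  set N : κ[X] → ℕ := fun u => ((pts κ K (2 * k)).filter fun θ => charp κ (2 * k) θ %ₘ M = u).card
    with hN
  set q : ℝ := (Fintype.card κ : ℝ) with hq
  have hq1 : 1 ≤ q := by rw [hq]; exact_mod_cast Fintype.card_pos
  -- the character sum in terms of residue counts
  have hsum : charSum K χ (2 * k) = ∑ u ∈ U, (N u : ℂ) * χ u := by
    rw [charSum, ← Finset.sum_fiberwise_of_maps_to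
      (g := fun θ => charp κ (2 * k) θ %ₘ M) (t := lowPolys κ M.natDegree)
      fun θ _ => modByMonic_mem_lowPolys hmon _, hU, Finset.sum_filter]
    refine Finset.sum_congr rfl fun u _ => ?_
    have h1 : ∀ θ ∈ (pts κ K (2 * k)).filter fun θ => charp κ (2 * k) θ %ₘ M = u,
        χ (charp κ (2 * k) θ) = χ u := fun θ hθ => by
      rw [← hχ.map_modByMonic, (Finset.mem_filter.mp hθ).2]
    rw [Finset.sum_congr rfl h1, Finset.sum_const, nsmul_eq_mul]
    split_ifs with hc
    · rfl
    · rw [hχ.zero u hc, mul_zero]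
  have hU0 : ∑ u ∈ U, χ u = 0 := by
    rw [← hχ.sum_lowPolys_eq_zero hmon, hU, Finset.sum_filter]
    refine Finset.sum_congr rfl fun u _ => ?_
    split_ifs with hc
    · rfl
    · rw [hχ.zero u hc]
  set x : κ[X] → ℝ := fun u => N u - q ^ (2 * k) / Φ with hx
  have hsum' : charSum K χ (2 * k) = ∑ u ∈ U, (x u : ℂ) * χ u := by
    have : ∑ u ∈ U, (x u : ℂ) * χ u =
        ∑ u ∈ U, (N u : ℂ) * χ u - (q ^ (2 * k) / Φ : ℝ) * ∑ u ∈ U, χ u := by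
      rw [Finset.mul_sum, ← Finset.sum_sub_distrib]
      refine Finset.sum_congr rfl fun u _ => ?_
      rw [hx]; push_cast; ring
    rw [this, hU0, hsum]; simp
  -- the upper bound for residue counts
  have hxle : ∀ u ∈ U, x u ≤ C₀ * q ^ k / Φ := by
    intro u hu
    obtain ⟨hu1, hu2⟩ := Finset.mem_filter.mp hu
    have h := hC k hk u hu2
    have heq : ((pts κ K (2 * k)).filter fun θ => M ∣ charp κ (2 * k) θ - u).card = N u := by
      rw [hN]
      congr 1
      refine Finset.filter_congr fun θ _ => (modByMonic_eq_iff hmon hu1).symm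
    rw [heq] at h
    have h' : (Φ : ℝ) * N u ≤ q ^ (2 * k) + C₀ * q ^ k := by rw [hq]; exact_mod_cast h
    rw [hx]
    simp only
    rw [sub_le_iff_le_add, ← add_div, le_div_iff₀ hΦ0']
    linarith
  -- the total of the residue counts
  have htot : q ^ (2 * k) - Fintype.card ι ≤ ∑ u ∈ U, (N u : ℝ) := by
    have h1 : (pts κ K (2 * k)).filter (fun θ => charp κ (2 * k) θ %ₘ M ∈ U) =
        pts κ K (2 * k) \ Finset.univ.image (fun i => algebraMap κ K (a i)) := by
      ext θ
      simp only [Finset.mem_filter, Finset.mem_sdiff, Finset.mem_image, Finset.mem_univ, true_and]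
      refine and_congr_right fun hθ => ?_
      rw [mem_pts h2k] at hθ
      have h2 : charp κ (2 * k) θ %ₘ M ∈ U ↔ IsCoprime (charp κ (2 * k) θ) M := by
        rw [hU, Finset.mem_filter]
        have hd := dvd_sub_modByMonic (M := M) (charp κ (2 * k) θ)
        exact ⟨fun h => isCoprime_of_dvd_sub hd h.2, fun h => ⟨modByMonic_mem_lowPolys hmon _,
          isCoprime_of_dvd_sub ((dvd_sub_comm).mp hd) h⟩⟩
      rw [h2, hM, IsCoprime.prod_right_iff]
      simp only [Finset.mem_univ, true_imp_iff, not_exists]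
      refine forall_congr' fun i => ?_
      rw [IsCoprime.pow_right_iff (Nat.succ_pos _), isCoprime_comm,
        (irreducible_X_sub_C (a i)).coprime_iff_not_dvd, dvd_iff_isRoot, IsRoot,
        eval_charp_eq_zero_iff h2k hθ, eq_comm]
    have h3 : ∑ u ∈ U, N u = ((pts κ K (2 * k)).filter
        (fun θ => charp κ (2 * k) θ %ₘ M ∈ U)).card := by
      have hmaps : ∀ θ ∈ (pts κ K (2 * k)).filter (fun θ => charp κ (2 * k) θ %ₘ M ∈ U),
          charp κ (2 * k) θ %ₘ M ∈ U := fun θ hθ => (Finset.mem_filter.mp hθ).2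
      rw [Finset.card_eq_sum_card_fiberwise hmaps]
      refine Finset.sum_congr rfl fun u hu => ?_
      refine congrArg Finset.card ?_
      ext θ
      simp only [Finset.mem_filter]
      exact ⟨fun h => ⟨⟨h.1, h.2 ▸ hu⟩, h.2⟩, fun h => ⟨h.1.1, h.2⟩⟩
    have h4 : Fintype.card κ ^ (2 * k) ≤ ∑ u ∈ U, N u + Fintype.card ι := by
      rw [h3, h1, ← card_pts κ K h2k]
      have := Finset.le_card_sdiff (Finset.univ.image fun i => algebraMap κ K (a i))
        (pts κ K (2 * k))
      have h5 := Finset.card_image_le (s := (Finset.univ : Finset ι))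
        (f := fun i => algebraMap κ K (a i))
      rw [Finset.card_univ] at h5
      omega
    rw [sub_le_iff_le_add, hq]
    exact_mod_cast h4
  have hxsum : -(Fintype.card ι : ℝ) ≤ ∑ u ∈ U, x u := by
    rw [hx, Finset.sum_sub_distrib, Finset.sum_const, nsmul_eq_mul]
    have : (U.card : ℝ) * (q ^ (2 * k) / Φ) ≤ q ^ (2 * k) := by
      rw [mul_div_assoc', div_le_iff₀ hΦ0', mul_comm]
      have : (U.card : ℝ) ≤ Φ := by exact_mod_cast hUΦ
      gcongr
    linarith
  set ε := C₀ * q ^ k / Φ with hε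
  have hε0 : 0 ≤ ε := by positivity
  rw [hsum']
  calc ‖∑ u ∈ U, (x u : ℂ) * χ u‖ ≤ ∑ u ∈ U, |x u| := by
        refine norm_sum_le_of_le _ fun u _ => ?_
        rw [norm_mul, Complex.norm_real, Real.norm_eq_abs]
        exact mul_le_of_le_one_right (abs_nonneg _) (hχ.norm_le_one hmon u)
    _ ≤ ∑ u ∈ U, (2 * ε - x u) := Finset.sum_le_sum fun u hu => by
        have := hxle u hu
        rw [abs_le]
        constructor <;> linarith
    _ = 2 * (U.card * ε) - ∑ u ∈ U, x u := by
        rw [Finset.sum_sub_distrib, Finset.sum_const, nsmul_eq_mul]; ring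
    _ ≤ 2 * (C₀ * q ^ k) + Fintype.card ι := by
        have : (U.card : ℝ) * ε ≤ C₀ * q ^ k := by
          rw [hε, mul_div_assoc', div_le_iff₀ hΦ0', mul_comm]
          have : (U.card : ℝ) ≤ Φ := by exact_mod_cast hUΦ
          gcongr
        linarith
    _ ≤ (2 * C₀ + Fintype.card ι) * q ^ k := by
        have : (1 : ℝ) ≤ q ^ k := one_le_pow₀ hq1
        nlinarith [(Nat.cast_nonneg (Fintype.card ι) : (0 : ℝ) ≤ _)]

end Split

section Divisors

variable {κ : Type} [Field κ] [Fintype κ] {K : Type} [Field K] [Algebra κ K]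

omit [Field κ] [Algebra κ K] in
variable (κ K) in
theorem pts_zero : pts κ K 0 = ∅ := by
  simp [pts]

theorem isPeriodicPt_frob_iff {θ : K} {n : ℕ} :
    Function.IsPeriodicPt (frob κ K) n θ ↔ θ ^ Fintype.card κ ^ n = θ := by
  rw [Function.IsPeriodicPt, Function.IsFixedPt, frob_iterate_apply]

theorem normPoly_eq_prod_iterate (θ : K) (n : ℕ) : normPoly (Fintype.card κ) θ n =
    ∏ j ∈ Finset.range n, (X - C ((frob κ K)^[j] θ)) :=
  Finset.prod_congr rfl fun j _ => by rw [frob_iterate_apply]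

theorem normPoly_mul {θ : K} {e : ℕ} (he : Function.IsPeriodicPt (frob κ K) e θ) (j : ℕ) :
    normPoly (Fintype.card κ) θ (e * j) = normPoly (Fintype.card κ) θ e ^ j := by
  induction j with
  | zero => simp [normPoly]
  | succ j ih =>
    rw [pow_succ, ← ih, mul_add, mul_one, normPoly_eq_prod_iterate, Finset.prod_range_add,
      ← normPoly_eq_prod_iterate, normPoly_eq_prod_iterate θ e]
    congr 1
    refine Finset.prod_congr rfl fun i _ => ?_
    rw [add_comm, Function.iterate_add_apply, (he.mul_const j).eq]

theorem rootMultiplicity_iterate_frob {g : K[X]} (hg : g.map (frob κ K) = g) (θ : K) (i : ℕ) :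
    rootMultiplicity ((frob κ K)^[i] θ) g = rootMultiplicity θ g := by
  induction i with
  | zero => rfl
  | succ i ih =>
    rw [Function.iterate_succ_apply', ← ih]
    conv_lhs => rw [← hg]
    exact (eq_rootMultiplicity_map (frob κ K).injective _).symm

theorem normPoly_minimalPeriod_pow_dvd_iff {g : K[X]} (hg0 : g ≠ 0) (hg : g.map (frob κ K) = g)
    {θ : K} (hθ : 0 < Function.minimalPeriod (frob κ K) θ) (j : ℕ) :
    normPoly (Fintype.card κ) θ (Function.minimalPeriod (frob κ K) θ) ^ j ∣ g ↔
      j ≤ rootMultiplicity θ g := by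
  rw [normPoly_eq_prod_iterate, ← Finset.prod_pow]
  constructor
  · intro h
    rw [le_rootMultiplicity_iff hg0]
    have h0 := Finset.dvd_prod_of_mem (fun i => (X - C ((frob κ K)^[i] θ)) ^ j)
      (Finset.mem_range.mpr hθ)
    rw [Function.iterate_zero, id] at h0
    exact h0.trans h
  · intro h
    refine Finset.prod_dvd_of_coprime (fun i hi k hk hik => ?_) fun i _ => ?_
    · refine IsCoprime.pow (isCoprime_X_sub_C_of_isUnit_sub (sub_ne_zero.mpr ?_).isUnit)
      exact fun h => hik (Function.iterate_injOn_Iio_minimalPeriod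
        (Finset.mem_range.mp hi) (Finset.mem_range.mp hk) h)
    · rwa [← le_rootMultiplicity_iff hg0, rootMultiplicity_iterate_frob hg]

theorem minimalPeriod_frob_pos {g : K[X]} (hg0 : g ≠ 0) (hg : g.map (frob κ K) = g) {θ : K}
    (hθ : g.IsRoot θ) : 0 < Function.minimalPeriod (frob κ K) θ := by
  classical
  have hroot : ∀ i, (frob κ K)^[i] θ ∈ g.roots.toFinset := fun i => by
    rw [Multiset.mem_toFinset, ← Multiset.count_pos, count_roots, rootMultiplicity_iterate_frob hg]
    exact (rootMultiplicity_pos hg0).mpr hθ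
  obtain ⟨i, -, j, -, hij, h⟩ := Set.infinite_univ.exists_ne_map_eq_of_mapsTo
    (f := fun i : ℕ => (frob κ K)^[i] θ) (fun i _ => hroot i) g.roots.toFinset.finite_toSet
  wlog hlt : i < j generalizing i j
  · exact this j i hij.symm h.symm (by omega)
  · refine Function.minimalPeriod_pos_of_mem_periodicPts ⟨j - i, by omega, ?_⟩
    refine (frob κ K).injective.iterate i ?_
    rw [← Function.iterate_add_apply, Nat.add_sub_cancel' hlt.le]
    exact h.symm

open Classical in
theorem card_filter_normPoly_dvd {g : K[X]} (hg0 : g ≠ 0) (hg : g.map (frob κ K) = g) {θ : K}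
    (hθ : g.IsRoot θ) : ((Finset.Icc 1 g.natDegree).filter fun k =>
      θ ^ Fintype.card κ ^ k = θ ∧ normPoly (Fintype.card κ) θ k ∣ g).card =
      rootMultiplicity θ g := by
  have hpos := minimalPeriod_frob_pos hg0 hg hθ
  have hper := Function.isPeriodicPt_minimalPeriod (frob κ K) θ
  set e := Function.minimalPeriod (frob κ K) θ with he
  have hdvd := normPoly_minimalPeriod_pow_dvd_iff hg0 hg hpos
  have hcard : (Finset.Icc 1 (rootMultiplicity θ g)).card = rootMultiplicity θ g := by simp
  rw [← hcard]
  symm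
  refine Finset.card_bij (fun j _ => e * j) (fun j hj => ?_)
    (fun j _ j' _ h => Nat.eq_of_mul_eq_mul_left hpos h) fun k hk => ?_
  · rw [Finset.mem_Icc] at hj
    have h1 := (hdvd j).mpr hj.2
    rw [← normPoly_mul hper] at h1
    rw [Finset.mem_filter, Finset.mem_Icc]
    refine ⟨⟨Nat.mul_pos hpos hj.1, ?_⟩, isPeriodicPt_frob_iff.mp (hper.mul_const j), h1⟩
    have := natDegree_le_of_dvd h1 hg0
    rwa [natDegree_normPoly] at this
  · rw [Finset.mem_filter, Finset.mem_Icc, ← isPeriodicPt_frob_iff] at hk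
    obtain ⟨⟨hk1, -⟩, hk2, hk3⟩ := hk
    obtain ⟨j, rfl⟩ := hk2.minimalPeriod_dvd
    rw [← he, normPoly_mul hper] at hk3
    refine ⟨j, Finset.mem_Icc.mpr ⟨?_, (hdvd j).mp hk3⟩, rfl⟩
    by_contra h
    simp [show j = 0 by omega] at hk1

open Classical in
theorem sum_card_charp_dvd [IsAlgClosed K] {f : κ[X]} (hf : f.Monic) :
    ∑ k ∈ Finset.range (f.natDegree + 1), ((pts κ K k).filter fun θ => charp κ k θ ∣ f).card =
      f.natDegree := by
  set g := f.map (algebraMap κ K) with hg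
  have hg0 : g ≠ 0 := (hf.map _).ne_zero
  have hgd : g.natDegree = f.natDegree := natDegree_map _
  have hgf : g.map (frob κ K) = g := by
    rw [hg, map_map]
    congr 1
    exact RingHom.ext (frob_algebraMap κ K)
  have h1 : ∑ k ∈ Finset.range (f.natDegree + 1),
      ((pts κ K k).filter fun θ => charp κ k θ ∣ f).card =
      ∑ k ∈ Finset.Icc 1 g.natDegree, (g.roots.toFinset.filter fun θ =>
        θ ^ Fintype.card κ ^ k = θ ∧ normPoly (Fintype.card κ) θ k ∣ g).card := by
    rw [Finset.sum_range_succ', pts_zero, Finset.filter_empty, Finset.card_empty, add_zero,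
      Finset.range_eq_Ico, Finset.sum_Ico_add'
        (fun k => ((pts κ K k).filter fun θ => charp κ k θ ∣ f).card) 0 _ 1, zero_add, hgd,
      Finset.Ico_add_one_right_eq_Icc]
    refine Finset.sum_congr rfl fun k hk => congrArg Finset.card ?_
    have hk0 : k ≠ 0 := by have := (Finset.mem_Icc.mp hk).1; omega
    ext θ
    rw [Finset.mem_filter, Finset.mem_filter, mem_pts hk0]
    constructor
    · rintro ⟨h1, h2⟩
      have h3 : normPoly (Fintype.card κ) θ k ∣ g := by
        rw [← map_charp h1]; exact Polynomial.map_dvd _ h2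
      refine ⟨?_, h1, h3⟩
      rw [Multiset.mem_toFinset, mem_roots hg0, ← dvd_iff_isRoot]
      refine dvd_trans ?_ h3
      refine dvd_trans ?_ (Finset.dvd_prod_of_mem _
        (Finset.mem_range.mpr (Nat.pos_of_ne_zero hk0)))
      simp
    · rintro ⟨-, h1, h2⟩
      refine ⟨h1, ?_⟩
      rwa [← map_charp h1, hg, map_dvd_map'] at h2
  rw [h1, ← hgd]
  conv_rhs => rw [← splits_iff_card_roots.mp (IsAlgClosed.splits g),
    ← Multiset.toFinset_sum_count_eq]
  have := Finset.sum_card_bipartiteAbove_eq_sum_card_bipartiteBelow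
    (s := Finset.Icc 1 g.natDegree) (t := g.roots.toFinset)
    (fun k θ => θ ^ Fintype.card κ ^ k = θ ∧ normPoly (Fintype.card κ) θ k ∣ g)
  refine this.trans (Finset.sum_congr rfl fun θ hθ => ?_)
  rw [count_roots]
  exact card_filter_normPoly_dvd hg0 hgf ((mem_roots hg0).mp (Multiset.mem_toFinset.mp hθ))

end Divisors

section Newton

variable {κ : Type} [Field κ] [Fintype κ]

open Classical in
variable (κ) in
/-- The monic polynomials of degree `d`. -/
noncomputable def monics (d : ℕ) : Finset κ[X] := (lowPolys κ d).image fun f => X ^ d + f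

theorem mem_monics {d : ℕ} {f : κ[X]} : f ∈ monics κ d ↔ f.Monic ∧ f.natDegree = d := by
  classical
  rw [monics, Finset.mem_image]
  constructor
  · rintro ⟨u, hu, rfl⟩
    rw [mem_lowPolys] at hu
    refine ⟨monic_X_pow_add hu, ?_⟩
    rw [natDegree_add_eq_left_of_degree_lt (by rwa [degree_X_pow]), natDegree_X_pow]
  · rintro ⟨hf, rfl⟩
    refine ⟨f - X ^ f.natDegree, ?_, by ring⟩
    rw [mem_lowPolys, ← degree_eq_natDegree hf.ne_zero]
    exact degree_sub_lt_left (by rw [degree_X_pow, degree_eq_natDegree hf.ne_zero]) hf.ne_zero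
      (by rw [hf.leadingCoeff, (monic_X_pow _).leadingCoeff])

/-- The sum of a character over the monic polynomials of degree `d`. -/
noncomputable def monicSum (χ : κ[X] →* ℂ) (d : ℕ) : ℂ := ∑ f ∈ monics κ d, χ f

theorem monicSum_zero (χ : κ[X] →* ℂ) : monicSum χ 0 = 1 := by
  have : monics κ 0 = {1} := by
    ext f
    rw [mem_monics, Finset.mem_singleton]
    exact ⟨fun h => h.1.natDegree_eq_zero.mp h.2, fun h => h ▸ ⟨monic_one, natDegree_one⟩⟩
  rw [monicSum, this, Finset.sum_singleton, map_one]

theorem IsNontrivial.monicSum_eq_zero {M : κ[X]} {χ : κ[X] →* ℂ} (hχ : IsNontrivial M χ)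
    (hM : M.Monic) {d : ℕ} (hd : M.natDegree ≤ d) : monicSum χ d = 0 := by
  have : monicSum χ d = ∑ x ∈ monics κ (d - M.natDegree) ×ˢ lowPolys κ M.natDegree,
      χ x.2 := by
    symm
    refine Finset.sum_bij' (fun x _ => M * x.1 + x.2) (fun f _ => (f /ₘ M, f %ₘ M)) ?_ ?_ ?_ ?_ ?_
    · rintro ⟨s, u⟩ hx
      rw [Finset.mem_product, mem_monics, mem_lowPolys] at hx
      obtain ⟨⟨hs, hsd⟩, hu⟩ := hx
      have hMs : (M * s).Monic := hM.mul hs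
      have hdeg : (M * s).natDegree = d := by rw [hM.natDegree_mul hs, hsd]; omega
      have hlt : u.degree < (M * s).degree := by
        rw [degree_eq_natDegree hMs.ne_zero, hdeg]
        exact hu.trans_le (by exact_mod_cast hd)
      exact mem_monics.mpr ⟨hMs.add_of_left hlt, by
        rw [natDegree_add_eq_left_of_degree_lt hlt, hdeg]⟩
    · intro f hf
      rw [mem_monics] at hf
      rw [Finset.mem_product, mem_monics]
      refine ⟨⟨?_, ?_⟩, modByMonic_mem_lowPolys hM f⟩
      · rw [Monic, leadingCoeff_divByMonic_of_monic hM, hf.1]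
        rw [degree_eq_natDegree hM.ne_zero, degree_eq_natDegree hf.1.ne_zero, hf.2]
        exact_mod_cast hd
      · rw [natDegree_divByMonic f hM, hf.2]
    · rintro ⟨s, u⟩ hx
      rw [Finset.mem_product, mem_lowPolys] at hx
      have hu : u.degree < M.degree := by rw [degree_eq_natDegree hM.ne_zero]; exact hx.2
      obtain ⟨h1, h2⟩ := div_modByMonic_unique s u hM ⟨add_comm _ _, hu⟩
      exact Prod.ext h1 h2
    · intro f _
      rw [add_comm]
      exact modByMonic_add_div f M
    · rintro ⟨s, u⟩ _
      exact (hχ.congr _ _ ⟨s, by ring⟩).symm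
  rw [this, Finset.sum_product]
  simp [hχ.sum_lowPolys_eq_zero hM]

open Classical in
theorem sum_monics_dvd (χ : κ[X] →* ℂ) {P : κ[X]} (hP : P.Monic) {d : ℕ} (hd : P.natDegree ≤ d) :
    ∑ f ∈ (monics κ d).filter (P ∣ ·), χ f = χ P * monicSum χ (d - P.natDegree) := by
  rw [monicSum, Finset.mul_sum]
  symm
  refine Finset.sum_bij (fun f _ => P * f) ?_ (fun f _ f' _ h => mul_left_cancel₀ hP.ne_zero h) ?_
    fun f _ => (map_mul _ _ _).symm
  · intro f hf
    rw [mem_monics] at hf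
    rw [Finset.mem_filter, mem_monics]
    exact ⟨⟨hP.mul hf.1, by rw [hP.natDegree_mul hf.1, hf.2]; omega⟩, dvd_mul_right _ _⟩
  · intro f hf
    rw [Finset.mem_filter, mem_monics] at hf
    obtain ⟨⟨h1, h2⟩, f', rfl⟩ := hf
    have hf' : f'.Monic := hP.of_mul_monic_left h1
    rw [hP.natDegree_mul hf'] at h2
    exact ⟨f', mem_monics.mpr ⟨hf', by omega⟩, rfl⟩

variable (K : Type) [Field K] [Algebra κ K] [IsAlgClosed K]

/-- Newton's identities for the `L`-function. -/
theorem natCast_mul_monicSum (χ : κ[X] →* ℂ) (d : ℕ) :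
    (d : ℂ) * monicSum χ d =
      ∑ k ∈ Finset.range (d + 1), charSum K χ k * monicSum χ (d - k) := by
  classical
  have h1 : (d : ℂ) * monicSum χ d = ∑ f ∈ monics κ d, ∑ k ∈ Finset.range (d + 1),
      ∑ θ ∈ pts κ K k, if charp κ k θ ∣ f then χ f else 0 := by
    rw [monicSum, Finset.mul_sum]
    refine Finset.sum_congr rfl fun f hf => ?_
    obtain ⟨hf1, hf2⟩ := mem_monics.mp hf
    have := sum_card_charp_dvd (K := K) hf1
    rw [hf2] at this
    simp_rw [← Finset.sum_filter, Finset.sum_const, nsmul_eq_mul]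
    rw [← Finset.sum_mul]
    congr 1
    exact_mod_cast this.symm
  rw [h1, Finset.sum_comm]
  refine Finset.sum_congr rfl fun k hk => ?_
  rw [Finset.sum_comm, charSum, Finset.sum_mul]
  refine Finset.sum_congr rfl fun θ hθ => ?_
  rw [← Finset.sum_filter]
  rcases eq_or_ne k 0 with rfl | hk0
  · simp [pts_zero] at hθ
  · rw [mem_pts hk0] at hθ
    have := sum_monics_dvd χ (charp_monic hθ) (d := d)
      (by rw [natDegree_charp hθ]; exact Nat.lt_succ_iff.mp (Finset.mem_range.mp hk))
    rwa [natDegree_charp hθ] at this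

end Newton

section PowerSums

theorem exists_eq_prod_one_sub (p : ℂ[X]) (hp : p.coeff 0 = 1) : ∃ s : Multiset ℂ,
    s.card = p.natDegree ∧ p = (s.map fun a => 1 - C a * X).prod := by
  induction hn : p.natDegree generalizing p with
  | zero =>
    refine ⟨0, rfl, ?_⟩
    rw [eq_C_of_natDegree_eq_zero hn, hp]
    simp
  | succ n ih =>
    obtain ⟨z, hz⟩ := Complex.exists_root (f := p) (natDegree_pos_iff_degree_pos.mp (by omega))
    obtain ⟨r, hr⟩ := dvd_iff_isRoot.mpr hz
    have hz0 : z ≠ 0 := by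
      rintro rfl
      rw [hr] at hp
      simp at hp
    have hr0 : r ≠ 0 := by
      rintro rfl
      rw [hr] at hp
      simp at hp
    have hfac : p = (1 - C z⁻¹ * X) * (C (-z) * r) := by
      have h : (C z : ℂ[X]) * C z⁻¹ = 1 := by rw [← C_mul, mul_inv_cancel₀ hz0, C_1]
      rw [hr, C_neg]
      linear_combination (-X * r) * h
    have hdeg : (C (-z) * r).natDegree = n := by
      rw [natDegree_C_mul (neg_ne_zero.mpr hz0)]
      rw [hr, natDegree_mul (X_sub_C_ne_zero z) hr0, natDegree_X_sub_C] at hn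
      omega
    have hc : (C (-z) * r).coeff 0 = 1 := by
      rw [hr] at hp
      simpa using hp
    obtain ⟨s, hs, hs'⟩ := ih _ hc hdeg
    refine ⟨z⁻¹ ::ₘ s, by simp [hs], ?_⟩
    rw [Multiset.map_cons, Multiset.prod_cons, ← hs', ← hfac]

open PowerSeries in
theorem X_mul_derivative_prod_one_sub (s : Multiset ℂ) :
    (PowerSeries.X : PowerSeries ℂ) *
      PowerSeries.derivative ℂ ((s.map fun a => (1 - Polynomial.C a * Polynomial.X : ℂ[X])).prod : ℂ[X]) =
      -(PowerSeries.mk fun n => if n = 0 then 0 else (s.map (· ^ n)).sum) *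
        ((s.map fun a => (1 - Polynomial.C a * Polynomial.X : ℂ[X])).prod : ℂ[X]) := by
  induction s using Multiset.induction with
  | empty =>
    have : (PowerSeries.mk fun n => if n = 0 then (0 : ℂ) else ((0 : Multiset ℂ).map (· ^ n)).sum) =
        0 := by ext n; simp
    rw [this]
    simp
  | cons a s ih =>
    set L : PowerSeries ℂ := (((s.map fun a => (1 - Polynomial.C a * Polynomial.X : ℂ[X])).prod :
      ℂ[X]) : PowerSeries ℂ) with hL
    set P : PowerSeries ℂ := PowerSeries.mk fun n => if n = 0 then 0 else (s.map (· ^ n)).sum with hP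
    set G : PowerSeries ℂ := PowerSeries.mk fun n => if n = 0 then 0 else a ^ n with hG
    have hPG : (PowerSeries.mk fun n => if n = 0 then 0 else ((a ::ₘ s).map (· ^ n)).sum) = G + P := by
      ext n
      rw [map_add, hG, hP, coeff_mk, coeff_mk, coeff_mk]
      split_ifs <;> simp
    have hGa : (1 - PowerSeries.C a * PowerSeries.X) * G = PowerSeries.C a * PowerSeries.X := by
      ext n
      rw [sub_mul, one_mul, mul_assoc, map_sub, PowerSeries.coeff_C_mul, PowerSeries.coeff_C_mul]
      rcases n with _ | n
      · simp [hG]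
      · rw [coeff_succ_X_mul, hG, coeff_mk, coeff_mk, PowerSeries.coeff_X]
        rcases n with _ | n
        · simp
        · simp [pow_succ']
    have hL' : (((a ::ₘ s).map fun a => (1 - Polynomial.C a * Polynomial.X : ℂ[X])).prod : ℂ[X]) =
        (1 - PowerSeries.C a * PowerSeries.X : PowerSeries ℂ) * L := by
      rw [Multiset.map_cons, Multiset.prod_cons, Polynomial.coe_mul, hL]
      simp
    have hd : PowerSeries.derivative ℂ (1 - PowerSeries.C a * PowerSeries.X : PowerSeries ℂ) =
        -PowerSeries.C a := by
      rw [map_sub, Derivation.leibniz]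
      simp
    rw [hL', hPG, Derivation.leibniz, hd, smul_eq_mul, smul_eq_mul]
    linear_combination (1 - PowerSeries.C a * PowerSeries.X) * ih + L * hGa

variable {κ : Type} [Field κ] [Fintype κ]
variable (K : Type) [Field K] [Algebra κ K] [IsAlgClosed K]

/-- The character sums are power sums of the inverse roots of the `L`-function. -/
theorem IsNontrivial.exists_charSum_eq {M : κ[X]} {χ : κ[X] →* ℂ} (hχ : IsNontrivial M χ)
    (hM : M.Monic) : ∃ s : Multiset ℂ, s.card + 1 ≤ M.natDegree ∧
      ∀ n ≠ 0, charSum K χ n = -(s.map (· ^ n)).sum := by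
  set p : ℂ[X] := ∑ d ∈ Finset.range M.natDegree, monomial d (monicSum χ d) with hp
  have hcoeff : ∀ d, p.coeff d = monicSum χ d := fun d => by
    rw [hp, finsetSum_coeff]
    simp_rw [coeff_monomial]
    rw [Finset.sum_ite_eq']
    split_ifs with h
    · rfl
    · exact (hχ.monicSum_eq_zero hM (by simpa using h)).symm
  obtain ⟨s, hs, hs'⟩ := exists_eq_prod_one_sub p (by rw [hcoeff, monicSum_zero])
  have hpos : 0 < M.natDegree := by
    by_contra h
    have := hχ.monicSum_eq_zero hM (d := 0) (by omega)
    rw [monicSum_zero] at this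
    exact one_ne_zero this
  refine ⟨s, ?_, ?_⟩
  · have : p.natDegree ≤ M.natDegree - 1 := natDegree_le_iff_coeff_eq_zero.mpr fun d hd => by
      rw [hcoeff, hχ.monicSum_eq_zero hM (by omega)]
    omega
  · have hnewton : (PowerSeries.X : PowerSeries ℂ) * PowerSeries.derivative ℂ (p : PowerSeries ℂ) =
        (PowerSeries.mk (charSum K χ)) * (p : PowerSeries ℂ) := by
      ext d
      rw [PowerSeries.coeff_mul d (PowerSeries.mk (charSum K χ)), Finset.Nat.sum_antidiagonal_eq_sum_range_succ
        (fun i j => PowerSeries.coeff i (PowerSeries.mk (charSum K χ)) *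
          PowerSeries.coeff j (p : PowerSeries ℂ))]
      simp only [PowerSeries.coeff_mk, Polynomial.coeff_coe, hcoeff]
      rw [← natCast_mul_monicSum]
      rcases d with _ | d
      · simp
      · rw [PowerSeries.coeff_succ_X_mul, PowerSeries.coeff_derivative, Polynomial.coeff_coe, hcoeff]
        push_cast
        ring
    rw [hs', X_mul_derivative_prod_one_sub s, ← hs'] at hnewton
    have hp0 : (p : PowerSeries ℂ) ≠ 0 := by
      rw [Ne, Polynomial.coe_eq_zero_iff]
      intro h
      have := hcoeff 0
      rw [h, monicSum_zero] at this
      simp at this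
    have := mul_right_cancel₀ hp0 hnewton
    intro n hn
    have h := congrArg (PowerSeries.coeff n) this
    rw [map_neg, PowerSeries.coeff_mk, PowerSeries.coeff_mk, if_neg hn] at h
    exact h.symm

end PowerSums

section Recurrence

theorem exists_forall_norm_pow_sub_one_le (T : Finset ℂ) (hT : ∀ a ∈ T, ‖a‖ = 1) (k₀ : ℕ) :
    ∃ k ≥ k₀, ∀ a ∈ T, ‖a ^ k - 1‖ ≤ 1 / 2 := by
  set v : ℕ → T → ℂ := fun k a => (a : ℂ) ^ k with hv
  have hmem : ∀ k, v k ∈ Metric.closedBall (0 : T → ℂ) 1 := fun k => by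
    rw [mem_closedBall_zero_iff, pi_norm_le_iff_of_nonneg zero_le_one]
    intro a
    rw [hv, norm_pow, hT a a.2, one_pow]
  obtain ⟨w, -, φ, hφ, hlim⟩ := (isCompact_closedBall (0 : T → ℂ) 1).tendsto_subseq hmem
  obtain ⟨N, hN⟩ := Metric.cauchySeq_iff'.mp hlim.cauchySeq (1 / 2) (by norm_num)
  have hle : φ N ≤ φ (φ N + N + k₀) := hφ.monotone (by omega)
  have hge : φ N + N + k₀ ≤ φ (φ N + N + k₀) := hφ.id_le _
  refine ⟨φ (φ N + N + k₀) - φ N, by omega, fun a ha => ?_⟩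
  have h1 := (hN (φ N + N + k₀) (by omega)).le
  rw [dist_eq_norm, pi_norm_le_iff_of_nonneg (by norm_num)] at h1
  have h2 := h1 ⟨a, ha⟩
  have h3 : a ^ φ (φ N + N + k₀) - a ^ φ N =
      a ^ φ N * (a ^ (φ (φ N + N + k₀) - φ N) - 1) := by
    rw [mul_sub, mul_one, ← pow_add, Nat.add_sub_cancel' hle]
  have h4 : ‖a ^ φ (φ N + N + k₀) - a ^ φ N‖ ≤ 1 / 2 := h2
  rwa [h3, norm_mul, norm_pow, hT a ha, one_pow, one_mul] at h4

/-- An upper bound for the real parts of power sums bounds all the summands. -/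
theorem norm_le_of_re_sum_pow_le (s : Multiset ℂ) {d : ℕ} (hd : d ≠ 0) {R c : ℝ} (hR : 0 ≤ R)
    (h : ∀ k ≠ 0, (s.map (· ^ (d * k))).sum.re ≤ c * R ^ (d * k)) : ∀ a ∈ s, ‖a‖ ≤ R := by
  classical
  by_contra! hcon
  obtain ⟨a₀, ha₀, hRa⟩ := hcon
  obtain ⟨b, hb, hmax⟩ := s.toFinset.exists_max_image (‖·‖) ⟨a₀, Multiset.mem_toFinset.mpr ha₀⟩
  set ρ := ‖b‖ with hρ
  have hRρ : R < ρ := hRa.trans_le (hmax a₀ (Multiset.mem_toFinset.mpr ha₀))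
  have hρ0 : 0 < ρ := hR.trans_lt hRρ
  obtain ⟨ρ', hρ'1, hρ'2, hρ'3⟩ : ∃ ρ' : ℝ, ρ' < ρ ∧ R ≤ ρ' ∧ ∀ a ∈ s, ‖a‖ ≠ ρ → ‖a‖ ≤ ρ' := by
    obtain ⟨x, hx, hx'⟩ := (insert R ((s.toFinset.filter fun a => ‖a‖ ≠ ρ).image (‖·‖))).exists_max_image
      id (Finset.insert_nonempty _ _)
    refine ⟨x, ?_, hx' R (Finset.mem_insert_self _ _), fun a ha hne => hx' _
      (Finset.mem_insert_of_mem (Finset.mem_image_of_mem _ ?_))⟩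
    · rcases Finset.mem_insert.mp hx with rfl | hx
      · exact hRρ
      · obtain ⟨a, ha, rfl⟩ := Finset.mem_image.mp hx
        obtain ⟨ha1, ha2⟩ := Finset.mem_filter.mp ha
        exact lt_of_le_of_ne (hmax a ha1) ha2
    · exact Finset.mem_filter.mpr ⟨Multiset.mem_toFinset.mpr ha, hne⟩
  have hρ'0 : 0 ≤ ρ' := hR.trans hρ'2
  set T := s.toFinset.filter fun a => ‖a‖ = ρ with hT
  -- the bound along recurrence times
  have key : ∀ k ≠ 0, (∀ a ∈ T, ‖(a ^ d / (ρ : ℂ) ^ d) ^ k - 1‖ ≤ 1 / 2) →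
      ρ ^ (d * k) / 2 ≤ (|c| + s.card) * ρ' ^ (d * k) := by
    intro k hk hrec
    have hnn : ∀ n : ℕ, 0 ≤ ρ' ^ n := fun n => pow_nonneg hρ'0 n
    have hlow : ∀ a ∈ s.toFinset, -ρ' ^ (d * k) + (if a = b then ρ ^ (d * k) / 2 else 0) ≤
        (a ^ (d * k)).re := by
      intro a ha
      by_cases haT : ‖a‖ = ρ
      · have h1 := hrec a (Finset.mem_filter.mpr ⟨ha, haT⟩)
        have hρc : (ρ : ℂ) ^ (d * k) ≠ 0 := pow_ne_zero _ (by exact_mod_cast hρ0.ne')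
        have h2 : a ^ (d * k) = ((ρ ^ (d * k) : ℝ) : ℂ) * (a ^ d / (ρ : ℂ) ^ d) ^ k := by
          rw [div_pow, ← pow_mul, ← pow_mul]
          push_cast
          field_simp
        have h3 : 1 / 2 ≤ ((a ^ d / (ρ : ℂ) ^ d) ^ k).re := by
          have h4 := (Complex.abs_re_le_norm _).trans h1
          rw [Complex.sub_re, Complex.one_re, abs_le] at h4
          linarith
        rw [h2, Complex.re_ofReal_mul]
        have h5 : 0 ≤ ρ ^ (d * k) := by positivity
        have h6 := hnn (d * k)
        split_ifs <;> nlinarith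
      · have hab : a ≠ b := fun hab => haT (hab ▸ rfl)
        rw [if_neg hab, add_zero]
        have h1 := hρ'3 a (Multiset.mem_toFinset.mp ha) haT
        have h2 := Complex.abs_re_le_norm (a ^ (d * k))
        rw [norm_pow] at h2
        have h3 : ‖a‖ ^ (d * k) ≤ ρ' ^ (d * k) := by gcongr
        exact (abs_le.mp (h2.trans h3)).1
    have hsum : (s.map (· ^ (d * k))).sum.re =
        ∑ a ∈ s.toFinset, (s.count a : ℝ) * (a ^ (d * k)).re := by
      rw [Finset.sum_multiset_map_count, Complex.re_sum]
      refine Finset.sum_congr rfl fun a _ => ?_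
      rw [nsmul_eq_mul, ← Complex.ofReal_natCast, Complex.re_ofReal_mul]
    have h1 := h k hk
    rw [hsum] at h1
    have h2 : -((s.card : ℝ) * ρ' ^ (d * k)) + ρ ^ (d * k) / 2 ≤
        ∑ a ∈ s.toFinset, (s.count a : ℝ) * (a ^ (d * k)).re := by
      calc -((s.card : ℝ) * ρ' ^ (d * k)) + ρ ^ (d * k) / 2
          ≤ -((s.card : ℝ) * ρ' ^ (d * k)) + s.count b * (ρ ^ (d * k) / 2) := by
            have : (1 : ℝ) ≤ s.count b := by
              exact_mod_cast Multiset.count_pos.mpr (Multiset.mem_toFinset.mp hb)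
            have : 0 ≤ ρ ^ (d * k) / 2 := by positivity
            nlinarith
        _ = ∑ a ∈ s.toFinset, (s.count a : ℝ) *
            (-ρ' ^ (d * k) + (if a = b then ρ ^ (d * k) / 2 else 0)) := by
            simp_rw [mul_add, Finset.sum_add_distrib, mul_ite, mul_zero]
            rw [Finset.sum_ite_eq' s.toFinset b, if_pos hb, ← Finset.sum_mul]
            rw [← Multiset.toFinset_sum_count_eq s]
            push_cast
            ring
        _ ≤ _ := Finset.sum_le_sum fun a ha =>
            mul_le_mul_of_nonneg_left (hlow a ha) (Nat.cast_nonneg _)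
    have h3 : c * R ^ (d * k) ≤ |c| * ρ' ^ (d * k) := by
      gcongr
      exact le_abs_self c
    linarith
  have hT1 : ∀ a ∈ T.image fun a => a ^ d / (ρ : ℂ) ^ d, ‖a‖ = 1 := by
    intro x hx
    obtain ⟨a, ha, rfl⟩ := Finset.mem_image.mp hx
    rw [norm_div, norm_pow, norm_pow, (Finset.mem_filter.mp ha).2, Complex.norm_real,
      Real.norm_of_nonneg hρ0.le, div_self (by positivity)]
  have hlim : Filter.Tendsto (fun k : ℕ => (|c| + s.card) * ((ρ' / ρ) ^ d) ^ k) Filter.atTop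
      (nhds 0) := by
    rw [← mul_zero (|c| + (s.card : ℝ))]
    refine (tendsto_pow_atTop_nhds_zero_of_lt_one (by positivity) ?_).const_mul _
    exact pow_lt_one₀ (by positivity) (by rwa [div_lt_one hρ0]) hd
  obtain ⟨k₀, hk₀⟩ := (hlim.eventually (gt_mem_nhds (show (0 : ℝ) < 1 / 2 by norm_num))).exists_forall_of_atTop
  obtain ⟨k, hk, hrec⟩ := exists_forall_norm_pow_sub_one_le _ hT1 (k₀ + 1)
  have h1 := key k (by omega) fun a ha => hrec _ (Finset.mem_image_of_mem _ ha)
  have h2 := hk₀ k (by omega)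
  rw [← pow_mul, div_pow, mul_div_assoc', div_lt_iff₀ (by positivity)] at h2
  linarith

end Recurrence

section SplitBound

variable {κ : Type} [Field κ] [Fintype κ]
variable (K : Type) [Field K] [Algebra κ K] [IsAlgClosed K]

theorem norm_multiset_sum_pow_le {s : Multiset ℂ} {R : ℝ} (hs : ∀ a ∈ s, ‖a‖ ≤ R) (n : ℕ) :
    ‖(s.map (· ^ n)).sum‖ ≤ s.card * R ^ n := by
  refine (norm_multiset_sum_le _).trans ?_
  rw [Multiset.map_map, ← nsmul_eq_mul]
  refine (Multiset.sum_le_card_nsmul _ (R ^ n) ?_).trans_eq (by simp)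
  intro x hx
  obtain ⟨a, ha, rfl⟩ := Multiset.mem_map.mp hx
  have := hs a ha
  simp only [Function.comp, norm_pow]
  gcongr

/-- A one-sided bound along an arithmetic progression gives the Riemann hypothesis. -/
theorem IsNontrivial.norm_charSum_le_of_re {M : κ[X]} {χ : κ[X] →* ℂ} (hχ : IsNontrivial M χ)
    (hM : M.Monic) {d : ℕ} (hd : d ≠ 0) {c : ℝ}
    (h : ∀ k ≠ 0, -(charSum K χ (d * k)).re ≤ c * √(Fintype.card κ) ^ (d * k)) {n : ℕ}
    (hn : n ≠ 0) : ‖charSum K χ n‖ ≤ (M.natDegree - 1 : ℕ) * √(Fintype.card κ) ^ n := by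
  obtain ⟨s, hs, hsum⟩ := hχ.exists_charSum_eq K hM
  have hR := norm_le_of_re_sum_pow_le s hd (R := √(Fintype.card κ)) (c := c) (Real.sqrt_nonneg _)
    fun k hk => by
      have h1 := h k hk
      rwa [hsum _ (mul_ne_zero hd hk), Complex.neg_re, neg_neg] at h1
  rw [hsum n hn, norm_neg]
  refine (norm_multiset_sum_pow_le hR n).trans ?_
  gcongr
  omega

theorem IsNontrivial.norm_charSum_le_of_splits {M : κ[X]} {χ : κ[X] →* ℂ} (hχ : IsNontrivial M χ)
    (hM : M.Monic) (hs : M.Splits) {n : ℕ} (hn : n ≠ 0) :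
    ‖charSum K χ n‖ ≤ (M.natDegree - 1 : ℕ) * √(Fintype.card κ) ^ n := by
  classical
  have hfac : M = ∏ i : M.roots.toFinset, (X - C (i : κ)) ^ ((M.roots.count i.1 - 1) + 1) := by
    conv_lhs => rw [hs.eq_prod_roots_of_monic hM, Finset.prod_multiset_map_count]
    rw [← Finset.prod_coe_sort]
    refine Finset.prod_congr rfl fun i _ => ?_
    rw [Nat.sub_add_cancel]
    exact Multiset.count_pos.mpr (Multiset.mem_toFinset.mp i.2)
  obtain ⟨c, -, hc⟩ := exists_norm_charSum_le_of_split K Subtype.val_injective _ hfac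
  refine hχ.norm_charSum_le_of_re K hM two_ne_zero (c := c) (fun k hk => ?_) hn
  rw [pow_mul, Real.sq_sqrt (Nat.cast_nonneg _)]
  exact (neg_le_abs _).trans ((Complex.abs_re_le_norm _).trans (hc χ hχ k hk))

end SplitBound

section Extension

variable (κ E K : Type) [Field κ] [Fintype κ] [Field E] [Fintype E] [Algebra κ E]
variable [Field K] [Algebra κ K] [Algebra E K] [IsScalarTower κ E K]

omit [Fintype κ] [Fintype E] in
theorem map_map_algebraMap (f : κ[X]) :
    (f.map (algebraMap κ E)).map (algebraMap E K) = f.map (algebraMap κ K) := by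
  rw [map_map, ← IsScalarTower.algebraMap_eq]

omit [IsScalarTower κ E K] in
theorem frob_pow_finrank_algebraMap (x : E) :
    (frob κ K ^ Module.finrank κ E) (algebraMap E K x) = algebraMap E K x := by
  rw [RingHom.coe_pow, frob_iterate_apply, ← Module.card_eq_pow_finrank (K := κ) (V := E),
    ← map_pow, FiniteField.pow_card]

theorem map_algebraMap_map_frob (f : κ[X]) (j : ℕ) :
    (f.map (algebraMap κ K)).map (frob κ K ^ j) = f.map (algebraMap κ K) := by
  rw [map_map]
  congr 1
  ext c
  rw [RingHom.comp_apply, RingHom.coe_pow, Function.iterate_fixed (frob_algebraMap κ K c)]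

/-- The product of the conjugates of a polynomial over `E`, as a polynomial over `K`. -/
noncomputable def conjProd (f : E[X]) : K[X] :=
  ∏ j ∈ Finset.range (Module.finrank κ E), (f.map (algebraMap E K)).map (frob κ K ^ j)

omit [IsScalarTower κ E K] in
theorem exists_map_eq_conjProd (f : E[X]) :
    ∃ g : κ[X], g.map (algebraMap κ K) = conjProd κ E K f := by
  refine exists_map_algebraMap_eq κ ?_
  have hpos : 0 < Module.finrank κ E := Module.finrank_pos
  rcases eq_or_ne f 0 with rfl | hf
  · have : conjProd κ E K (0 : E[X]) = 0 :=
      Finset.prod_eq_zero (Finset.mem_range.mpr hpos) (by simp)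
    rw [this, Polynomial.map_zero]
  · have hf0 : f.map (algebraMap E K) ≠ 0 :=
      (Polynomial.map_ne_zero_iff (algebraMap E K).injective).mpr hf
    refine mul_left_cancel₀ hf0 ?_
    set g := f.map (algebraMap E K) with hg
    have hn : g.map (frob κ K ^ Module.finrank κ E) = g := by
      rw [hg, map_map]
      congr 1
      ext x
      exact frob_pow_finrank_algebraMap κ E K x
    have h1 : g * (conjProd κ E K f).map (frob κ K) =
        ∏ j ∈ Finset.range (Module.finrank κ E + 1), g.map (frob κ K ^ j) := by
      rw [Finset.prod_range_succ', mul_comm, conjProd, Polynomial.map_prod]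
      congr 1
      · refine Finset.prod_congr rfl fun j _ => ?_
        rw [← hg, map_map, pow_succ']
        rfl
      · rw [pow_zero]
        exact Polynomial.map_id.symm
    rw [h1, Finset.prod_range_succ, hn, mul_comm, conjProd]

/-- The norm of polynomials. -/
noncomputable def polyNorm : E[X] →* κ[X] where
  toFun f := (exists_map_eq_conjProd κ E K f).choose
  map_one' := by
    refine map_injective_algebraMap κ K ?_
    rw [(exists_map_eq_conjProd κ E K 1).choose_spec]
    simp [conjProd]
  map_mul' f g := by
    refine map_injective_algebraMap κ K ?_
    rw [(exists_map_eq_conjProd κ E K _).choose_spec, Polynomial.map_mul,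
      (exists_map_eq_conjProd κ E K _).choose_spec, (exists_map_eq_conjProd κ E K _).choose_spec]
    simp [conjProd, Finset.prod_mul_distrib]

omit [IsScalarTower κ E K] in
theorem map_polyNorm (f : E[X]) :
    (polyNorm κ E K f).map (algebraMap κ K) = conjProd κ E K f :=
  (exists_map_eq_conjProd κ E K f).choose_spec

variable {κ E}

theorem dvd_polyNorm_sub {M : κ[X]} {f g : E[X]} (h : M.map (algebraMap κ E) ∣ f - g) :
    M ∣ polyNorm κ E K f - polyNorm κ E K g := by
  rw [← map_dvd_map' (algebraMap κ K), Polynomial.map_sub, map_polyNorm, map_polyNorm,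
    ← Ideal.mem_span_singleton, ← Ideal.Quotient.eq, conjProd, conjProd, map_prod, map_prod]
  refine Finset.prod_congr rfl fun j _ => ?_
  rw [Ideal.Quotient.eq, Ideal.mem_span_singleton, ← Polynomial.map_sub, ← Polynomial.map_sub,
    ← map_algebraMap_map_frob κ K M j, ← map_map_algebraMap κ E K]
  exact Polynomial.map_dvd _ (Polynomial.map_dvd _ h)

theorem dvd_map_polyNorm (f : E[X]) : f ∣ (polyNorm κ E K f).map (algebraMap κ E) := by
  rw [← map_dvd_map' (algebraMap E K), map_map_algebraMap, map_polyNorm]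
  refine dvd_trans ?_ (Finset.dvd_prod_of_mem _ (Finset.mem_range.mpr Module.finrank_pos))
  rw [pow_zero]
  exact (Polynomial.map_id (p := f.map (algebraMap E K))).symm.dvd

theorem isCoprime_of_polyNorm {M : κ[X]} {f : E[X]} (h : IsCoprime (polyNorm κ E K f) M) :
    IsCoprime f (M.map (algebraMap κ E)) :=
  (h.map (mapRingHom (algebraMap κ E))).of_isCoprime_of_dvd_left (dvd_map_polyNorm K f)

theorem isDirichlet_comp_polyNorm {M : κ[X]} {χ : κ[X] →* ℂ} (hχ : IsDirichlet M χ) :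
    IsDirichlet (M.map (algebraMap κ E)) (χ.comp (polyNorm κ E K)) where
  congr _ _ h := hχ.congr _ _ (dvd_polyNorm_sub K h)
  zero _ h := hχ.zero _ fun h' => h (isCoprime_of_polyNorm K h')

variable (κ E) in
omit [Algebra κ K] [Algebra E K] [IsScalarTower κ E K] in
theorem pts_one_eq : pts E K 1 = pts κ K (Module.finrank κ E) := by
  ext θ
  rw [mem_pts one_ne_zero, mem_pts Module.finrank_pos.ne', pow_one,
    Module.card_eq_pow_finrank (K := κ) (V := E)]

variable {K}

theorem map_charp_one {θ : K} (hθ : θ ∈ pts E K 1) :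
    (charp E 1 θ).map (algebraMap E K) = X - C θ := by
  rw [map_charp ((mem_pts one_ne_zero).mp hθ), normPoly]
  simp

omit [IsScalarTower κ E K] in
theorem polyNorm_charp_one {θ : K} (hθ : θ ∈ pts E K 1) :
    polyNorm κ E K (charp E 1 θ) = charp κ (Module.finrank κ E) θ := by
  refine map_injective_algebraMap κ K ?_
  have hθ' := hθ
  rw [pts_one_eq κ E K, mem_pts Module.finrank_pos.ne'] at hθ'
  rw [map_polyNorm, map_charp hθ', conjProd, map_charp_one hθ]
  refine Finset.prod_congr rfl fun j _ => ?_
  rw [Polynomial.map_sub, map_X, map_C, RingHom.coe_pow, frob_iterate_apply]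

variable (K) in
omit [IsScalarTower κ E K] in
theorem charSum_comp_polyNorm (χ : κ[X] →* ℂ) :
    charSum K (χ.comp (polyNorm κ E K)) 1 = charSum K χ (Module.finrank κ E) := by
  rw [charSum, charSum, ← pts_one_eq κ E K]
  exact Finset.sum_congr rfl fun θ hθ => congrArg χ (polyNorm_charp_one hθ)

variable (κ E) in
omit [Field K] [Algebra κ K] [Algebra E K] [IsScalarTower κ E K] in
theorem sqrt_card_eq : √(Fintype.card E : ℝ) = √(Fintype.card κ) ^ Module.finrank κ E := by
  rw [Module.card_eq_pow_finrank (K := κ) (V := E), Nat.cast_pow]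
  refine (Real.sqrt_eq_iff_mul_self_eq (by positivity) (by positivity)).mpr ?_
  rw [← mul_pow, Real.mul_self_sqrt (Nat.cast_nonneg _)]

end Extension

section RiemannHypothesis

variable {κ : Type} [Field κ] [Fintype κ]
variable (K : Type) [Field K] [Algebra κ K] [IsAlgClosed K]

variable (κ) in
theorem exists_extension {n : ℕ} (hn : n ≠ 0) : ∃ (E : Type) (_ : Field E) (_ : Fintype E)
    (_ : Algebra κ E) (_ : Algebra E K) (_ : IsScalarTower κ E K), Module.finrank κ E = n := by
  obtain ⟨p, hp⟩ := CharP.exists κ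
  have hfp : Fact p.Prime := ⟨CharP.char_is_prime κ p⟩
  have hn' : NeZero n := ⟨hn⟩
  let φ : FiniteField.Extension κ p n →ₐ[κ] K := IsAlgClosed.lift
  let : Algebra (FiniteField.Extension κ p n) K := φ.toRingHom.toAlgebra
  have : IsScalarTower κ (FiniteField.Extension κ p n) K :=
    IsScalarTower.of_algebraMap_eq fun x => (φ.commutes x).symm
  exact ⟨_, inferInstance, Fintype.ofFinite _, inferInstance, inferInstance, this,
    FiniteField.finrank_extension κ p n⟩

/-- A polynomial over a finite field splits in the extensions of suitable degrees. -/
theorem exists_splits {M : κ[X]} (hM : M.Monic) : ∃ d ≠ 0, ∀ k ≠ 0,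
    ∀ (E : Type) [Field E] [Fintype E] [Algebra κ E] [Algebra E K] [IsScalarTower κ E K],
      Module.finrank κ E = d * k → (M.map (algebraMap κ E)).Splits := by
  classical
  set g := M.map (algebraMap κ K) with hg
  have hg0 : g ≠ 0 := (hM.map _).ne_zero
  have hgf : g.map (frob κ K) = g := by
    have := map_algebraMap_map_frob κ K M 1
    rwa [pow_one] at this
  refine ⟨∏ θ ∈ g.roots.toFinset, Function.minimalPeriod (frob κ K) θ, ?_, ?_⟩
  · refine Finset.prod_ne_zero_iff.mpr fun θ hθ => ?_
    exact (minimalPeriod_frob_pos hg0 hgf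
      ((mem_roots hg0).mp (Multiset.mem_toFinset.mp hθ))).ne'
  · intro k _ E _ _ _ _ _ hE
    refine Splits.of_splits_map (algebraMap E K) (IsAlgClosed.splits _) fun θ hθ => ?_
    rw [map_map_algebraMap] at hθ
    refine exists_algebraMap_eq E ?_
    rw [Module.card_eq_pow_finrank (K := κ) (V := E), ← isPeriodicPt_frob_iff, hE]
    refine Function.IsPeriodicPt.mul_const ?_ k
    refine (Function.isPeriodicPt_minimalPeriod _ θ).trans_dvd ?_
    exact Finset.dvd_prod_of_mem _ (Multiset.mem_toFinset.mpr hθ)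

/-- **Riemann hypothesis** for Dirichlet characters over a finite field. -/
theorem IsNontrivial.norm_charSum_le {M : κ[X]} {χ : κ[X] →* ℂ} (hχ : IsNontrivial M χ)
    (hM : M.Monic) {n : ℕ} (hn : n ≠ 0) :
    ‖charSum K χ n‖ ≤ (M.natDegree - 1 : ℕ) * √(Fintype.card κ) ^ n := by
  obtain ⟨d, hd, hsplit⟩ := exists_splits K hM
  refine hχ.norm_charSum_le_of_re K hM hd (c := (M.natDegree - 1 : ℕ)) (fun k hk => ?_) hn
  obtain ⟨E, _, _, _, _, _, hE⟩ := exists_extension κ K (mul_ne_zero hd hk)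
  have hME : (M.map (algebraMap κ E)).Monic := hM.map _
  have hχE := isDirichlet_comp_polyNorm (E := E) K hχ.toIsDirichlet
  rw [← hE, ← charSum_comp_polyNorm K χ]
  by_cases htriv : ∃ f, IsCoprime f (M.map (algebraMap κ E)) ∧ χ.comp (polyNorm κ E K) f ≠ 1
  · have hnt : IsNontrivial (M.map (algebraMap κ E)) (χ.comp (polyNorm κ E K)) := ⟨hχE, htriv⟩
    have h1 := hnt.norm_charSum_le_of_splits K hME (hsplit k hk E hE) one_ne_zero
    rw [natDegree_map, pow_one, sqrt_card_eq κ E] at h1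
    exact (neg_le_abs _).trans ((Complex.abs_re_le_norm _).trans h1)
  · push Not at htriv
    have h0 : 0 ≤ (charSum K (χ.comp (polyNorm κ E K)) 1).re := by
      rw [charSum, Complex.re_sum]
      refine Finset.sum_nonneg fun θ _ => ?_
      by_cases hc : IsCoprime (charp E 1 θ) (M.map (algebraMap κ E))
      · rw [htriv _ hc, Complex.one_re]; exact zero_le_one
      · rw [hχE.zero _ hc, Complex.zero_re]
    have : 0 ≤ ((M.natDegree - 1 : ℕ) : ℝ) * √(Fintype.card κ) ^ Module.finrank κ E := by
      positivity
    linarith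

end RiemannHypothesis

section Orthogonality

theorem mulChar_pow_apply_unit {R : Type} [CommRing R] (χ : MulChar R ℂ) (j : ℕ) {x : R}
    (hx : IsUnit x) : (χ ^ j) x = χ x ^ j := by
  obtain ⟨u, rfl⟩ := hx
  exact MulChar.pow_apply_coe χ j u

theorem sum_mulChar_pow {E : Type} [Field E] [Fintype E] {χ : MulChar E ℂ} {r : ℕ} (hr : r ≠ 0)
    (hχ : orderOf χ = r) [DecidableEq E] {x : E} (hx : x ≠ 0) :
    ∑ j ∈ Finset.range r, (χ ^ j) x =
      if x ^ ((Fintype.card E - 1) / r) = 1 then (r : ℂ) else 0 := by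
  have hdvd : r ∣ Fintype.card E - 1 := hχ ▸ MulChar.orderOf_dvd_card_sub_one E χ
  obtain ⟨k, hk⟩ := hdvd
  have hpos : 0 < Fintype.card E - 1 := Nat.sub_pos_of_lt Fintype.one_lt_card
  have hk0 : k ≠ 0 := by rintro rfl; omega
  simp_rw [mulChar_pow_apply_unit χ _ (isUnit_iff_ne_zero.mpr hx)]
  rw [hk, Nat.mul_div_cancel_left k (Nat.pos_of_ne_zero hr)]
  have hiff : x ^ k = 1 ↔ χ x = 1 := by
    obtain ⟨γ, hγ⟩ := IsCyclic.exists_generator (α := Eˣ)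
    obtain ⟨a, ha⟩ := mem_powers_iff_mem_zpowers.mpr (hγ (Units.mk0 x hx))
    have hxa : x = (γ : E) ^ a := by
      have := congrArg Units.val ha
      simpa using this.symm
    have hord : orderOf γ = r * k := by
      rw [orderOf_eq_card_of_forall_mem_zpowers hγ, Nat.card_eq_fintype_card,
        Fintype.card_units, hk]
    have hχγ : orderOf (χ γ) = r := by
      rw [← hχ]
      refine Nat.dvd_antisymm (orderOf_dvd_of_pow_eq_one ?_) (orderOf_dvd_of_pow_eq_one ?_)
      · rw [← MulChar.pow_apply_coe, pow_orderOf_eq_one, MulChar.one_apply_coe]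
      · refine MulChar.ext fun u => ?_
        obtain ⟨b, hb⟩ := mem_powers_iff_mem_zpowers.mpr (hγ u)
        have hub : (u : E) = (γ : E) ^ b := by
          rw [← Units.val_pow_eq_pow_val]; exact congrArg Units.val hb.symm
        rw [MulChar.pow_apply_coe, MulChar.one_apply_coe, hub, map_pow, pow_right_comm,
          pow_orderOf_eq_one, one_pow]
    rw [hxa, map_pow, ← orderOf_dvd_iff_pow_eq_one (x := χ γ), hχγ, ← pow_mul, ← Units.val_pow_eq_pow_val,
      Units.val_eq_one, ← orderOf_dvd_iff_pow_eq_one, hord]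
    exact Nat.mul_dvd_mul_iff_right (Nat.pos_of_ne_zero hk0)
  split_ifs with h
  · rw [hiff] at h
    simp [h]
  · rw [hiff] at h
    have h1 : χ x ^ r = 1 := by
      rw [← mulChar_pow_apply_unit χ _ (isUnit_iff_ne_zero.mpr hx), ← hχ, pow_orderOf_eq_one,
        MulChar.one_apply (isUnit_iff_ne_zero.mpr hx)]
    rw [geom_sum_eq h, h1, sub_self, zero_div]

theorem sum_mulChar_mul {A : Type} [CommRing A] [Finite A] [Fintype (MulChar A ℂ)]
    [DecidableEq A] (u : Aˣ) (a : A) :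
    ∑ ψ : MulChar A ℂ, ψ ↑u⁻¹ * ψ a = if a = u then (Nat.card Aˣ : ℂ) else 0 := by
  simp_rw [← map_mul]
  have : ↑u⁻¹ * a = 1 ↔ a = u := by
    rw [Units.inv_mul_eq_iff_eq_mul, mul_one]
  rw [← if_congr this rfl rfl]
  split_ifs with h
  · simp [h, ← MulChar.card_eq_card_units_of_hasEnoughRootsOfUnity A ℂ, Nat.card_eq_fintype_card]
  · obtain ⟨χ, hχ⟩ := MulChar.exists_apply_ne_one_of_hasEnoughRootsOfUnity A ℂ h
    refine eq_zero_of_mul_eq_self_left hχ ?_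
    simp only [Finset.mul_sum, ← MulChar.mul_apply]
    exact Fintype.sum_bijective _ (Group.mulLeft_bijective χ) _ _ fun χ' ↦ rfl

end Orthogonality

section Lift

variable {F : Type} [Field F] {M : F[X]}

theorem isUnit_mk_iff {f : F[X]} :
    IsUnit (Ideal.Quotient.mk (Ideal.span {M}) f) ↔ IsCoprime f M := by
  constructor
  · intro h
    obtain ⟨b, hb⟩ := h.exists_right_inv
    obtain ⟨b, rfl⟩ := Ideal.Quotient.mk_surjective b
    rw [← map_mul, ← map_one (Ideal.Quotient.mk _), Ideal.Quotient.eq,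
      Ideal.mem_span_singleton] at hb
    obtain ⟨c, hc⟩ := hb
    exact ⟨b, -c, by linear_combination hc⟩
  · rintro ⟨a, b, h⟩
    refine IsUnit.of_mul_eq_one (Ideal.Quotient.mk _ a) ?_
    rw [← map_mul, ← map_one (Ideal.Quotient.mk _), Ideal.Quotient.eq, Ideal.mem_span_singleton]
    exact ⟨-b, by linear_combination h⟩

/-- The Dirichlet character on polynomials attached to a character of the residue ring. -/
noncomputable def liftChar (ψ : MulChar (F[X] ⧸ Ideal.span {M}) ℂ) : F[X] →* ℂ :=
  ψ.toMonoidHom.comp (Ideal.Quotient.mk (Ideal.span {M})).toMonoidHom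

theorem liftChar_apply (ψ : MulChar (F[X] ⧸ Ideal.span {M}) ℂ) (f : F[X]) :
    liftChar ψ f = ψ (Ideal.Quotient.mk _ f) := rfl

theorem isDirichlet_liftChar (ψ : MulChar (F[X] ⧸ Ideal.span {M}) ℂ) :
    IsDirichlet M (liftChar ψ) where
  congr f g h := by
    rw [liftChar_apply, liftChar_apply,
      Ideal.Quotient.eq.mpr (Ideal.mem_span_singleton.mpr h)]
  zero f h := by
    rw [liftChar_apply]
    exact ψ.map_nonunit fun h' => h (isUnit_mk_iff.mp h')

theorem isNontrivial_liftChar {ψ : MulChar (F[X] ⧸ Ideal.span {M}) ℂ} (hψ : ψ ≠ 1) :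
    IsNontrivial M (liftChar ψ) where
  toIsDirichlet := isDirichlet_liftChar ψ
  exists_ne := by
    by_contra! h
    refine hψ (MulChar.ext fun u => ?_)
    obtain ⟨f, hf⟩ := Ideal.Quotient.mk_surjective (u : F[X] ⧸ Ideal.span {M})
    rw [MulChar.one_apply_coe, ← hf]
    exact h f (isUnit_mk_iff.mp (hf ▸ u.isUnit))

theorem finite_quotient [Finite F] (hM : M ≠ 0) : Finite (F[X] ⧸ Ideal.span {M}) := by
  have : Module.Finite F (AdjoinRoot M) := (AdjoinRoot.powerBasis hM).finite
  exact Module.finite_of_finite F (M := AdjoinRoot M)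

end Lift

section AdjoinRootNorm

variable {E : Type} [Field E]

/-- The norm of the class of a polynomial in the algebra obtained by adjoining a root of `h`. -/
noncomputable def adjNorm (h : E[X]) : E[X] →* E :=
  (Algebra.norm E : AdjoinRoot h →* E).comp (AdjoinRoot.mk h).toMonoidHom

theorem adjNorm_apply (h f : E[X]) : adjNorm h f = Algebra.norm E (AdjoinRoot.mk h f) := rfl

theorem adjNorm_congr {h f₁ f₂ : E[X]} (hf : h ∣ f₁ - f₂) : adjNorm h f₁ = adjNorm h f₂ := by
  rw [adjNorm_apply, adjNorm_apply, AdjoinRoot.mk_eq_mk.mpr hf]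

theorem adjNorm_C {h : E[X]} (hh : h ≠ 0) (c : E) : adjNorm h (C c) = c ^ h.natDegree := by
  rw [adjNorm_apply, AdjoinRoot.mk_C, ← AdjoinRoot.algebraMap_eq, Algebra.norm_algebraMap,
    (AdjoinRoot.powerBasis hh).finrank, AdjoinRoot.powerBasis_dim]

theorem adjNorm_C_sub_X {h : E[X]} (hh : h.Monic) (c : E) : adjNorm h (C c - X) = h.eval c := by
  have h1 := charpoly_leftMulMatrix (AdjoinRoot.powerBasis hh.ne_zero)
  rw [AdjoinRoot.minpoly_powerBasis_gen_of_monic hh] at h1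
  rw [adjNorm_apply, map_sub, AdjoinRoot.mk_C, ← AdjoinRoot.algebraMap_eq, AdjoinRoot.mk_X,
    Algebra.norm_eq_matrix_det (AdjoinRoot.powerBasis hh.ne_zero).basis, map_sub,
    AlgHom.commutes, ← AdjoinRoot.powerBasis_gen hh.ne_zero]
  refine Eq.trans ?_ (congrArg (Polynomial.eval c) h1)
  rw [Matrix.eval_charpoly]
  rfl

end AdjoinRootNorm

theorem exists_dvd_pow_of_forall_irreducible_dvd {F : Type} [Field F] {g M : F[X]} (hg : g ≠ 0)
    (h : ∀ p, Irreducible p → p ∣ g → p ∣ M) : ∃ n : ℕ, g ∣ M ^ n := by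
  induction g using WfDvdMonoid.induction_on_irreducible with
  | zero => exact absurd rfl hg
  | unit u hu => exact ⟨0, hu.dvd⟩
  | mul a i ha hi ih =>
    obtain ⟨n, hn⟩ := ih ha fun p hp hpa => h p hp (hpa.mul_left i)
    exact ⟨n + 1, by
      rw [pow_succ']
      exact mul_dvd_mul (h i hi (dvd_mul_right i a)) hn⟩

section Twist

variable {E : Type} [Field E]

/-- The product of a Kummer character attached to `h` with a given character. -/
noncomputable def twist (χ : MulChar E ℂ) (h : E[X]) (ψ : E[X] →* ℂ) : E[X] →* ℂ :=
  χ.toMonoidHom.comp (adjNorm h) * ψ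

theorem twist_apply (χ : MulChar E ℂ) (h : E[X]) (ψ : E[X] →* ℂ) (f : E[X]) :
    twist χ h ψ f = χ (adjNorm h f) * ψ f := rfl

theorem isDirichlet_twist (χ : MulChar E ℂ) {h M : E[X]} {ψ : E[X] →* ℂ} (hψ : IsDirichlet M ψ)
    {n : ℕ} (hM : h ∣ M ^ n) : IsDirichlet (M * h) (twist χ h ψ) where
  congr f₁ f₂ hf := by
    rw [twist_apply, twist_apply, adjNorm_congr ((dvd_mul_left h M).trans hf),
      hψ.congr _ _ ((dvd_mul_right M h).trans hf)]
  zero f hf := by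
    rw [twist_apply, hψ.zero f fun hfM =>
      hf (hfM.mul_right (hfM.pow_right.of_isCoprime_of_dvd_right hM)), mul_zero]

end Twist

section TwistedSum

variable {F E : Type} (K : Type) [Field F] [Fintype F] [Field E] [Fintype E] [Algebra F E]
variable [Field K] [Algebra F K] [Algebra E K] [IsScalarTower F E K] [IsAlgClosed K]

omit [IsScalarTower F E K] [IsAlgClosed K] in
theorem pts_one_eq_image [DecidableEq K] :
    pts E K 1 = Finset.univ.image (algebraMap E K) := by
  ext θ
  rw [mem_pts one_ne_zero, pow_one, Finset.mem_image]
  constructor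
  · intro h
    obtain ⟨e, he⟩ := exists_algebraMap_eq E h
    exact ⟨e, Finset.mem_univ e, he⟩
  · rintro ⟨e, -, rfl⟩
    rw [← map_pow, FiniteField.pow_card]

omit [Fintype F] [Algebra F E] [Algebra F K] [IsScalarTower F E K] [IsAlgClosed K] in
theorem charp_one_algebraMap (e : E) : charp E 1 (algebraMap E K e) = X - C e := by
  classical
  refine map_injective_algebraMap E K ?_
  rw [map_charp_one (by rw [pts_one_eq_image]; exact Finset.mem_image_of_mem _ (Finset.mem_univ e)),
    Polynomial.map_sub, map_X, map_C]

omit [Fintype F] [Algebra F E] [Algebra F K] [IsScalarTower F E K] [IsAlgClosed K] in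
theorem charSum_one_eq (χ : E[X] →* ℂ) : charSum K χ 1 = ∑ e : E, χ (X - C e) := by
  classical
  rw [charSum, pts_one_eq_image, Finset.sum_image fun _ _ _ _ h => (algebraMap E K).injective h]
  exact Finset.sum_congr rfl fun e _ => by rw [charp_one_algebraMap]

omit [IsScalarTower F E K] [IsAlgClosed K] in
theorem polyNorm_C_pow (c : E) (hc : c ≠ 0) :
    polyNorm F E K (C c) ^ (Fintype.card F - 1) = 1 := by
  have hu : IsUnit (polyNorm F E K (C c)) :=
    (isUnit_C.mpr (isUnit_iff_ne_zero.mpr hc)).map (polyNorm F E K)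
  obtain ⟨d, hd, hdc⟩ := Polynomial.isUnit_iff.mp hu
  rw [← hdc, ← C_pow, FiniteField.pow_card_sub_one_eq_one d hd.ne_zero, C_1]

omit [IsAlgClosed K] in
theorem isNontrivial_twist {g M : F[X]} (hg : g.Monic) {n : ℕ} (hgM : g ∣ M ^ n)
    {ψ : F[X] →* ℂ} (hψ : IsDirichlet M ψ) {χ : MulChar E ℂ} {r : ℕ} (hr : r.Prime)
    (hχr : χ ^ r = 1) (hχ : χ ≠ 1) (hrg : ¬ r ∣ g.natDegree) (hrq : ¬ r ∣ Fintype.card F - 1) :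
    IsNontrivial (M.map (algebraMap F E) * g.map (algebraMap F E))
      (twist χ (g.map (algebraMap F E)) (ψ.comp (polyNorm F E K))) where
  toIsDirichlet := by
    refine isDirichlet_twist χ (isDirichlet_comp_polyNorm K hψ) (n := n) ?_
    rw [← Polynomial.map_pow]
    exact Polynomial.map_dvd _ hgM
  exists_ne := by
    by_contra! h
    have hord : orderOf χ = r := orderOf_eq_prime (hp := ⟨hr⟩) hχr hχ
    have h1 : χ ^ (g.natDegree * (Fintype.card F - 1)) = 1 := by
      refine MulChar.ext fun u => ?_
      have hu := h (C (u : E)) (isCoprime_one_left.of_isCoprime_of_dvd_left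
        (isUnit_C.mpr u.isUnit).dvd)
      have h2 := congrArg (· ^ (Fintype.card F - 1)) hu
      simp only [twist_apply, mul_pow, one_pow, MonoidHom.comp_apply] at h2
      rw [← map_pow ψ, polyNorm_C_pow K _ u.ne_zero, map_one, mul_one,
        adjNorm_C (hg.map _).ne_zero, natDegree_map, map_pow, ← pow_mul] at h2
      rw [MulChar.pow_apply_coe, MulChar.one_apply_coe, h2]
    rw [← orderOf_dvd_iff_pow_eq_one, hord, hr.dvd_mul] at h1
    exact h1.elim hrg hrq

/-- The bound for mixed sums of a Kummer character and a Dirichlet character. -/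
theorem norm_sum_twist_le {g M : F[X]} (hg : g.Monic) (hM : M.Monic) {n : ℕ} (hgM : g ∣ M ^ n)
    {ψ : F[X] →* ℂ} (hψ : IsDirichlet M ψ) {χ : MulChar E ℂ} {r : ℕ} (hr : r.Prime)
    (hχr : χ ^ r = 1) (hχ : χ ≠ 1) (hrg : ¬ r ∣ g.natDegree) (hrq : ¬ r ∣ Fintype.card F - 1) :
    ‖∑ e : E, χ ((g.map (algebraMap F E)).eval e) *
        ψ (charp F (Module.finrank F E) (algebraMap E K e))‖ ≤
      (M.natDegree + g.natDegree : ℕ) * √(Fintype.card E) := by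
  classical
  have hnt := isNontrivial_twist (E := E) K hg hgM hψ hr hχr hχ hrg hrq
  have h1 := hnt.norm_charSum_le K ((hM.map _).mul (hg.map _)) one_ne_zero
  rw [charSum_one_eq, pow_one, (hM.map _).natDegree_mul (hg.map _), natDegree_map,
    natDegree_map] at h1
  set ε := χ (adjNorm (g.map (algebraMap F E)) (C (-1))) with hε
  have hterm : ∀ e : E, twist χ (g.map (algebraMap F E)) (ψ.comp (polyNorm F E K)) (X - C e) =
      ε * (χ ((g.map (algebraMap F E)).eval e) *
        ψ (charp F (Module.finrank F E) (algebraMap E K e))) := by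
    intro e
    have h2 : (X - C e : E[X]) = C (-1) * (C e - X) := by
      rw [C_neg, C_1]; ring
    have h3 : polyNorm F E K (X - C e) = charp F (Module.finrank F E) (algebraMap E K e) := by
      rw [← charp_one_algebraMap K e]
      refine polyNorm_charp_one ?_
      rw [pts_one_eq_image]
      exact Finset.mem_image_of_mem _ (Finset.mem_univ e)
    rw [twist_apply, MonoidHom.comp_apply, h3, h2, map_mul, map_mul, adjNorm_C_sub_X (hg.map _),
      mul_assoc]
  have hε1 : ‖ε‖ = 1 := by
    have : ε ^ 2 = 1 := by
      rw [hε, ← map_pow, ← map_pow, ← C_pow, neg_one_sq, C_1, map_one, map_one]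
    exact Complex.norm_eq_one_of_pow_eq_one this two_ne_zero
  rw [Finset.sum_congr rfl fun e _ => hterm e, ← Finset.mul_sum, norm_mul, hε1, one_mul] at h1
  refine h1.trans (mul_le_mul_of_nonneg_right ?_ (Real.sqrt_nonneg _))
  exact Nat.cast_le.mpr (Nat.sub_le _ _)

end TwistedSum

section ElementCharpoly

variable (F : Type) {E : Type} (K : Type) [Field F] [Fintype F] [Field E] [Fintype E]
variable [Algebra F E] [Field K] [Algebra F K] [Algebra E K]

/-- The characteristic polynomial over `F` of an element of the finite extension `E`. -/
noncomputable def elemCharp (e : E) : F[X] :=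
  charp F (Module.finrank F E) (algebraMap E K e)

variable {F}

omit [Algebra F K] in
theorem algebraMap_pow_card (e : E) :
    algebraMap E K e ^ Fintype.card F ^ Module.finrank F E = algebraMap E K e := by
  rw [← Module.card_eq_pow_finrank (K := F) (V := E), ← map_pow, FiniteField.pow_card]

theorem elemCharp_monic (e : E) : (elemCharp F K e).Monic := charp_monic (algebraMap_pow_card K e)

theorem natDegree_elemCharp (e : E) : (elemCharp F K e).natDegree = Module.finrank F E :=
  natDegree_charp (algebraMap_pow_card K e)

theorem map_elemCharp (e : E) : (elemCharp F K e).map (algebraMap F K) =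
    normPoly (Fintype.card F) (algebraMap E K e) (Module.finrank F E) :=
  map_charp (algebraMap_pow_card K e)

variable [IsScalarTower F E K]

theorem aeval_elemCharp (e : E) : aeval e (elemCharp F K e) = 0 := by
  refine (algebraMap E K).injective ?_
  rw [map_zero, ← aeval_algebraMap_apply, aeval_def, ← eval_map, map_elemCharp, normPoly,
    eval_prod]
  refine Finset.prod_eq_zero (Finset.mem_range.mpr Module.finrank_pos) ?_
  simp

theorem eval_map_ne_zero_of_isCoprime {g : F[X]} {e : E} (h : IsCoprime (elemCharp F K e) g) :
    (g.map (algebraMap F E)).eval e ≠ 0 := by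
  obtain ⟨a, b, hab⟩ := h
  intro h0
  have := congrArg (aeval e) hab
  rw [map_add, map_mul, map_mul, aeval_elemCharp, mul_zero, zero_add, map_one, aeval_def e g,
    ← eval_map, h0, mul_zero] at this
  exact zero_ne_one this

theorem isCoprime_elemCharp {M : F[X]} {e : E} (h : (M.map (algebraMap F E)).eval e ≠ 0) :
    IsCoprime (elemCharp F K e) M := by
  rw [← isCoprime_map (algebraMap F K), map_elemCharp, normPoly]
  refine IsCoprime.prod_left fun j _ => ?_
  refine ((irreducible_X_sub_C _).coprime_iff_not_dvd).mpr fun hd => h ?_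
  rw [dvd_iff_isRoot, IsRoot, ← frob_iterate_apply, ← RingHom.coe_pow,
    ← map_algebraMap_map_frob F K M j, eval_map_apply, map_eq_zero,
    ← map_map_algebraMap F E K, eval_map_apply, map_eq_zero] at hd
  exact hd

theorem card_not_isCoprime_elemCharp_le {M : F[X]} (hM : M ≠ 0)
    [DecidablePred fun e : E => IsCoprime (elemCharp F K e) M] :
    (Finset.univ.filter fun e : E => ¬ IsCoprime (elemCharp F K e) M).card ≤ M.natDegree := by
  classical
  rw [← natDegree_map (algebraMap F E)]
  refine (Finset.card_le_card (t := (M.map (algebraMap F E)).roots.toFinset) fun e he => ?_).trans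
    ((Multiset.toFinset_card_le _).trans (card_roots' _))
  rw [Finset.mem_filter] at he
  rw [Multiset.mem_toFinset, mem_roots (map_ne_zero hM), IsRoot]
  by_contra h
  exact he.2 (isCoprime_elemCharp K h)

omit [IsScalarTower F E K] in
theorem charSum_finrank_eq (χ : F[X] →* ℂ) :
    charSum K χ (Module.finrank F E) = ∑ e : E, χ (elemCharp F K e) := by
  classical
  rw [charSum, ← pts_one_eq F E K, pts_one_eq_image,
    Finset.sum_image fun _ _ _ _ h => (algebraMap E K).injective h]
  rfl

variable [IsAlgClosed K]

section Expansion

variable {g M : F[X]} {n : ℕ}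

theorem norm_sum_kummer_mul_liftChar_le (hg : g.Monic) (hM : M.Monic) (hgM : g ∣ M ^ n)
    {χ : MulChar E ℂ} {r : ℕ} (hr : r.Prime) (hχ : orderOf χ = r) (hrg : ¬ r ∣ g.natDegree)
    (hrq : ¬ r ∣ Fintype.card F - 1) (ψ : MulChar (F[X] ⧸ Ideal.span {M}) ℂ) {j : ℕ} (hj : j < r)
    (h : (j, ψ) ≠ (0, 1)) :
    ‖∑ e : E, (χ ^ j) ((g.map (algebraMap F E)).eval e) * liftChar ψ (elemCharp F K e)‖ ≤
      (M.natDegree + g.natDegree : ℕ) * √(Fintype.card E) := by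
  rcases eq_or_ne j 0 with rfl | hj0
  · have hψ : ψ ≠ 1 := fun h' => h (by rw [h'])
    have h1 := (isNontrivial_liftChar hψ).norm_charSum_le K hM
      (n := Module.finrank F E) Module.finrank_pos.ne'
    rw [charSum_finrank_eq, ← sqrt_card_eq F E] at h1
    have hterm : ∀ e : E, (χ ^ 0) ((g.map (algebraMap F E)).eval e) *
        liftChar ψ (elemCharp F K e) = liftChar ψ (elemCharp F K e) := by
      intro e
      by_cases hc : IsCoprime (elemCharp F K e) M
      · rw [pow_zero, MulChar.one_apply (isUnit_iff_ne_zero.mpr (eval_map_ne_zero_of_isCoprime K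
          (hc.pow_right.of_isCoprime_of_dvd_right hgM))), one_mul]
      · rw [(isDirichlet_liftChar ψ).zero _ hc, mul_zero]
    rw [Finset.sum_congr rfl fun e _ => hterm e]
    refine h1.trans (mul_le_mul_of_nonneg_right ?_ (Real.sqrt_nonneg _))
    exact Nat.cast_le.mpr (by omega)
  · have h1 : (χ ^ j) ^ r = 1 := by rw [pow_right_comm, ← hχ, pow_orderOf_eq_one, one_pow]
    have h2 : χ ^ j ≠ 1 := fun h' => by
      rw [← orderOf_dvd_iff_pow_eq_one, hχ] at h'
      exact absurd (Nat.le_of_dvd (Nat.pos_of_ne_zero hj0) h') (by omega)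
    exact norm_sum_twist_le K hg hM hgM (isDirichlet_liftChar ψ) hr h1 h2 hrg hrq

omit [IsAlgClosed K] in
theorem norm_sum_principal_sub_le (hM : M.Monic) (hgM : g ∣ M ^ n) (χ : MulChar E ℂ) :
    ‖∑ e : E, (χ ^ 0) ((g.map (algebraMap F E)).eval e) *
      liftChar (1 : MulChar (F[X] ⧸ Ideal.span {M}) ℂ) (elemCharp F K e) - Fintype.card E‖ ≤
      M.natDegree := by
  classical
  have hterm : ∀ e : E, (χ ^ 0) ((g.map (algebraMap F E)).eval e) *
      liftChar (1 : MulChar (F[X] ⧸ Ideal.span {M}) ℂ) (elemCharp F K e) =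
      1 - if ¬ IsCoprime (elemCharp F K e) M then 1 else 0 := by
    intro e
    split_ifs with hc
    · rw [pow_zero, MulChar.one_apply (isUnit_iff_ne_zero.mpr (eval_map_ne_zero_of_isCoprime K
        (hc.pow_right.of_isCoprime_of_dvd_right hgM))), one_mul, liftChar_apply,
        MulChar.one_apply (isUnit_mk_iff.mpr hc), sub_zero]
    · rw [(isDirichlet_liftChar _).zero _ hc, mul_zero, sub_self]
  rw [Finset.sum_congr rfl fun e _ => hterm e, Finset.sum_sub_distrib, Finset.sum_boole,
    Finset.sum_const, Finset.card_univ, nsmul_one, sub_sub_cancel_left, norm_neg,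
    Complex.norm_natCast]
  exact Nat.cast_le.mpr (card_not_isCoprime_elemCharp_le K hM.ne_zero)

omit [IsAlgClosed K] in
theorem sum_kummer_mul_sum_liftChar [Finite (F[X] ⧸ Ideal.span {M})]
    [Fintype (MulChar (F[X] ⧸ Ideal.span {M}) ℂ)] (hgM : g ∣ M ^ n)
    {χ : MulChar E ℂ} {r : ℕ} (hr : r.Prime) (hχ : orderOf χ = r) {β : F[X]}
    {u : (F[X] ⧸ Ideal.span {M})ˣ} (hu : Ideal.Quotient.mk _ β = (u : F[X] ⧸ Ideal.span {M}))
    (e : E) [Decidable (M ∣ elemCharp F K e - β ∧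
      (g.map (algebraMap F E)).eval e ^ ((Fintype.card E - 1) / r) = 1)] :
    (∑ j ∈ Finset.range r, (χ ^ j) ((g.map (algebraMap F E)).eval e)) *
      ∑ ψ : MulChar (F[X] ⧸ Ideal.span {M}) ℂ, ψ ↑u⁻¹ * liftChar ψ (elemCharp F K e) =
    if M ∣ elemCharp F K e - β ∧
      (g.map (algebraMap F E)).eval e ^ ((Fintype.card E - 1) / r) = 1 then
      ((r * polyPhi F M : ℕ) : ℂ) else 0 := by
  classical
  simp_rw [liftChar_apply]
  rw [sum_mulChar_mul, ← hu, Ideal.Quotient.eq, Ideal.mem_span_singleton]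
  by_cases h : M ∣ elemCharp F K e - β
  · have hc : IsCoprime (elemCharp F K e) M :=
      isCoprime_of_dvd_sub h (isUnit_mk_iff.mp (hu ▸ u.isUnit))
    rw [sum_mulChar_pow hr.ne_zero hχ (eval_map_ne_zero_of_isCoprime K
      (hc.pow_right.of_isCoprime_of_dvd_right hgM)), if_pos h, ite_mul, zero_mul, polyPhi]
    simp only [h, true_and, Nat.cast_mul]
  · rw [if_neg h, mul_zero, if_neg fun h' => h h'.1]

theorem abs_card_sub_le (hg : g.Monic) (hM : M.Monic) (hgM : g ∣ M ^ n)
    {r : ℕ} (hr : r.Prime) (hrE : r ∣ Fintype.card E - 1) (hrg : ¬ r ∣ g.natDegree)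
    (hrq : ¬ r ∣ Fintype.card F - 1) {β : F[X]} (hβ : IsCoprime β M)
    [DecidablePred fun e : E => M ∣ elemCharp F K e - β ∧
      (g.map (algebraMap F E)).eval e ^ ((Fintype.card E - 1) / r) = 1] :
    |((Finset.univ.filter fun e : E => M ∣ elemCharp F K e - β ∧
      (g.map (algebraMap F E)).eval e ^ ((Fintype.card E - 1) / r) = 1).card : ℝ) -
      Fintype.card E / (r * polyPhi F M : ℕ)| ≤
    (M.natDegree + g.natDegree : ℕ) * √(Fintype.card E) + M.natDegree := by
  classical
  have : Finite (F[X] ⧸ Ideal.span {M}) := finite_quotient hM.ne_zero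
  have : Fintype (MulChar (F[X] ⧸ Ideal.span {M}) ℂ) := Fintype.ofFinite _
  obtain ⟨χ, hχ⟩ := MulChar.exists_mulChar_orderOf E hrE
    (Complex.isPrimitiveRoot_exp r hr.ne_zero)
  obtain ⟨u, hu⟩ := isUnit_mk_iff.mpr hβ
  set B : ℝ := (M.natDegree + g.natDegree : ℕ) * √(Fintype.card E) with hB
  have hB0 : 0 ≤ B := by positivity
  set N := (Finset.univ.filter fun e : E => M ∣ elemCharp F K e - β ∧
      (g.map (algebraMap F E)).eval e ^ ((Fintype.card E - 1) / r) = 1).card with hN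
  set R := r * polyPhi F M with hR
  set T : ℕ × MulChar (F[X] ⧸ Ideal.span {M}) ℂ → ℂ := fun p =>
    ∑ e : E, (χ ^ p.1) ((g.map (algebraMap F E)).eval e) * liftChar p.2 (elemCharp F K e) with hT
  set S := Finset.range r ×ˢ (Finset.univ : Finset (MulChar (F[X] ⧸ Ideal.span {M}) ℂ)) with hS
  have hcard : S.card = R := by
    rw [hS, Finset.card_product, Finset.card_range, Finset.card_univ, ← Nat.card_eq_fintype_card,
      MulChar.card_eq_card_units_of_hasEnoughRootsOfUnity, hR, polyPhi]
  have hmem : ((0, 1) : ℕ × MulChar (F[X] ⧸ Ideal.span {M}) ℂ) ∈ S :=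
    Finset.mem_product.mpr ⟨Finset.mem_range.mpr hr.pos, Finset.mem_univ _⟩
  have hRpos : (1 : ℝ) ≤ R := by
    rw [← hcard]
    exact_mod_cast Finset.card_pos.mpr ⟨_, hmem⟩
  have hmain : (R : ℂ) * N = ∑ p ∈ S, p.2 ↑u⁻¹ * T p := by
    have h1 : (R : ℂ) * N = ∑ e : E, (∑ j ∈ Finset.range r,
        (χ ^ j) ((g.map (algebraMap F E)).eval e)) *
        ∑ ψ : MulChar (F[X] ⧸ Ideal.span {M}) ℂ, ψ ↑u⁻¹ * liftChar ψ (elemCharp F K e) := by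
      rw [Finset.sum_congr rfl fun e _ => sum_kummer_mul_sum_liftChar K hgM hr hχ hu.symm e,
        ← Finset.sum_filter, Finset.sum_const, nsmul_eq_mul, mul_comm]
    rw [h1]
    simp_rw [Finset.sum_mul_sum]
    rw [Finset.sum_comm, hS, Finset.sum_product]
    refine Finset.sum_congr rfl fun j _ => ?_
    rw [Finset.sum_comm]
    refine Finset.sum_congr rfl fun ψ _ => ?_
    rw [hT, Finset.mul_sum]
    exact Finset.sum_congr rfl fun e _ => by ring
  have hunit : ∀ ψ : MulChar (F[X] ⧸ Ideal.span {M}) ℂ, ‖ψ ↑u⁻¹‖ ≤ 1 := by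
    intro ψ
    obtain ⟨f, hf⟩ := Ideal.Quotient.mk_surjective (↑u⁻¹ : F[X] ⧸ Ideal.span {M})
    rw [← hf]
    exact (isDirichlet_liftChar ψ).norm_le_one hM f
  have hbound : ∀ p ∈ S, ‖p.2 ↑u⁻¹ * T p - if p = (0, 1) then (Fintype.card E : ℂ) else 0‖ ≤
      B + if p = (0, 1) then (M.natDegree : ℝ) else 0 := by
    rintro ⟨j, ψ⟩ hp
    split_ifs with h
    · obtain ⟨rfl, rfl⟩ := Prod.mk.inj h
      rw [MulChar.one_apply_coe, one_mul]
      exact (norm_sum_principal_sub_le K hM hgM χ).trans (le_add_of_nonneg_left hB0)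
    · rw [sub_zero, add_zero, norm_mul]
      refine (mul_le_of_le_one_left (norm_nonneg _) (hunit ψ)).trans ?_
      exact norm_sum_kummer_mul_liftChar_le K hg hM hgM hr hχ hrg hrq ψ
        (Finset.mem_range.mp (Finset.mem_product.mp hp).1) h
  have hsum : ‖(R : ℂ) * N - Fintype.card E‖ ≤ R * B + M.natDegree := by
    have h2 := norm_sum_le_of_le S hbound
    rw [Finset.sum_sub_distrib, ← hmain, Finset.sum_ite_eq' , if_pos hmem, Finset.sum_add_distrib,
      Finset.sum_const, hcard, nsmul_eq_mul, Finset.sum_ite_eq', if_pos hmem] at h2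
    exact h2
  have hreal : |(R : ℝ) * N - Fintype.card E| ≤ R * B + M.natDegree := by
    have : ((R : ℂ) * N - Fintype.card E) = (((R : ℝ) * N - Fintype.card E : ℝ) : ℂ) := by
      push_cast; rfl
    rwa [this, Complex.norm_real, Real.norm_eq_abs] at hsum
  have hR0 : (0 : ℝ) < R := by linarith
  have hfact : (N : ℝ) - Fintype.card E / (R : ℕ) = (R * N - Fintype.card E) / R := by
    field_simp
  rw [hfact, abs_div, abs_of_pos hR0, div_le_iff₀ hR0]
  refine hreal.trans ?_
  have : (M.natDegree : ℝ) ≤ M.natDegree * R :=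
    le_mul_of_one_le_right (Nat.cast_nonneg _) hRpos
  linarith

end Expansion

end ElementCharpoly

section PrimeDegree

variable {F E : Type} (K : Type) [Field F] [Fintype F] [Field E] [Fintype E]
variable [Algebra F E] [Field K] [Algebra F K] [Algebra E K] [IsScalarTower F E K]

theorem elemCharp_eq_minpoly (hE : (Module.finrank F E).Prime) {e : E}
    (he : e ∉ (algebraMap F E).range) : elemCharp F K e = minpoly F e := by
  have hint : IsIntegral F e := Algebra.IsIntegral.isIntegral e
  have hdeg : (minpoly F e).natDegree = Module.finrank F E :=
    (hE.eq_one_or_self_of_dvd _ (minpoly.degree_dvd hint)).resolve_left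
      fun h => he (minpoly.natDegree_eq_one_iff.mp h)
  exact eq_of_monic_of_dvd_of_natDegree_le (minpoly.monic hint) (elemCharp_monic K e)
    (minpoly.dvd _ _ (aeval_elemCharp K e)) (by rw [natDegree_elemCharp, hdeg])

theorem elemCharp_eq_iff (hE : (Module.finrank F E).Prime) {P : F[X]} (hPm : P.Monic)
    (hP : Irreducible P) (hd : P.natDegree = Module.finrank F E) {e : E} :
    (e ∉ (algebraMap F E).range ∧ elemCharp F K e = P) ↔ aeval e P = 0 := by
  constructor
  · rintro ⟨-, rfl⟩
    exact aeval_elemCharp K e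
  · intro h
    have hmin := minpoly.eq_of_irreducible_of_monic hP h hPm
    have he : e ∉ (algebraMap F E).range := fun he => by
      rw [hmin, minpoly.natDegree_eq_one_iff.mpr he] at hd
      exact hE.one_lt.ne hd
    exact ⟨he, by rw [elemCharp_eq_minpoly K hE he, hmin]⟩

omit [Field K] [Algebra F K] [Algebra E K] [IsScalarTower F E K] in
theorem card_filter_aeval_eq_zero [DecidableEq E] {P : F[X]} (hP : Irreducible P)
    (hd : P.natDegree = Module.finrank F E) :
    (Finset.univ.filter fun e : E => aeval e P = 0).card = P.natDegree := by
  have hdvd : P.map (algebraMap F E) ∣ X ^ Fintype.card E - X := by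
    have h1 := hP.natDegree_dvd_iff_dvd_X_pow_card_pow_sub_X.mp hd.dvd
    rw [Nat.card_eq_fintype_card, ← Module.card_eq_pow_finrank] at h1
    simpa using Polynomial.map_dvd (algebraMap F E) h1
  have h0 : (X ^ Fintype.card E - X : E[X]) ≠ 0 :=
    FiniteField.X_pow_card_sub_X_ne_zero E Fintype.one_lt_card
  have hs : (X ^ Fintype.card E - X : E[X]).Splits := by
    rw [splits_iff_card_roots, FiniteField.roots_X_pow_card_sub_X,
      FiniteField.X_pow_card_sub_X_natDegree_eq E Fintype.one_lt_card]
    rfl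
  have hle : (P.map (algebraMap F E)).roots ≤ Finset.univ.val := by
    rw [← FiniteField.roots_X_pow_card_sub_X E]
    exact roots.le_of_dvd h0 hdvd
  have hnd := Multiset.nodup_of_le hle Finset.univ.nodup
  rw [← natDegree_map (algebraMap F E), (hs.of_dvd h0 hdvd).natDegree_eq_card_roots,
    ← Multiset.toFinset_card_of_nodup hnd]
  congr 1
  ext e
  rw [Finset.mem_filter, Multiset.mem_toFinset, mem_roots (map_ne_zero hP.ne_zero), IsRoot,
    eval_map_algebraMap]
  simp

theorem natDegree_mul_ncard_eq [DecidableEq E] (hE : (Module.finrank F E).Prime) (g M β : F[X])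
    (k : ℕ) [DecidablePred fun e : E => e ∉ (algebraMap F E).range ∧ M ∣ elemCharp F K e - β ∧
      (g.map (algebraMap F E)).eval e ^ k = 1] :
    Module.finrank F E * {P : F[X] | IsPrimePoly P ∧ P.natDegree = Module.finrank F E ∧
      M ∣ P - β ∧ P ∣ g ^ k - 1}.ncard =
    (Finset.univ.filter fun e : E => e ∉ (algebraMap F E).range ∧ M ∣ elemCharp F K e - β ∧
      (g.map (algebraMap F E)).eval e ^ k = 1).card := by
  classical
  set S := Finset.univ.filter fun e : E => e ∉ (algebraMap F E).range ∧
    M ∣ elemCharp F K e - β ∧ (g.map (algebraMap F E)).eval e ^ k = 1 with hS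
  have hpow : ∀ (e : E) {P : F[X]}, Irreducible P → aeval e P = 0 →
      ((g.map (algebraMap F E)).eval e ^ k = 1 ↔ P ∣ g ^ k - 1) := by
    intro e P hP he
    rw [← hP.dvd_iff_aeval_eq_zero he, map_sub, map_pow, map_one, sub_eq_zero,
      eval_map_algebraMap]
  have hirr : ∀ e : E, e ∉ (algebraMap F E).range → Irreducible (elemCharp F K e) := by
    intro e he
    rw [elemCharp_eq_minpoly K hE he]
    exact minpoly.irreducible (Algebra.IsIntegral.isIntegral e)
  have himg : {P : F[X] | IsPrimePoly P ∧ P.natDegree = Module.finrank F E ∧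
      M ∣ P - β ∧ P ∣ g ^ k - 1} = (S.image (elemCharp F K) : Finset F[X]) := by
    ext P
    rw [Finset.mem_coe, Finset.mem_image, Set.mem_ofPred_eq]
    constructor
    · rintro ⟨⟨hPm, hP⟩, hd, hβ, hk⟩
      have hcard := card_filter_aeval_eq_zero (E := E) hP hd
      obtain ⟨e, he⟩ := Finset.card_pos.mp (hcard.symm ▸ hP.natDegree_pos)
      have he := (Finset.mem_filter.mp he).2
      obtain ⟨heF, rfl⟩ := (elemCharp_eq_iff K hE hPm hP hd).mpr he
      exact ⟨e, Finset.mem_filter.mpr ⟨Finset.mem_univ _, heF, hβ, (hpow e hP he).mpr hk⟩, rfl⟩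
    · rintro ⟨e, he, rfl⟩
      obtain ⟨-, heF, hβ, hk⟩ := Finset.mem_filter.mp he
      exact ⟨⟨elemCharp_monic K e, hirr e heF⟩, natDegree_elemCharp K e, hβ,
        (hpow e (hirr e heF) (aeval_elemCharp K e)).mp hk⟩
  rw [himg, Set.ncard_coe_finset, Finset.card_eq_sum_card_image (elemCharp F K) S, mul_comm,
    ← smul_eq_mul, ← Finset.sum_const]
  refine Finset.sum_congr rfl fun P hP => ?_
  rw [← Finset.mem_coe, ← himg] at hP
  obtain ⟨⟨hPm, hP⟩, hd, hβ, hk⟩ := hP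
  rw [← hd, ← card_filter_aeval_eq_zero (E := E) hP hd, hS, Finset.filter_filter]
  congr 1
  ext e
  rw [Finset.mem_filter, Finset.mem_filter, ← elemCharp_eq_iff K hE hPm hP hd]
  constructor
  · rintro ⟨h1, h2, rfl⟩
    have h3 := (elemCharp_eq_iff K hE hPm hP hd).mp ⟨h2, rfl⟩
    exact ⟨h1, ⟨h2, hβ, (hpow e hP h3).mpr hk⟩, rfl⟩
  · rintro ⟨h1, ⟨h2, -⟩, h3⟩
    exact ⟨h1, h2, h3⟩

theorem abs_card_filter_notMem_sub_le (p : E → Prop) [DecidablePred p] [DecidablePred fun e : E =>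
    e ∉ (algebraMap F E).range ∧ p e] :
    |((Finset.univ.filter fun e : E => e ∉ (algebraMap F E).range ∧ p e).card : ℝ) -
      (Finset.univ.filter p).card| ≤ Fintype.card F := by
  classical
  set S := Finset.univ.filter fun e : E => e ∉ (algebraMap F E).range ∧ p e with hS
  have hsub : S ⊆ Finset.univ.filter p := fun e he =>
    Finset.mem_filter.mpr ⟨Finset.mem_univ _, (Finset.mem_filter.mp he).2.2⟩
  have hle := Finset.card_le_card hsub
  have hle' : (Finset.univ.filter p).card ≤ S.card + Fintype.card F := by
    refine (Finset.card_le_card (t := S ∪ Finset.univ.image (algebraMap F E)) fun e he => ?_).trans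
      ((Finset.card_union_le _ _).trans (Nat.add_le_add_left Finset.card_image_le _))
    rw [Finset.mem_union]
    by_cases heF : e ∈ (algebraMap F E).range
    · obtain ⟨c, rfl⟩ := heF
      exact Or.inr (Finset.mem_image_of_mem _ (Finset.mem_univ c))
    · exact Or.inl (Finset.mem_filter.mpr ⟨Finset.mem_univ _, heF, (Finset.mem_filter.mp he).2⟩)
  have h1 : (S.card : ℝ) ≤ (Finset.univ.filter p).card := by exact_mod_cast hle
  have h2 : ((Finset.univ.filter p).card : ℝ) ≤ S.card + Fintype.card F := by exact_mod_cast hle'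
  rw [abs_le]
  constructor <;> linarith [Nat.cast_nonneg (α := ℝ) (Fintype.card F)]

end PrimeDegree

theorem lt_of_dvd_pow_sub_one {q ℓ r : ℕ} (hq : 0 < q) (hℓ : ℓ.Prime) (hr : r.Prime)
    (h : r ∣ q ^ ℓ - 1) (h1 : ¬ r ∣ q - 1) : ℓ < r := by
  have : Fact r.Prime := ⟨hr⟩
  have hcast : ∀ n : ℕ, 0 < n → ((n : ZMod r) = 1 ↔ r ∣ n - 1) := by
    intro n hn
    rw [← ZMod.natCast_eq_zero_iff, Nat.cast_sub hn, Nat.cast_one, sub_eq_zero]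
  have hpow : (q : ZMod r) ^ ℓ = 1 := by
    rw [← Nat.cast_pow]
    exact (hcast _ (pow_pos hq ℓ)).mpr h
  have hne : (q : ZMod r) ≠ 1 := fun h' => h1 ((hcast q hq).mp h')
  have hord : orderOf (q : ZMod r) = ℓ := orderOf_eq_prime (hp := ⟨hℓ⟩) hpow hne
  have h0 : (q : ZMod r) ≠ 0 := fun h' => by
    rw [h', zero_pow hℓ.ne_zero] at hpow
    exact zero_ne_one hpow
  have hdvd : ℓ ∣ r - 1 := hord ▸ ZMod.orderOf_dvd_card_sub_one h0
  have hle := Nat.le_of_dvd (Nat.sub_pos_of_lt hr.one_lt) hdvd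
  have := hr.one_lt
  omega

end Carlitz

theorem stmt6 (F : Type) [Field F] [Fintype F] (g : Polynomial F)
    (hg_monic : g.Monic) (hg_deg : 0 < g.natDegree) :
    ∃ C : ℝ, 0 < C ∧ ∃ L : ℕ, ∀ ℓ : ℕ, ℓ.Prime → L ≤ ℓ →
      ∀ r : ℕ, r.Prime → r ∣ Fintype.card F ^ ℓ - 1 → ¬ r ∣ Fintype.card F - 1 →
        ∀ M : Polynomial F, M.Monic → (∀ p : Polynomial F, IsPrimePoly p → p ∣ g → p ∣ M) →
          ∀ β : Polynomial F, IsCoprime β M →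
            |({P : Polynomial F | IsPrimePoly P ∧ P.natDegree = ℓ ∧ M ∣ P - β ∧
                P ∣ g ^ ((Fintype.card F ^ ℓ - 1) / r) - 1}.ncard : ℝ) -
              (Fintype.card F : ℝ) ^ ℓ / ((ℓ : ℝ) * r * polyPhi F M)| ≤
            C * (Fintype.card F : ℝ) ^ ((ℓ : ℝ) / 2) * (1 + M.natDegree) / ℓ := by
  classical
  refine ⟨Fintype.card F + g.natDegree + 2, by positivity, g.natDegree, ?_⟩
  intro ℓ hℓ hL r hr hrq hrq1 M hM hgM β hβ
  have hrg : ¬ r ∣ g.natDegree := fun h =>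
    absurd (Nat.le_of_dvd hg_deg h)
      (by have := Carlitz.lt_of_dvd_pow_sub_one Fintype.card_pos hℓ hr hrq hrq1; omega)
  obtain ⟨n, hn⟩ := Carlitz.exists_dvd_pow_of_forall_irreducible_dvd hg_monic.ne_zero
    (M := M) fun p hp hpg => by
      have h1 := hgM (normalize p) ⟨monic_normalize hp.ne_zero,
        (normalize_associated p).symm.irreducible hp⟩
        ((normalize_associated p).dvd.trans hpg)
      exact (normalize_associated p).symm.dvd.trans h1
  obtain ⟨E, _, _, _, _, _, rfl⟩ :=
    Carlitz.exists_extension F (AlgebraicClosure F) hℓ.ne_zero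
  have hQ : Fintype.card F ^ Module.finrank F E = Fintype.card E :=
    Module.card_eq_pow_finrank.symm
  have hQR : (Fintype.card F : ℝ) ^ Module.finrank F E = Fintype.card E := by
    rw [← hQ, Nat.cast_pow]
  have hsqrt : (Fintype.card F : ℝ) ^ ((Module.finrank F E : ℝ) / 2) = √(Fintype.card E) := by
    rw [← hQR, Real.sqrt_eq_rpow, ← Real.rpow_natCast_mul (Nat.cast_nonneg _), mul_one_div]
  rw [hQ] at hrq ⊢
  have hmain := Carlitz.abs_card_sub_le (E := E) (AlgebraicClosure F) hg_monic hM hn hr hrq hrg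
    hrq1 hβ
  have hdiff := Carlitz.abs_card_filter_notMem_sub_le (F := F) fun e : E =>
    M ∣ Carlitz.elemCharp F (AlgebraicClosure F) e - β ∧
      (g.map (algebraMap F E)).eval e ^ ((Fintype.card E - 1) / r) = 1
  rw [← Carlitz.natDegree_mul_ncard_eq (AlgebraicClosure F) hℓ g M β] at hdiff
  have hℓ0 : (0 : ℝ) < Module.finrank F E := Nat.cast_pos.mpr hℓ.pos
  rw [hQR, hsqrt, le_div_iff₀ hℓ0, ← abs_of_pos hℓ0, ← abs_mul, abs_of_pos hℓ0, sub_mul,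
    mul_assoc (Module.finrank F E : ℝ), div_mul_eq_mul_div, mul_comm (Fintype.card E : ℝ),
    mul_div_mul_left _ _ hℓ0.ne', mul_comm _ (Module.finrank F E : ℝ)]
  have htri := (abs_sub_le _ _ _).trans (add_le_add hdiff hmain)
  push_cast at htri
  refine htri.trans ?_
  have hs1 : 1 ≤ √(Fintype.card E : ℝ) :=
    Real.one_le_sqrt.mpr (Nat.one_le_cast.mpr Fintype.card_pos)
  have hq0 : (0 : ℝ) ≤ Fintype.card F := Nat.cast_nonneg _
  have hg0 : (0 : ℝ) ≤ g.natDegree := Nat.cast_nonneg _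
  have hM0 : (0 : ℝ) ≤ M.natDegree := Nat.cast_nonneg _
  calc (Fintype.card F : ℝ) + ((M.natDegree + g.natDegree) * √(Fintype.card E) + M.natDegree)
      ≤ (Fintype.card F + M.natDegree) * √(Fintype.card E) +
        (M.natDegree + g.natDegree) * √(Fintype.card E) := by
        nlinarith [mul_nonneg (add_nonneg hq0 hM0) (sub_nonneg.mpr hs1)]
    _ = (Fintype.card F + g.natDegree + 2 * M.natDegree) * √(Fintype.card E) := by ring
    _ ≤ (Fintype.card F + g.natDegree + 2) * (1 + M.natDegree) * √(Fintype.card E) := by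
        refine mul_le_mul_of_nonneg_right ?_ (Real.sqrt_nonneg _)
        nlinarith [mul_nonneg hq0 hM0, mul_nonneg hg0 hM0]
    _ = (Fintype.card F + g.natDegree + 2) * √(Fintype.card E) * (1 + M.natDegree) := by ring
end

section
/- Let q be a prime power. Then ∑_{r prime, r ∣ q^ℓ − 1, r ∤ q − 1} 1/r → 0 as ℓ → ∞ through prime values; that is, for every ε > 0 there is an L such that for every prime ℓ ≥ L, the sum of 1/r over prime numbers r dividing q^ℓ − 1 but not dividing q − 1 is less than ε. -/
theorem Nat.Prime.dvd_sub_one_of_dvd_pow_sub_one {q ℓ r : ℕ} (hq : 0 < q) (hℓ : ℓ.Prime)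
    (hr : r.Prime) (hdvd : r ∣ q ^ ℓ - 1) (hndvd : ¬ r ∣ q - 1) : ℓ ∣ r - 1 := by
  have := Fact.mk hr
  have := Fact.mk hℓ
  have hpow : (q : ZMod r) ^ ℓ = 1 := by
    have h := (ZMod.natCast_eq_zero_iff (q ^ ℓ - 1) r).2 hdvd
    rw [Nat.cast_sub (Nat.one_le_pow _ _ hq)] at h
    push_cast at h
    exact sub_eq_zero.1 h
  have hne : (q : ZMod r) ≠ 1 := by
    intro h
    apply hndvd
    rw [← ZMod.natCast_eq_zero_iff, Nat.cast_sub hq, h]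
    simp
  have hq0 : (q : ZMod r) ≠ 0 := by
    intro h
    rw [h, zero_pow hℓ.ne_zero] at hpow
    exact zero_ne_one hpow
  rw [← orderOf_eq_prime hpow hne]
  exact orderOf_dvd_of_pow_eq_one (ZMod.pow_card_sub_one_eq_one hq0)

theorem Nat.two_pow_card_primeFactors_le {n : ℕ} (hn : n ≠ 0) :
    2 ^ n.primeFactors.card ≤ n :=
  (Finset.pow_card_le_prod n.primeFactors id 2
    fun _ hp => (Nat.prime_of_mem_primeFactors hp).two_le).trans
    (Nat.le_of_dvd (Nat.pos_of_ne_zero hn) (Nat.prod_primeFactors_dvd n))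

theorem Finset.card_le_of_dvd_sub_one {ℓ T : ℕ} (hℓ : 1 < ℓ) {s : Finset ℕ}
    (hs : ∀ r ∈ s, 1 < r ∧ r ≤ T * ℓ ∧ ℓ ∣ r - 1) : s.card ≤ T := by
  have hform : ∀ r ∈ s, r - 1 = (r - 1) / ℓ * ℓ := fun r hr =>
    (Nat.div_mul_cancel (hs r hr).2.2).symm
  refine (Finset.card_le_card_of_injOn (t := Finset.range T) (fun r => (r - 1) / ℓ) ?_ ?_).trans_eq
    (Finset.card_range T)
  · intro r hr
    obtain ⟨h1, h2, -⟩ := hs r hr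
    simp only [Finset.coe_range, Set.mem_Iio]
    exact (Nat.div_lt_iff_lt_mul (by omega)).2 (by omega)
  · intro a ha b hb hab
    have h1 := hform a ha
    have h2 := hform b hb
    have h3 := (hs a ha).1
    have h4 := (hs b hb).1
    simp only at hab
    rw [hab] at h1
    omega

theorem Finset.sum_one_div_le_of_dvd_sub_one {ℓ T C : ℕ} (hℓ : 1 < ℓ) (hT : 0 < T)
    {s : Finset ℕ} (hs : ∀ r ∈ s, 1 < r ∧ ℓ ∣ r - 1) (hcard : s.card ≤ C * ℓ) :
    ∑ r ∈ s, (1 : ℝ) / r ≤ T / ℓ + C / T := by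
  have hℓ0 : (0 : ℝ) < ℓ := by exact_mod_cast (by omega : 0 < ℓ)
  have hT0 : (0 : ℝ) < T := by exact_mod_cast hT
  rw [← Finset.sum_filter_add_sum_filter_not s (fun r => r ≤ T * ℓ)]
  refine add_le_add ?_ ?_
  · calc ∑ r ∈ s with r ≤ T * ℓ, (1 : ℝ) / r
        ≤ (s.filter (fun r => r ≤ T * ℓ)).card • ((1 : ℝ) / ℓ) := by
          refine Finset.sum_le_card_nsmul _ _ _ fun r hr => ?_
          obtain ⟨h1, h2⟩ := hs r (Finset.mem_filter.1 hr).1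
          have := Nat.le_of_dvd (by omega) h2
          exact one_div_le_one_div_of_le hℓ0 (by exact_mod_cast (by omega : ℓ ≤ r))
      _ ≤ T / ℓ := by
          have : (s.filter (fun r => r ≤ T * ℓ)).card ≤ T :=
            Finset.card_le_of_dvd_sub_one hℓ fun r hr => by
              obtain ⟨hrs, hrT⟩ := Finset.mem_filter.1 hr
              exact ⟨(hs r hrs).1, hrT, (hs r hrs).2⟩
          rw [nsmul_eq_mul, mul_one_div]
          gcongr
  · calc ∑ r ∈ s with ¬ r ≤ T * ℓ, (1 : ℝ) / r
        ≤ (s.filter (fun r => ¬ r ≤ T * ℓ)).card • ((1 : ℝ) / (T * ℓ)) := by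
          refine Finset.sum_le_card_nsmul _ _ _ fun r hr => ?_
          have := (Finset.mem_filter.1 hr).2
          exact one_div_le_one_div_of_le (by positivity)
            (by exact_mod_cast (by omega : T * ℓ ≤ r))
      _ ≤ ((C * ℓ : ℕ) : ℝ) * (1 / (T * ℓ)) := by
          rw [nsmul_eq_mul]
          gcongr
          exact (Finset.card_filter_le _ _).trans hcard
      _ = C / T := by
          push_cast
          field_simp

theorem stmt8 (q : ℕ) (hq : IsPrimePow q) (ε : ℝ) (hε : 0 < ε) :
    ∃ L : ℕ, ∀ ℓ : ℕ, ℓ.Prime → L ≤ ℓ →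
      ∑ r ∈ (q ^ ℓ - 1).primeFactors.filter (fun r => ¬ r ∣ q - 1), (1 : ℝ) / r < ε := by
  have hq2 : 1 < q := hq.one_lt
  obtain ⟨T, hT⟩ := exists_nat_gt (q / (ε / 2))
  have hT0 : (0 : ℝ) < T := lt_of_le_of_lt (by positivity) hT
  obtain ⟨L, hL⟩ := exists_nat_gt (T / (ε / 2))
  refine ⟨L, fun ℓ hℓ hLℓ => ?_⟩
  have hℓ0 : (0 : ℝ) < ℓ := by exact_mod_cast hℓ.pos
  have hTℓ : (T : ℝ) / ℓ < ε / 2 := by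
    have : (L : ℝ) ≤ ℓ := by exact_mod_cast hLℓ
    exact (div_lt_comm₀ (by positivity) hℓ0).1 (hL.trans_le this)
  have hqT : (q : ℝ) / T < ε / 2 := (div_lt_comm₀ (by positivity) hT0).1 hT
  have hn : q ^ ℓ - 1 ≠ 0 := by
    have := Nat.one_lt_pow hℓ.ne_zero hq2
    omega
  have hcard : (q ^ ℓ - 1).primeFactors.card ≤ q * ℓ := by
    refine (Nat.pow_le_pow_iff_right (a := 2) (by norm_num)).1 ?_
    calc 2 ^ (q ^ ℓ - 1).primeFactors.card ≤ q ^ ℓ - 1 := Nat.two_pow_card_primeFactors_le hn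
      _ ≤ q ^ ℓ := Nat.sub_le _ _
      _ ≤ (2 ^ q) ^ ℓ := Nat.pow_le_pow_left Nat.lt_two_pow_self.le ℓ
      _ = 2 ^ (q * ℓ) := (pow_mul 2 q ℓ).symm
  have hsum := Finset.sum_one_div_le_of_dvd_sub_one (T := T) hℓ.one_lt (by exact_mod_cast hT0)
    (s := (q ^ ℓ - 1).primeFactors.filter (fun r => ¬ r ∣ q - 1))
    (fun r hr => by
      obtain ⟨hr, hndvd⟩ := Finset.mem_filter.1 hr
      have hrp := Nat.prime_of_mem_primeFactors hr
      exact ⟨hrp.one_lt, Nat.Prime.dvd_sub_one_of_dvd_pow_sub_one (by omega) hℓ hrp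
        (Nat.dvd_of_mem_primeFactors hr) hndvd⟩)
    ((Finset.card_filter_le _ _).trans hcard)
  linarith
end
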